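/- Assume f satisfies the basic assumptions and hypothesis (H). Suppose c̄*₊ > 0 and c̄*₋ > 0 are the spreading speeds of the Cauchy problem, i.e., for every continuous compactly supported v₀ with 0 ≤ v₀ ≤ p(0,·), v₀ not identically 0, the bounded classical solution v of the Cauchy problem with v(0,·) = v₀ satisfies: sup over −c₂t ≤ x ≤ c₁t of |v(t,x) − p(t,x)| → 0 as t → ∞ whenever −c̄*₋ < −c₂ < c₁ < c̄*₊, and sup over x ∈ (−∞,−c₂'t] ∪ [c₁'t,∞) of v(t,x) → 0 whenever c₂' > c̄*₋ and c₁' > c̄*₊. For each μ > 0 let c*₊,μ > 0 and c*₋,μ > 0 be constants satisfying the conclusion of Theorem 1.1 for the free boundary problem with parameter μ, and assume that for each μ > 0 there exists at least one classical solution of the free boundary problem (1.1) satisfying the spreading hypotheses of Theorem 1.1 (so that c*±,μ are uniquely determined). Then μ ↦ c*₊,μ and μ ↦ c*₋,μ are nondecreasing on (0,∞), and c*₊,μ → c̄*₊ and c*₋,μ → c̄*₋ as μ → ∞. -/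

import Mathlib

open Filter Topology Set

noncomputable section

/-- `u` solves `u_t = d u_xx + f(t,x,u)` classically at every point `(t,x)` of the set `s`:
the spatial function is twice differentiable there and the time derivative exists and
equals `d u_xx + f(t,x,u)`. -/
def SolvesPDE (d : ℝ) (f : ℝ → ℝ → ℝ → ℝ) (u : ℝ → ℝ → ℝ) (s : Set (ℝ × ℝ)) : Prop :=
  ∀ q ∈ s,
    DifferentiableAt ℝ (u q.1) q.2 ∧
    DifferentiableAt ℝ (deriv (u q.1)) q.2 ∧
    HasDerivAt (fun t => u t q.2)
      (d * deriv (deriv (u q.1)) q.2 + f q.1 q.2 (u q.1 q.2)) q.1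

/-- Basic assumptions on the reaction term `f(t,x,u)` (for `u ≥ 0`): continuity,
Hölder continuity of class `C^{α/2,α}` in `(t,x)` locally uniformly in `u`,
`C¹` in `u` uniformly in `(t,x)`, `f(t,x,0) = 0`, nonpositivity for large `u`,
and space-time periodicity. -/
structure BasicAssumptions (ω L : ℝ) (f : ℝ → ℝ → ℝ → ℝ) : Prop where
  cont : ContinuousOn (fun q : ℝ × ℝ × ℝ => f q.1 q.2.1 q.2.2) {q : ℝ × ℝ × ℝ | 0 ≤ q.2.2}
  holder : ∃ α ∈ Set.Ioo (0:ℝ) 1, ∀ R > 0, ∃ C > 0, ∀ t s x y u : ℝ,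
    0 ≤ u → u ≤ R → |f t x u - f s y u| ≤ C * (|t - s| ^ (α / 2) + |x - y| ^ α)
  c1 : ∃ fu : ℝ → ℝ → ℝ → ℝ,
    (∀ t x u : ℝ, 0 ≤ u → HasDerivWithinAt (fun w => f t x w) (fu t x u) (Set.Ici 0) u) ∧
    ∀ ε > 0, ∃ δ > 0, ∀ t x u v : ℝ, 0 ≤ u → 0 ≤ v → |u - v| ≤ δ →
      |fu t x u - fu t x v| ≤ ε
  zero : ∀ t x : ℝ, f t x 0 = 0
  neg_large : ∃ M > 0, ∀ t x u : ℝ, M ≤ u → f t x u ≤ 0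
  per_t : ∀ t x u : ℝ, 0 ≤ u → f (t + ω) x u = f t x u
  per_x : ∀ t x u : ℝ, 0 ≤ u → f t (x + L) u = f t x u

/-- A bounded classical solution of the Cauchy problem
`v_t = d v_xx + f(t,x,v)` on `(0,∞) × ℝ` with initial datum `v₀`. -/
structure IsCauchySolution (d : ℝ) (f : ℝ → ℝ → ℝ → ℝ) (v₀ : ℝ → ℝ) (v : ℝ → ℝ → ℝ) : Prop where
  init : ∀ x, v 0 x = v₀ x
  cont : ContinuousOn (fun q : ℝ × ℝ => v q.1 q.2) {q : ℝ × ℝ | 0 ≤ q.1}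
  pde : SolvesPDE d f v {q : ℝ × ℝ | 0 < q.1}
  bdd : ∃ C, ∀ t ≥ (0:ℝ), ∀ x, |v t x| ≤ C

/-- Hypothesis (H): `p` is the unique positive space-time periodic solution of
`p_t = d p_xx + f(t,x,p)`, and every bounded solution of the Cauchy problem with
initial datum bounded below by a positive constant converges to `p` uniformly. -/
structure HypH (d ω L : ℝ) (f : ℝ → ℝ → ℝ → ℝ) (p : ℝ → ℝ → ℝ) : Prop where
  pos : ∀ t x, 0 < p t x
  per_t : ∀ t x, p (t + ω) x = p t x
  per_x : ∀ t x, p t (x + L) = p t x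
  sol : SolvesPDE d f p Set.univ
  uniq : ∀ q : ℝ → ℝ → ℝ, (∀ t x, 0 < q t x) → (∀ t x, q (t + ω) x = q t x) →
    (∀ t x, q t (x + L) = q t x) → SolvesPDE d f q Set.univ → q = p
  conv : ∀ v₀ : ℝ → ℝ, Continuous v₀ → (∃ C, ∀ x, |v₀ x| ≤ C) →
    (∃ ε > 0, ∀ x, ε ≤ v₀ x) →
    ∀ v : ℝ → ℝ → ℝ, IsCauchySolution d f v₀ v →
    ∀ ε > 0, ∃ S, ∀ s ≥ S, ∀ t ≥ (0:ℝ), ∀ x : ℝ, |v (t + s) x - p (t + s) x| ≤ ε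

/-- The class `H(g₀,h₀)` of admissible initial data on `[g₀,h₀]`. -/
def memH (g₀ h₀ : ℝ) (φ : ℝ → ℝ) : Prop :=
  ContinuousOn φ (Set.Icc g₀ h₀) ∧ φ g₀ = 0 ∧ φ h₀ = 0 ∧ ∀ x ∈ Set.Ioo g₀ h₀, 0 < φ x

/-- A classical solution `(u, g, h)` of the free boundary problem (1.1) with
Stefan constant `μ` and initial data `u₀ ∈ H(g₀,h₀)`, with `u` extended by `0`
outside `[g(t), h(t)]`. -/
structure IsFBPSolution (d μ : ℝ) (f : ℝ → ℝ → ℝ → ℝ) (g₀ h₀ : ℝ) (u₀ : ℝ → ℝ)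
    (u : ℝ → ℝ → ℝ) (g h : ℝ → ℝ) : Prop where
  g_init : g 0 = g₀
  h_init : h 0 = h₀
  g_smooth : ContDiffOn ℝ 1 g (Set.Ici 0)
  h_smooth : ContDiffOn ℝ 1 h (Set.Ici 0)
  u_cont : ContinuousOn (fun q : ℝ × ℝ => u q.1 q.2)
    {q : ℝ × ℝ | 0 ≤ q.1 ∧ g q.1 ≤ q.2 ∧ q.2 ≤ h q.1}
  pde : SolvesPDE d f u {q : ℝ × ℝ | 0 < q.1 ∧ g q.1 < q.2 ∧ q.2 < h q.1}
  bc_left : ∀ t > (0:ℝ), u t (g t) = 0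
  bc_right : ∀ t > (0:ℝ), u t (h t) = 0
  stefan_left : ∀ t > (0:ℝ),
    HasDerivAt g (-μ * derivWithin (u t) (Set.Ici (g t)) (g t)) t
  stefan_right : ∀ t > (0:ℝ),
    HasDerivAt h (-μ * derivWithin (u t) (Set.Iic (h t)) (h t)) t
  init : ∀ x ∈ Set.Icc g₀ h₀, u 0 x = u₀ x
  ext : ∀ t ≥ (0:ℝ), ∀ x : ℝ, (x < g t ∨ h t < x) → u t x = 0

/-- The conclusion of Theorem 1.1 with leftward speed `cminus` and rightward speed `cplus`. -/
def Theorem11Conclusion (d μ : ℝ) (f : ℝ → ℝ → ℝ → ℝ) (p : ℝ → ℝ → ℝ)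
    (cminus cplus : ℝ) : Prop :=
  ∀ (g₀ h₀ : ℝ), g₀ < h₀ → ∀ u₀ : ℝ → ℝ, memH g₀ h₀ u₀ →
    (∀ x ∈ Set.Icc g₀ h₀, u₀ x ≤ p 0 x) →
    ∀ (u : ℝ → ℝ → ℝ) (g h : ℝ → ℝ), IsFBPSolution d μ f g₀ h₀ u₀ u g h →
    Tendsto h atTop atTop → Tendsto g atTop atBot →
    (∀ A > (0:ℝ), ∀ ε > 0, ∃ T, ∀ t ≥ T, ∀ x ∈ Set.Icc (-A) A, |u t x - p t x| ≤ ε) →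
    (∀ c₁ c₂ : ℝ, -cminus < -c₂ → -c₂ < c₁ → c₁ < cplus →
        ∀ ε > 0, ∃ T, ∀ t ≥ T, ∀ x ∈ Set.Icc (-c₂ * t) (c₁ * t), |u t x - p t x| ≤ ε) ∧
    Tendsto (fun t => g t / t) atTop (𝓝 (-cminus)) ∧
    Tendsto (fun t => h t / t) atTop (𝓝 cplus)

section
/-- `φ` is twice differentiable at `x` with second derivative `b`. -/
def D2 (φ : ℝ → ℝ) (x b : ℝ) : Prop :=
  ∃ φ' : ℝ → ℝ, (∀ᶠ y in 𝓝 x, HasDerivAt φ (φ' y) y) ∧ HasDerivAt φ' b x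

theorem D2.congr {φ ψ : ℝ → ℝ} {x b : ℝ} (h : D2 φ x b) (he : ψ =ᶠ[𝓝 x] φ) : D2 ψ x b := by
  obtain ⟨φ', h1, h2⟩ := h
  refine ⟨φ', ?_, h2⟩
  filter_upwards [h1, he.eventually_nhds] with y hy hy2
  exact hy.congr_of_eventuallyEq hy2

theorem D2.add {φ ψ : ℝ → ℝ} {x b c : ℝ} (h : D2 φ x b) (k : D2 ψ x c) :
    D2 (fun y => φ y + ψ y) x (b + c) := by
  obtain ⟨φ', h1, h2⟩ := h
  obtain ⟨ψ', k1, k2⟩ := k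
  refine ⟨fun y => φ' y + ψ' y, ?_, h2.add k2⟩
  filter_upwards [h1, k1] with y hy hy2
  exact hy.add hy2

theorem D2.const_mul {φ : ℝ → ℝ} {x b : ℝ} (h : D2 φ x b) (a : ℝ) :
    D2 (fun y => a * φ y) x (a * b) := by
  obtain ⟨φ', h1, h2⟩ := h
  refine ⟨fun y => a * φ' y, ?_, h2.const_mul a⟩
  filter_upwards [h1] with y hy
  exact hy.const_mul a

theorem D2.sub {φ ψ : ℝ → ℝ} {x b c : ℝ} (h : D2 φ x b) (k : D2 ψ x c) :
    D2 (fun y => φ y - ψ y) x (b - c) := by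
  have := h.add (k.const_mul (-1))
  convert this using 1
  · funext y; ring
  · ring

theorem D2.const (a x : ℝ) : D2 (fun _ => a) x 0 :=
  ⟨fun _ => 0, Eventually.of_forall fun y => hasDerivAt_const y a, hasDerivAt_const x 0⟩

theorem D2.of_hasDerivAt {φ φ' : ℝ → ℝ} {x b : ℝ} (h : ∀ y, HasDerivAt φ (φ' y) y)
    (h2 : HasDerivAt φ' b x) : D2 φ x b := ⟨φ', Eventually.of_forall h, h2⟩

theorem D2.nonpos {φ : ℝ → ℝ} {x b : ℝ} (h : D2 φ x b) (hm : IsLocalMax φ x) : b ≤ 0 := by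
  obtain ⟨φ', h1, h2⟩ := h
  by_contra hb
  push Not at hb
  have e1 : deriv φ =ᶠ[𝓝 x] φ' := by
    filter_upwards [h1] with y hy
    exact hy.deriv
  have e2 : deriv (deriv φ) x = b := by rw [e1.deriv_eq, h2.deriv]
  have hmin : IsLocalMin φ x :=
    isLocalMin_of_deriv_deriv_pos (by rw [e2]; exact hb) hm.deriv_eq_zero
      h1.self_of_nhds.continuousAt
  have e3 : φ =ᶠ[𝓝 x] fun _ => φ x := by
    filter_upwards [hm, hmin] with y h3 h4
    exact le_antisymm h3 h4
  have e4 : deriv φ =ᶠ[𝓝 x] fun _ => 0 := by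
    have := e3.deriv
    simpa using this
  have e5 : deriv (deriv φ) x = 0 := by rw [e4.deriv_eq]; simp
  rw [e5] at e2
  exact hb.ne e2

/-- Parabolic derivatives at a point: `z_xx = b` and `z_t = c`. -/
def PD (z : ℝ → ℝ → ℝ) (t x b c : ℝ) : Prop :=
  D2 (z t) x b ∧ HasDerivAt (fun s => z s x) c t

theorem PD.sub {z w : ℝ → ℝ → ℝ} {t x b c b' c' : ℝ} (h : PD z t x b c) (k : PD w t x b' c') :
    PD (fun s y => z s y - w s y) t x (b - b') (c - c') := ⟨h.1.sub k.1, h.2.sub k.2⟩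

theorem PD.add {z w : ℝ → ℝ → ℝ} {t x b c b' c' : ℝ} (h : PD z t x b c) (k : PD w t x b' c') :
    PD (fun s y => z s y + w s y) t x (b + b') (c + c') := ⟨h.1.add k.1, h.2.add k.2⟩

theorem PD.congr {z w : ℝ → ℝ → ℝ} {t x b c : ℝ} (h : PD z t x b c)
    (e : ∀ᶠ q in 𝓝 (t, x), w q.1 q.2 = z q.1 q.2) : PD w t x b c := by
  refine ⟨h.1.congr ?_, h.2.congr_of_eventuallyEq ?_⟩
  · have : Tendsto (fun y : ℝ => (t, y)) (𝓝 x) (𝓝 (t, x)) :=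
      (Continuous.tendsto (by fun_prop) x)
    exact this.eventually e
  · have : Tendsto (fun s : ℝ => (s, x)) (𝓝 t) (𝓝 (t, x)) :=
      (Continuous.tendsto (by fun_prop) t)
    exact this.eventually e

theorem SolvesPDE.pd {d : ℝ} {f : ℝ → ℝ → ℝ → ℝ} {u : ℝ → ℝ → ℝ} {s : Set (ℝ × ℝ)}
    (h : SolvesPDE d f u s) {t x : ℝ} (hx : ∀ᶠ y in 𝓝 x, (t, y) ∈ s) :
    ∃ b, PD u t x b (d * b + f t x (u t x)) := by
  refine ⟨deriv (deriv (u t)) x, ⟨deriv (u t), ?_, ?_⟩, (h _ hx.self_of_nhds).2.2⟩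
  · filter_upwards [hx] with y hy
    exact (h _ hy).1.hasDerivAt
  · exact (h _ hx.self_of_nhds).2.1.hasDerivAt

theorem deriv_nonneg_of_left_max {ψ : ℝ → ℝ} {c t : ℝ} (h : HasDerivAt ψ c t)
    (hm : ∀ᶠ s in 𝓝[<] t, ψ s ≤ ψ t) : 0 ≤ c := by
  have h1 := (hasDerivAt_iff_tendsto_slope_left_right.1 h).1
  refine ge_of_tendsto h1 ?_
  filter_upwards [hm, self_mem_nhdsWithin] with s hs hs2
  rw [slope_def_field]
  apply div_nonneg_of_nonpos
  · linarith
  · simp only [mem_Iio] at hs2; linarith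

theorem deriv_nonpos_of_left_min {ψ : ℝ → ℝ} {c t : ℝ} (h : HasDerivAt ψ c t)
    (hm : ∀ᶠ s in 𝓝[<] t, ψ t ≤ ψ s) : c ≤ 0 := by
  have := deriv_nonneg_of_left_max h.neg (by filter_upwards [hm] with s hs; simpa using hs)
  linarith

theorem max_principle_compact {d K : ℝ} (hd : 0 ≤ d) {S : Set (ℝ × ℝ)} (hS : IsCompact S)
    {z : ℝ → ℝ → ℝ} (hz : ContinuousOn (fun q : ℝ × ℝ => z q.1 q.2) S)
    (H : ∀ t x, (t, x) ∈ S → 0 < z t x → (∀ᶠ y in 𝓝 x, (t, y) ∈ S) ∧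
      (∀ᶠ s in 𝓝[<] t, (s, x) ∈ S) ∧ ∃ b c, PD z t x b c ∧ c ≤ d * b + K * z t x) :
    ∀ t x, (t, x) ∈ S → z t x ≤ 0 := by
  intro t₀ x₀ h0
  by_contra hpos
  push Not at hpos
  have hc : ContinuousOn (fun q : ℝ × ℝ => Real.exp (-(K + 1) * q.1) * z q.1 q.2) S :=
    ContinuousOn.mul (by fun_prop) hz
  obtain ⟨⟨t, x⟩, hq, hmax⟩ := hS.exists_isMaxOn ⟨_, h0⟩ hc
  have hzq : 0 < z t x := by
    have h1 := hmax h0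
    simp only [mem_setOf_eq] at h1
    have h2 : 0 < Real.exp (-(K + 1) * t₀) * z t₀ x₀ := by positivity
    have h3 := h2.trans_le h1
    exact (mul_pos_iff_of_pos_left (Real.exp_pos _)).1 h3
  obtain ⟨hx, ht, b, c, hpd, hle⟩ := H t x hq hzq
  have hb : b ≤ 0 := by
    refine hpd.1.nonpos ?_
    filter_upwards [hx] with y hy
    have := hmax hy
    simp only [mem_setOf_eq] at this
    exact (mul_le_mul_iff_right₀ (Real.exp_pos _)).1 this
  have hder : HasDerivAt (fun s => Real.exp (-(K + 1) * s) * z s x)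
      (Real.exp (-(K + 1) * t) * (-(K + 1)) * z t x + Real.exp (-(K + 1) * t) * c) t := by
    refine HasDerivAt.mul ?_ hpd.2
    have := ((hasDerivAt_id t).const_mul (-(K + 1))).exp
    simpa using this
  have hc0 := deriv_nonneg_of_left_max hder (by
    filter_upwards [ht] with s hs
    exact hmax hs)
  have hc1 : 0 ≤ Real.exp (-(K + 1) * t) * (c - (K + 1) * z t x) := by linarith
  have hc2 : 0 ≤ c - (K + 1) * z t x := (mul_nonneg_iff_of_pos_left (Real.exp_pos _)).1 hc1
  nlinarith

theorem max_principle_strip {d K T C : ℝ} (hd : 0 ≤ d) 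
    {z : ℝ → ℝ → ℝ} (hz : ContinuousOn (fun q : ℝ × ℝ => z q.1 q.2) (Icc 0 T ×ˢ univ))
    (hC : ∀ t ∈ Icc 0 T, ∀ x, z t x ≤ C) (h0 : ∀ x, z 0 x ≤ 0)
    (H : ∀ t ∈ Ioc 0 T, ∀ x, 0 < z t x → ∃ b c, PD z t x b c ∧ c ≤ d * b + K * z t x) :
    ∀ t ∈ Icc 0 T, ∀ x, z t x ≤ 0 := by
  -- first the estimate with a penalty
  have key : ∀ ε > 0, ∀ t ∈ Icc 0 T, ∀ x,
      Real.exp (-K * t) * z t x - ε * (x ^ 2 + (2 * d + 1) * t + 1) ≤ 0 := by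
    intro ε hε
    obtain ⟨B, hB0, hB⟩ : ∃ B > 0, ∀ t ∈ Icc 0 T, ∀ x, Real.exp (-K * t) * z t x ≤ B := by
      obtain ⟨E, hE⟩ := (isCompact_Icc (a := (0:ℝ)) (b := T)).exists_bound_of_continuousOn
        (f := fun t => Real.exp (-K * t)) (by fun_prop)
      refine ⟨|E| * |C| + 1, by positivity, fun t ht x => ?_⟩
      have h1 : Real.exp (-K * t) ≤ |E| := by
        have := hE t ht
        rw [Real.norm_eq_abs, abs_of_pos (Real.exp_pos _)] at this
        exact this.trans (le_abs_self _)
      have h2 : z t x ≤ |C| := (hC t ht x).trans (le_abs_self _)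
      have h3 : Real.exp (-K * t) * z t x ≤ Real.exp (-K * t) * |C| := by gcongr
      have h4 : Real.exp (-K * t) * |C| ≤ |E| * |C| := by gcongr
      linarith
    have hbig : ∀ t ∈ Icc 0 T, ∀ x, B / ε ≤ x ^ 2 →
        Real.exp (-K * t) * z t x - ε * (x ^ 2 + (2 * d + 1) * t + 1) ≤ 0 := by
      intro t ht x hx
      have h1 := hB t ht x
      have h2 : B ≤ x ^ 2 * ε := by rwa [div_le_iff₀ hε] at hx
      have h3 : 0 ≤ ε * ((2 * d + 1) * t + 1) := by
        have := ht.1; positivity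
      nlinarith
    intro t ht x
    set R := B / ε + 1 with hR
    have hBe : 0 < B / ε := by positivity
    have hR1 : B / ε ≤ R ^ 2 := by nlinarith
    by_cases hxR : |x| ≤ R
    swap
    · refine hbig t ht x ?_
      push Not at hxR
      rw [← sq_abs x]
      nlinarith
    refine max_principle_compact (d := d) (K := 0) hd (S := Icc 0 T ×ˢ Icc (-R) R)
      (isCompact_Icc.prod isCompact_Icc)
      (z := fun t x => Real.exp (-K * t) * z t x - ε * (x ^ 2 + (2 * d + 1) * t + 1))
      ?_ ?_ t x ⟨ht, abs_le.1 hxR⟩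
    · refine ContinuousOn.sub (ContinuousOn.mul (by fun_prop) (hz.mono ?_)) (by fun_prop)
      exact prod_mono subset_rfl (subset_univ _)
    · intro t x ⟨ht, hx⟩ hpos
      simp only at ht hx
      have hxs : x ^ 2 < B / ε := by
        by_contra hcon
        push Not at hcon
        exact absurd (hbig t ht x hcon) (not_le.2 hpos)
      have hx1 : -R < x ∧ x < R := by
        constructor <;> nlinarith
      have ht0 : 0 < t := by
        rcases ht.1.eq_or_lt with h | h
        · exfalso
          subst h
          have := h0 x
          have h5 : 0 ≤ ε * (x ^ 2 + (2 * d + 1) * 0 + 1) := by positivity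
          simp only [mul_zero, Real.exp_zero, one_mul] at hpos
          nlinarith
        · exact h
      have hzp : 0 < z t x := by
        have h5 : 0 ≤ ε * (x ^ 2 + (2 * d + 1) * t + 1) := by positivity
        have : 0 < Real.exp (-K * t) * z t x := by linarith
        exact (mul_pos_iff_of_pos_left (Real.exp_pos _)).1 this
      obtain ⟨b, c, hpd, hle⟩ := H t ⟨ht0, ht.2⟩ x hzp
      refine ⟨?_, ?_, Real.exp (-K * t) * b - ε * 2,
        (Real.exp (-K * t) * (-K) * z t x + Real.exp (-K * t) * c) - ε * (2 * d + 1), ⟨?_, ?_⟩, ?_⟩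
      · filter_upwards [Ioo_mem_nhds hx1.1 hx1.2] with y hy
        exact ⟨ht, hy.1.le, hy.2.le⟩
      · filter_upwards [Ioo_mem_nhdsLT ht0] with s hs
        exact ⟨⟨hs.1.le, hs.2.le.trans ht.2⟩, hx⟩
      · refine (hpd.1.const_mul _).sub ?_
        refine D2.of_hasDerivAt (φ' := fun y => ε * (2 * y)) ?_ ?_
        · intro y
          have := ((((hasDerivAt_id y).pow 2).add_const ((2 * d + 1) * t)).add_const 1).const_mul ε
          simpa using this
        · have := ((hasDerivAt_id x).const_mul 2).const_mul ε
          simpa using this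
      · refine HasDerivAt.sub ?_ ?_
        · refine HasDerivAt.mul ?_ hpd.2
          have := ((hasDerivAt_id t).const_mul (-K)).exp
          simpa using this
        · have := ((((hasDerivAt_id t).const_mul (2 * d + 1)).const_add (x ^ 2)).add_const 1).const_mul ε
          simpa using this
      · have hE : 0 < Real.exp (-K * t) := Real.exp_pos _
        have : Real.exp (-K * t) * (c - K * z t x) ≤ Real.exp (-K * t) * (d * b) := by
          gcongr; linarith
        nlinarith
  intro t ht x
  have hlim : Tendsto (fun ε : ℝ => ε * (x ^ 2 + (2 * d + 1) * t + 1)) (𝓝[>] 0) (𝓝 0) := by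
    have : Tendsto (fun ε : ℝ => ε * (x ^ 2 + (2 * d + 1) * t + 1)) (𝓝 0)
        (𝓝 (0 * (x ^ 2 + (2 * d + 1) * t + 1))) := Continuous.tendsto (by fun_prop) 0
    rw [zero_mul] at this
    exact this.mono_left nhdsWithin_le_nhds
  have : Real.exp (-K * t) * z t x ≤ 0 := by
    refine ge_of_tendsto hlim ?_
    filter_upwards [self_mem_nhdsWithin] with ε hε
    have := key ε hε t ht x
    linarith
  by_contra hcon
  push Not at hcon
  have : 0 < Real.exp (-K * t) * z t x := by positivity
  linarith

end

section
/-- algebraic core of the expanding bump -/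
theorem bump_alg {d K σ ℓ ℓ0 ℓ1 lam k s E : ℝ} (hd : 0 < d) (hσ : 0 ≤ σ)
    (hℓ0 : 0 < ℓ0) (h0 : ℓ0 ≤ ℓ) (h1 : ℓ ≤ ℓ1) (hlam : lam = 2 + σ * ℓ1 / d)
    (hk : k = K + 1 + 2 * lam * (σ * ℓ1 + d) / ℓ0 ^ 2 / (1 - Real.exp (-(lam / 2))))
    (hs : 0 ≤ s) (hs1 : s ≤ 1) (hE : E = Real.exp (lam * (1 - s))) :
    -k * (E - 1) + E * (2 * lam * s * σ / ℓ) ≤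
      d * (E * (4 * lam ^ 2 * s - 2 * lam) / ℓ ^ 2) - K * (E - 1) := by
  have hℓ : 0 < ℓ := hℓ0.trans_le h0
  have hℓ1 : 0 < ℓ1 := hℓ.trans_le h1
  have hlam2 : 2 ≤ lam := by rw [hlam]; have : 0 ≤ σ * ℓ1 / d := by positivity
                             linarith
  have hlamd : lam * d = 2 * d + σ * ℓ1 := by rw [hlam]; field_simp
  have hE1 : 1 ≤ E := by
    rw [hE]; apply Real.one_le_exp; apply mul_nonneg <;> linarith
  set q := Real.exp (-(lam / 2)) with hq
  have hq1 : q < 1 := by rw [hq, Real.exp_lt_one_iff]; linarith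
  have hq0 : 0 < 1 - q := by linarith
  set G := 2 * lam * (σ * ℓ1 + d) / ℓ0 ^ 2 with hG
  have hG0 : 0 ≤ G := by positivity
  have hkK : 0 ≤ k - K := by
    rw [hk]; have : 0 ≤ G / (1 - q) := by positivity
    linarith
  -- the bracket
  have hbr : E * (2 * lam * s * σ / ℓ) - d * (E * (4 * lam ^ 2 * s - 2 * lam) / ℓ ^ 2)
      = E * (2 * lam / ℓ ^ 2) * (s * σ * ℓ - d * (2 * lam * s - 1)) := by
    field_simp
    ring
  have hσℓ : σ * ℓ ≤ σ * ℓ1 := by gcongr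
  suffices h : E * (2 * lam / ℓ ^ 2) * (s * σ * ℓ - d * (2 * lam * s - 1)) ≤ (k - K) * (E - 1) by
    linarith
  have hfac : 0 ≤ E * (2 * lam / ℓ ^ 2) := by positivity
  by_cases hs2 : s ≤ 1 / 2
  · have hEq : E * (1 - q) ≤ E - 1 := by
      have h3 : 1 ≤ E * q := by
        rw [hE, hq, ← Real.exp_add]
        apply Real.one_le_exp
        nlinarith
      nlinarith
    have hb1 : s * σ * ℓ - d * (2 * lam * s - 1) ≤ σ * ℓ1 + d := by
      have h4 : s * (σ * ℓ) ≤ 1 * (σ * ℓ1) := by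
        apply mul_le_mul hs1 hσℓ (by positivity) (by norm_num)
      have h5 : 0 ≤ d * (2 * lam * s) := by positivity
      nlinarith
    have hb2 : 2 * lam / ℓ ^ 2 ≤ 2 * lam / ℓ0 ^ 2 := by gcongr
    calc E * (2 * lam / ℓ ^ 2) * (s * σ * ℓ - d * (2 * lam * s - 1))
        ≤ E * (2 * lam / ℓ ^ 2) * (σ * ℓ1 + d) := by gcongr
      _ ≤ E * (2 * lam / ℓ0 ^ 2) * (σ * ℓ1 + d) := by gcongr
      _ = E * G := by rw [hG]; ring
      _ = G / (1 - q) * (E * (1 - q)) := by field_simp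
      _ ≤ G / (1 - q) * (E - 1) := by gcongr
      _ ≤ (k - K) * (E - 1) := by
          gcongr
          rw [hk]; linarith
  · push Not at hs2
    have hneg : s * σ * ℓ - d * (2 * lam * s - 1) ≤ 0 := by
      have h7 : s * (σ * ℓ) ≤ s * (σ * ℓ1) := by gcongr
      have h8 : d * (2 * lam * s - 1) = 2 * s * (lam * d) - d := by ring
      rw [h8, hlamd]
      have h9 : 0 ≤ s * (σ * ℓ1) := by positivity
      nlinarith
    have h6 := mul_nonneg hkK (by linarith : 0 ≤ E - 1)
    nlinarith [mul_nonneg hfac (neg_nonneg.2 hneg)]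

/-- Expanding bump: a nonnegative supersolution that is at least `m` on an interval stays above
an explicit expanding bump. -/
theorem bump_below {d K ℓ0 σ T m θ : ℝ} (hd : 0 < d) (hK : 0 ≤ K) (hℓ0 : 0 < ℓ0) (hσ : 0 ≤ σ)
    (hT : 0 ≤ T) (hm : 0 < m) (hθ : 0 < θ) :
    ∃ c > 0, ∀ (z : ℝ → ℝ → ℝ) (t0 xc T' : ℝ), 0 ≤ T' → T' ≤ T →
      ContinuousOn (fun q : ℝ × ℝ => z q.1 q.2)
        {q : ℝ × ℝ | t0 ≤ q.1 ∧ q.1 ≤ t0 + T' ∧ |q.2 - xc| ≤ ℓ0 + σ * (q.1 - t0)} →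
      (∀ x, |x - xc| ≤ ℓ0 → m ≤ z t0 x) →
      (∀ t x, t0 ≤ t → t ≤ t0 + T' → |x - xc| ≤ ℓ0 + σ * (t - t0) → 0 ≤ z t x) →
      (∀ t x, t0 < t → t ≤ t0 + T' → |x - xc| < ℓ0 + σ * (t - t0) → z t x < θ →
        ∃ b c', PD z t x b c' ∧ d * b - K * z t x ≤ c') →
      ∀ t x, t0 ≤ t → t ≤ t0 + T' → |x - xc| ≤ ℓ0 + σ * (t - t0) →
        c * ((ℓ0 + σ * (t - t0)) ^ 2 - (x - xc) ^ 2) ≤ z t x := by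
  set ℓ1 := ℓ0 + σ * T with hℓ1
  have hℓ1p : 0 < ℓ1 := by positivity
  obtain ⟨lam, hlam⟩ : ∃ lam, lam = 2 + σ * ℓ1 / d := ⟨_, rfl⟩
  obtain ⟨k, hk⟩ : ∃ k, k = K + 1 + 2 * lam * (σ * ℓ1 + d) / ℓ0 ^ 2 / (1 - Real.exp (-(lam / 2))) :=
    ⟨_, rfl⟩
  have hlam2 : 2 ≤ lam := by
    rw [hlam]; have : 0 ≤ σ * ℓ1 / d := by positivity
    linarith
  have hk0 : 0 ≤ k := by
    have : Real.exp (-(lam / 2)) < 1 := by rw [Real.exp_lt_one_iff]; linarith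
    have : 0 < 1 - Real.exp (-(lam / 2)) := by linarith
    rw [hk]; positivity
  set A := min m θ * Real.exp (-lam) / 2 with hA
  have hmin : 0 < min m θ := lt_min hm hθ
  have hA0 : 0 < A := by positivity
  have hAe : A * Real.exp lam = min m θ / 2 := by
    rw [hA]; rw [div_mul_eq_mul_div, mul_assoc, ← Real.exp_add]; simp
  refine ⟨A * Real.exp (-k * T) * lam / ℓ1 ^ 2, by positivity, ?_⟩
  intro z t0 xc T' hT'0 hT' hcont hbot hnn hpde
  set S := {q : ℝ × ℝ | t0 ≤ q.1 ∧ q.1 ≤ t0 + T' ∧ |q.2 - xc| ≤ ℓ0 + σ * (q.1 - t0)} with hS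
  set ℓ : ℝ → ℝ := fun t => ℓ0 + σ * (t - t0) with hℓ
  set w : ℝ → ℝ → ℝ := fun t x =>
    A * (Real.exp (-k * (t - t0)) * (Real.exp (lam * (1 - (x - xc) ^ 2 / (ℓ t) ^ 2)) - 1)) with hw
  have hℓb : ∀ t, t0 ≤ t → t ≤ t0 + T' → ℓ0 ≤ ℓ t ∧ ℓ t ≤ ℓ1 := by
    intro t h1 h2
    simp only [hℓ, hℓ1]
    have : 0 ≤ σ * (t - t0) := mul_nonneg hσ (by linarith)
    have : σ * (t - t0) ≤ σ * T := by gcongr; linarith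
    constructor <;> linarith
  have hs01 : ∀ t x, t0 ≤ t → t ≤ t0 + T' → |x - xc| ≤ ℓ t →
      0 ≤ (x - xc) ^ 2 / (ℓ t) ^ 2 ∧ (x - xc) ^ 2 / (ℓ t) ^ 2 ≤ 1 := by
    intro t x h1 h2 h3
    have h4 := (hℓb t h1 h2).1
    have h5 : 0 < ℓ t := by linarith
    refine ⟨by positivity, ?_⟩
    rw [div_le_one (by positivity), ← sq_abs (x - xc)]
    gcongr
  have hwle : ∀ t x, t0 ≤ t → t ≤ t0 + T' → |x - xc| ≤ ℓ t → w t x ≤ min m θ / 2 := by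
    intro t x h1 h2 h3
    obtain ⟨h4, h5⟩ := hs01 t x h1 h2 h3
    rw [← hAe]
    simp only [hw]
    have h6 : Real.exp (-k * (t - t0)) ≤ 1 := by
      apply Real.exp_le_one_iff.2
      have : 0 ≤ k * (t - t0) := mul_nonneg hk0 (by linarith)
      linarith
    have h7 : Real.exp (lam * (1 - (x - xc) ^ 2 / (ℓ t) ^ 2)) ≤ Real.exp lam := by
      apply Real.exp_le_exp.2
      nlinarith
    have h8 : 1 ≤ Real.exp (lam * (1 - (x - xc) ^ 2 / (ℓ t) ^ 2)) := by
      apply Real.one_le_exp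
      apply mul_nonneg <;> linarith
    have h9 : Real.exp (-k * (t - t0)) * (Real.exp (lam * (1 - (x - xc) ^ 2 / (ℓ t) ^ 2)) - 1)
        ≤ 1 * (Real.exp lam - 0) := by
      apply mul_le_mul h6 (by linarith) (by linarith) (by norm_num)
    calc _ ≤ A * (1 * (Real.exp lam - 0)) := by gcongr
      _ = _ := by ring
  have hScomp : IsCompact S := by
    have hclosed : IsClosed S := by
      simp only [hS, Set.ofPred_and]
      refine (isClosed_le (by fun_prop) (by fun_prop)).inter
        ((isClosed_le (by fun_prop) (by fun_prop)).inter (isClosed_le (by fun_prop) (by fun_prop)))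
    refine (isCompact_Icc.prod (isCompact_Icc (a := xc - ℓ1) (b := xc + ℓ1))).of_isClosed_subset
      (s := Icc t0 (t0 + T') ×ˢ Icc (xc - ℓ1) (xc + ℓ1)) hclosed ?_
    rintro ⟨t, x⟩ ⟨h1, h2, h3⟩
    have h4 := (hℓb t h1 h2).2
    have h5 := abs_le.1 (h3.trans h4)
    exact ⟨⟨h1, h2⟩, by constructor <;> linarith [h5.1, h5.2]⟩
  have hwz : ∀ t x, (t, x) ∈ S → w t x - z t x ≤ 0 := by
    refine max_principle_compact (d := d) (K := 0) hd.le hScomp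
      (z := fun t x => w t x - z t x) ?_ ?_
    · refine ContinuousOn.sub ?_ hcont
      simp only [hw, hℓ]
      have hne : ∀ q ∈ S, (ℓ0 + σ * (q.1 - t0)) ^ 2 ≠ 0 := by
        intro q hq
        have := (hℓb q.1 hq.1 hq.2.1).1
        simp only [hℓ] at this
        have : 0 < ℓ0 + σ * (q.1 - t0) := by linarith
        positivity
      have hdiv : ContinuousOn (fun q : ℝ × ℝ => (q.2 - xc) ^ 2 / (ℓ0 + σ * (q.1 - t0)) ^ 2) S :=
        ContinuousOn.div (by fun_prop) (by fun_prop) hne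
      refine continuousOn_const.mul (ContinuousOn.mul (by fun_prop) (ContinuousOn.sub ?_ continuousOn_const))
      exact (continuousOn_const.mul (continuousOn_const.sub hdiv)).rexp
    · intro t x ⟨h1, h2, h3⟩ hpos
      simp only at h1 h2 h3
      have hz0 := hnn t x h1 h2 h3
      have hℓt := hℓb t h1 h2
      have hℓtp : 0 < ℓ t := by linarith [hℓt.1]
      have h3' : |x - xc| < ℓ0 + σ * (t - t0) := by
        rcases h3.lt_or_eq with h | h
        · exact h
        · exfalso
          have : w t x = 0 := by
            simp only [hw]
            have : (x - xc) ^ 2 / (ℓ t) ^ 2 = 1 := by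
              rw [div_eq_one_iff_eq (by positivity), ← sq_abs (x - xc), h]
            rw [this]; simp
          linarith
      have ht0 : t0 < t := by
        rcases h1.lt_or_eq with h | h
        · exact h
        · exfalso
          subst h
          have h4 := hwle t0 x le_rfl h2 h3
          have h5 := hbot x (by simpa using h3)
          have := min_le_left m θ
          linarith
      have hzθ : z t x < θ := by
        have h4 := hwle t x h1 h2 h3
        have := min_le_right m θ
        linarith
      obtain ⟨b, c', hpd, hle⟩ := hpde t x ht0 h2 h3' hzθ
      obtain ⟨E, hE⟩ : ∃ E, E = Real.exp (lam * (1 - (x - xc) ^ 2 / (ℓ t) ^ 2)) := ⟨_, rfl⟩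
      obtain ⟨X, hX⟩ : ∃ X, X = Real.exp (-k * (t - t0)) := ⟨_, rfl⟩
      have hX0 : 0 < X := by rw [hX]; exact Real.exp_pos _
      obtain ⟨hs, hs1⟩ := hs01 t x h1 h2 h3
      have alg := bump_alg (K := K) (lam := lam) (k := k) hd hσ hℓ0 hℓt.1 hℓt.2 hlam hk hs hs1 hE
      have hpdw : PD w t x
          (A * (X * (E * (4 * lam ^ 2 * ((x - xc) ^ 2 / (ℓ t) ^ 2) - 2 * lam) / (ℓ t) ^ 2)))
          (A * (X * (-k * (E - 1) + E * (2 * lam * ((x - xc) ^ 2 / (ℓ t) ^ 2) * σ / ℓ t)))) := by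
        constructor
        · refine D2.const_mul (D2.const_mul ?_ _ |> fun h => hX ▸ h) A
          have hR : ∀ y, HasDerivAt (fun y => lam * (1 - (y - xc) ^ 2 / (ℓ t) ^ 2))
              (-(2 * lam / (ℓ t) ^ 2) * (y - xc)) y := by
            intro y
            have := ((((((hasDerivAt_id y).sub_const xc).pow 2).div_const ((ℓ t) ^ 2)).const_sub 1).const_mul lam)
            exact this.congr_deriv (by simp; ring)
          refine D2.of_hasDerivAt (φ' := fun y => Real.exp (lam * (1 - (y - xc) ^ 2 / (ℓ t) ^ 2)) *
              (-(2 * lam / (ℓ t) ^ 2) * (y - xc))) ?_ ?_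
          · intro y
            exact ((hR y).exp).sub_const 1
          · have := ((hR x).exp).mul (((hasDerivAt_id x).sub_const xc).const_mul (-(2 * lam / (ℓ t) ^ 2)))
            refine this.congr_deriv ?_
            rw [← hE]
            simp
            field_simp
            ring
        · have hℓd : HasDerivAt ℓ σ t := by
            have := (((hasDerivAt_id t).sub_const t0).const_mul σ).const_add ℓ0
            exact this.congr_deriv (by simp)
          have hR : HasDerivAt (fun s => lam * (1 - (x - xc) ^ 2 / (ℓ s) ^ 2))
              (2 * lam * ((x - xc) ^ 2 / (ℓ t) ^ 2) * σ / ℓ t) t := by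
            have := (((hasDerivAt_const t ((x - xc) ^ 2)).div (hℓd.pow 2) (pow_pos hℓtp 2).ne').const_sub 1).const_mul lam
            refine this.congr_deriv ?_
            simp
            field_simp
          have hX' : HasDerivAt (fun s => Real.exp (-k * (s - t0))) (X * (-k)) t := by
            have := (((hasDerivAt_id t).sub_const t0).const_mul (-k)).exp
            rw [hX]; exact this.congr_deriv (by simp)
          have := (hX'.mul (hR.exp.sub_const 1)).const_mul A
          refine this.congr_deriv ?_
          rw [← hE, ← hX]
          ring
      refine ⟨?_, ?_, _, _, hpdw.sub hpd, ?_⟩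
      · have : ∀ᶠ y in 𝓝 x, |y - xc| < ℓ0 + σ * (t - t0) :=
          (Continuous.tendsto (f := fun y => |y - xc|) (by fun_prop) x).eventually (gt_mem_nhds h3')
        filter_upwards [this] with y hy
        exact ⟨h1, h2, hy.le⟩
      · have h4 : ∀ᶠ s in 𝓝[<] t, |x - xc| < ℓ0 + σ * (s - t0) :=
          nhdsWithin_le_nhds ((Continuous.tendsto (f := fun s => ℓ0 + σ * (s - t0)) (by fun_prop) t).eventually
            (lt_mem_nhds h3'))
        filter_upwards [h4, Ioo_mem_nhdsLT ht0] with s hs hs2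
        exact ⟨hs2.1.le, hs2.2.le.trans h2, hs.le⟩
      · have hweq : w t x = A * (X * (E - 1)) := by rw [hX, hE]
        have h5 : A * (X * (-k * (E - 1) + E * (2 * lam * ((x - xc) ^ 2 / (ℓ t) ^ 2) * σ / ℓ t)))
          ≤ A * (X * (d * (E * (4 * lam ^ 2 * ((x - xc) ^ 2 / (ℓ t) ^ 2) - 2 * lam) / ℓ t ^ 2) - K * (E - 1))) := by
          gcongr
        have h6 : 0 ≤ K * (w t x - z t x) := mul_nonneg hK hpos.le
        rw [hweq] at h6
        linarith
  intro t x h1 h2 h3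
  have h4 := hwz t x ⟨h1, h2, h3⟩
  refine le_trans ?_ (sub_nonpos.1 h4)
  obtain ⟨hs, hs1⟩ := hs01 t x h1 h2 h3
  have hℓt := hℓb t h1 h2
  have hℓtp : 0 < ℓ t := by linarith [hℓt.1]
  set s := (x - xc) ^ 2 / (ℓ t) ^ 2 with hsdef
  have h5 : lam * (1 - s) ≤ Real.exp (lam * (1 - s)) - 1 := by
    have := Real.add_one_le_exp (lam * (1 - s)); linarith
  have h6 : Real.exp (-k * T) ≤ Real.exp (-k * (t - t0)) := by
    apply Real.exp_le_exp.2
    have : k * (t - t0) ≤ k * T := by gcongr; linarith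
    linarith
  have h7 : (ℓ0 + σ * (t - t0)) ^ 2 - (x - xc) ^ 2 = (ℓ t) ^ 2 * (1 - s) := by
    rw [hsdef]; field_simp
    simp only [hℓ]
  have h8 : 0 ≤ lam * (1 - s) := mul_nonneg (by linarith) (by linarith)
  have h9 : (ℓ t) ^ 2 / ℓ1 ^ 2 ≤ 1 := by
    rw [div_le_one (by positivity)]
    gcongr
    exact hℓt.2
  rw [h7]
  calc A * Real.exp (-k * T) * lam / ℓ1 ^ 2 * (ℓ t ^ 2 * (1 - s))
      = A * (Real.exp (-k * T) * (lam * (1 - s))) * ((ℓ t) ^ 2 / ℓ1 ^ 2) := by ring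
    _ ≤ A * (Real.exp (-k * T) * (lam * (1 - s))) * 1 := by gcongr
    _ = A * (Real.exp (-k * T) * (lam * (1 - s))) := by ring
    _ ≤ w t x := by
      simp only [hw]
      gcongr

end

section
/-- Abstract local Lipschitz hypothesis on the reaction term. -/
structure FLip (f : ℝ → ℝ → ℝ → ℝ) : Prop where
  zero : ∀ t x, f t x 0 = 0
  lip : ∀ R > 0, ∃ K > 0, ∀ t x u v, 0 ≤ u → u ≤ R → 0 ≤ v → v ≤ R →
    |f t x u - f t x v| ≤ K * |u - v|

theorem FLip.abs_le {f : ℝ → ℝ → ℝ → ℝ} (hf : FLip f) {R : ℝ} (hR : 0 < R) :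
    ∃ K > 0, (∀ t x u v, 0 ≤ u → u ≤ R → 0 ≤ v → v ≤ R →
    |f t x u - f t x v| ≤ K * |u - v|) ∧ ∀ t x u, 0 ≤ u → u ≤ R → |f t x u| ≤ K * u := by
  obtain ⟨K, hK, h⟩ := hf.lip R hR
  refine ⟨K, hK, h, fun t x u hu huR => ?_⟩
  have := h t x u 0 hu huR le_rfl hR.le
  rwa [hf.zero, sub_zero, sub_zero, abs_of_nonneg hu] at this

theorem per_reduce {ω L : ℝ} (hω : 0 < ω) (hL : 0 < L) {F : ℝ → ℝ → ℝ}
    (h1 : ∀ t x, F (t + ω) x = F t x) (h2 : ∀ t x, F t (x + L) = F t x) (t x : ℝ) :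
    ∃ t' ∈ Icc 0 ω, ∃ x' ∈ Icc 0 L, F t x = F t' x' := by
  have p1 : Function.Periodic (fun t => F t x) ω := fun t => h1 t x
  obtain ⟨t', ht', e1⟩ := p1.exists_mem_Ico₀ hω t
  have p2 : Function.Periodic (fun x => F t' x) L := fun x => h2 t' x
  obtain ⟨x', hx', e2⟩ := p2.exists_mem_Ico₀ hL x
  exact ⟨t', Ico_subset_Icc_self ht', x', Ico_subset_Icc_self hx', e1.trans e2⟩

theorem BasicAssumptions.fbdd {ω L : ℝ} (hω : 0 < ω) (hL : 0 < L) {f : ℝ → ℝ → ℝ → ℝ}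
    (hf : BasicAssumptions ω L f) (R : ℝ) :
    ∃ B, ∀ t x u, 0 ≤ u → u ≤ R → |f t x u| ≤ B := by
  have hc : IsCompact (Icc 0 ω ×ˢ (Icc 0 L ×ˢ Icc 0 R)) :=
    isCompact_Icc.prod (isCompact_Icc.prod isCompact_Icc)
  obtain ⟨B, hB⟩ := hc.exists_bound_of_continuousOn (hf.cont.mono (fun q hq => hq.2.2.1))
  refine ⟨B, fun t x u hu huR => ?_⟩
  obtain ⟨t', ht', x', hx', e⟩ := per_reduce hω hL (F := fun t x => f t x u)
    (fun t x => hf.per_t t x u hu) (fun t x => hf.per_x t x u hu) t x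
  rw [e]
  exact hB (t', x', u) ⟨ht', hx', hu, huR⟩

theorem BasicAssumptions.flip {ω L : ℝ} (hω : 0 < ω) (hL : 0 < L) {f : ℝ → ℝ → ℝ → ℝ}
    (hf : BasicAssumptions ω L f) : FLip f := by
  refine ⟨hf.zero, fun R hR => ?_⟩
  obtain ⟨fu, hfu, hunif⟩ := hf.c1
  obtain ⟨δ, hδ, hδu⟩ := hunif 1 one_pos
  obtain ⟨B, hB⟩ := hf.fbdd hω hL δ
  have hat : ∀ t x u, 0 < u → HasDerivAt (fun w => f t x w) (fu t x u) u := fun t x u hu =>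
    (hfu t x u hu.le).hasDerivAt (Ici_mem_nhds hu)
  have h0 : ∀ t x, |fu t x 0| ≤ B / δ + 1 := by
    intro t x
    obtain ⟨ξ, hξ, e⟩ := exists_hasDerivAt_eq_slope (fun w => f t x w) (fu t x) hδ
      (fun w hw => ((hfu t x w hw.1).continuousWithinAt).mono Icc_subset_Ici_self)
      (fun w hw => hat t x w hw.1)
    have h1 : |fu t x ξ| ≤ B / δ := by
      rw [e, hf.zero, sub_zero, sub_zero, abs_div, abs_of_pos hδ]
      gcongr
      exact hB t x δ hδ.le le_rfl
    have h2 := hδu t x ξ 0 hξ.1.le le_rfl (by rw [sub_zero, abs_of_pos hξ.1]; exact hξ.2.le)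
    have h3 := abs_le.1 h1
    have h4 := abs_le.1 h2
    rw [abs_le]; constructor <;> linarith [h3.1, h3.2, h4.1, h4.2]
  have hn : ∀ n : ℕ, ∀ t x u, 0 ≤ u → u ≤ n * δ → |fu t x u| ≤ B / δ + 1 + n := by
    intro n
    induction n with
    | zero =>
      intro t x u hu hu2
      have : u = 0 := by simp at hu2; linarith
      subst this
      simpa using h0 t x
    | succ n ih =>
      intro t x u hu hu2
      push_cast at hu2
      have hv0 : 0 ≤ max 0 (u - δ) := le_max_left _ _
      have h1 := ih t x (max 0 (u - δ)) hv0 (max_le (by positivity) (by linarith))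
      have h2 := hδu t x u (max 0 (u - δ)) hu hv0 (by
        rw [abs_le]
        constructor
        · have : max 0 (u - δ) ≤ u := max_le hu (by linarith)
          linarith
        · have : u - δ ≤ max 0 (u - δ) := le_max_right _ _
          linarith)
      have h3 := abs_le.1 h1
      have h4 := abs_le.1 h2
      push_cast
      rw [abs_le]; constructor <;> linarith [h3.1, h3.2, h4.1, h4.2]
  obtain ⟨n, hnR⟩ := exists_nat_ge (R / δ)
  have hnR' : R ≤ n * δ := by rwa [div_le_iff₀ hδ] at hnR
  have hB0 : 0 ≤ B := (abs_nonneg _).trans (hB 0 0 0 le_rfl hδ.le)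
  refine ⟨B / δ + 1 + n, by positivity, fun t x u v hu huR hv hvR => ?_⟩
  have := Convex.norm_image_sub_le_of_norm_hasDerivWithin_le (f := fun w => f t x w) (f' := fu t x)
    (s := Icc 0 R) (C := B / δ + 1 + n) (x := v) (y := u)
    (fun w hw => (hfu t x w hw.1).mono Icc_subset_Ici_self)
    (fun w hw => hn n t x w hw.1 (hw.2.trans hnR')) (convex_Icc 0 R) ⟨hv, hvR⟩ ⟨hu, huR⟩
  simpa [Real.norm_eq_abs] using this

/-- strict first-touch principle -/
theorem min_principle_strict {D : Set (ℝ × ℝ)} (hD : IsCompact D)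
    {ζ : ℝ → ℝ → ℝ} (hζ : ContinuousOn (fun q : ℝ × ℝ => ζ q.1 q.2) D)
    (H : ∀ t x, (t, x) ∈ D → ζ t x ≤ 0 → (∀ᶠ y in 𝓝 x, (t, y) ∈ D) ∧
      (∀ᶠ s in 𝓝[<] t, (s, x) ∈ D) ∧ (ζ t x = 0 → ∃ b c, PD ζ t x b c ∧ (0 ≤ b → 0 < c))) :
    ∀ t x, (t, x) ∈ D → 0 < ζ t x := by
  by_contra hcon
  push Not at hcon
  obtain ⟨t0, x0, hq0, hle0⟩ := hcon
  set A := D ∩ {q : ℝ × ℝ | ζ q.1 q.2 ≤ 0} with hA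
  have hAc : IsCompact A := by
    have : A = D ∩ (fun q : ℝ × ℝ => ζ q.1 q.2) ⁻¹' (Iic 0) := rfl
    rw [this]
    exact hD.of_isClosed_subset (hζ.preimage_isClosed_of_isClosed hD.isClosed isClosed_Iic)
      inter_subset_left
  obtain ⟨⟨t, x⟩, ⟨hD1, hz1⟩, hmin⟩ := hAc.exists_isMinOn ⟨(t0, x0), hq0, hle0⟩
    (f := fun q : ℝ × ℝ => q.1) continuousOn_fst
  simp only [Set.mem_ofPred_eq] at hz1
  have hearly : ∀ s y, (s, y) ∈ D → s < t → 0 < ζ s y := by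
    intro s y hs hst
    by_contra hc
    have := hmin (⟨hs, not_lt.1 hc⟩ : (s, y) ∈ A)
    simp only [Set.mem_ofPred_eq] at this
    linarith
  have hslice : ∀ y, (t, y) ∈ D → 0 ≤ ζ t y := by
    intro y hy
    by_contra hc
    push Not at hc
    obtain ⟨-, h2, -⟩ := H t y hy hc.le
    have ht : Tendsto (fun s => ((s, y) : ℝ × ℝ)) (𝓝[<] t) (𝓝[D] (t, y)) := by
      apply tendsto_nhdsWithin_of_tendsto_nhds_of_eventually_within
      · exact (Continuous.tendsto (by fun_prop) t).mono_left nhdsWithin_le_nhds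
      · exact h2
    have h3 : Tendsto (fun s => ζ s y) (𝓝[<] t) (𝓝 (ζ t y)) := (hζ (t, y) hy).tendsto.comp ht
    have h4 : 0 ≤ ζ t y := by
      refine ge_of_tendsto h3 ?_
      filter_upwards [h2, self_mem_nhdsWithin] with s hs hst
      exact (hearly s y hs hst).le
    linarith
  have hz0 : ζ t x = 0 := le_antisymm hz1 (hslice x hD1)
  obtain ⟨h1, h2, h3⟩ := H t x hD1 hz1
  obtain ⟨b, c, hpd, hbc⟩ := h3 hz0
  have hb : 0 ≤ b := by
    have h5 : D2 (fun y => (-1) * ζ t y) x ((-1) * b) := hpd.1.const_mul (-1)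
    have h6 : (-1) * b ≤ 0 := by
      apply h5.nonpos
      filter_upwards [h1] with y hy
      have := hslice y hy
      simp only [hz0]; linarith
    linarith
  have hc : c ≤ 0 := by
    apply deriv_nonpos_of_left_min hpd.2
    filter_upwards [h2, self_mem_nhdsWithin] with s hs hst
    simp only [hz0]
    exact (hearly s x hs hst).le
  linarith [hbc hb]

end

section
set_option maxHeartbeats 1000000 in
theorem bdry_upper {d t1 r0 Λ B : ℝ} {u : ℝ → ℝ → ℝ} {h : ℝ → ℝ} (hd : 0 < d) (hr0 : 0 < r0)
    (hΛ : 1 ≤ Λ) (hB : 0 ≤ B)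
    (hlip : ∀ t ∈ Icc (t1 - r0) t1, |h t - h t1| ≤ Λ * (t1 - t))
    (hcont : ContinuousOn (fun q : ℝ × ℝ => u q.1 q.2) (Icc (t1 - r0) t1 ×ˢ univ))
    (hz : ∀ t ∈ Icc (t1 - r0) t1, ∀ x, h t ≤ x → u t x = 0)
    (hpde : ∀ t ∈ Ioc (t1 - r0) t1, ∀ x, h t1 - r0 < x → x < h t →
      ∃ b F, PD u t x b (d * b + F) ∧ |F| ≤ B) :
    ∃ C > 0, ∃ ρ > 0, ρ ≤ r0 ∧ ∃ r > 0, r ≤ r0 ∧ ∀ t ∈ Icc (t1 - r) t1, ∀ y ∈ Icc 0 ρ,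
      u t (h t1 - y) ≤ C * (y + (t1 - t)) := by
  obtain ⟨κ, hκ⟩ : ∃ κ, κ = Λ + 1 := ⟨_, rfl⟩
  obtain ⟨N, hN⟩ : ∃ N, N = (κ + 1) / (2 * d) := ⟨_, rfl⟩
  have hκ0 : 0 < κ := by linarith
  have hN0 : 0 < N := by rw [hN]; positivity
  have hNd : 2 * d * N = κ + 1 := by rw [hN]; field_simp
  obtain ⟨ρ, hρ⟩ : ∃ ρ, ρ = min r0 (1 / (2 * N)) := ⟨_, rfl⟩
  obtain ⟨r, hr⟩ : ∃ r, r = min r0 (1 / (2 * (N * Λ ^ 2))) := ⟨_, rfl⟩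
  have hρ0 : 0 < ρ := by rw [hρ]; exact lt_min hr0 (by positivity)
  have hrp : 0 < r := by rw [hr]; exact lt_min hr0 (by positivity)
  have hρr0 : ρ ≤ r0 := by rw [hρ]; exact min_le_left _ _
  have hrr0 : r ≤ r0 := by rw [hr]; exact min_le_left _ _
  have hρN : N * ρ ≤ 1 / 2 := by
    have : ρ ≤ 1 / (2 * N) := by rw [hρ]; exact min_le_right _ _
    calc N * ρ ≤ N * (1 / (2 * N)) := by gcongr
      _ = 1 / 2 := by field_simp
  have hrN : N * Λ ^ 2 * r ≤ 1 / 2 := by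
    have : r ≤ 1 / (2 * (N * Λ ^ 2)) := by rw [hr]; exact min_le_right _ _
    calc N * Λ ^ 2 * r ≤ N * Λ ^ 2 * (1 / (2 * (N * Λ ^ 2))) := by gcongr
      _ = 1 / 2 := by field_simp
  set h1 := h t1 with hh1
  set S := {q : ℝ × ℝ | t1 - r ≤ q.1 ∧ q.1 ≤ t1 ∧ h1 - ρ ≤ q.2 ∧ q.2 ≤ h1 + Λ * (t1 - q.1)} with hS
  have hScomp : IsCompact S := by
    have hclosed : IsClosed S := by
      simp only [hS, Set.ofPred_and]
      refine (isClosed_le (by fun_prop) (by fun_prop)).inter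
        ((isClosed_le (by fun_prop) (by fun_prop)).inter
        ((isClosed_le (by fun_prop) (by fun_prop)).inter (isClosed_le (by fun_prop) (by fun_prop))))
    refine (isCompact_Icc.prod (isCompact_Icc (a := h1 - ρ) (b := h1 + Λ * r))).of_isClosed_subset
      (s := Icc (t1 - r) t1 ×ˢ Icc (h1 - ρ) (h1 + Λ * r)) hclosed ?_
    rintro ⟨t, x⟩ ⟨q1, q2, q3, q4⟩
    simp only at q1 q2 q3 q4
    have : Λ * (t1 - t) ≤ Λ * r := by gcongr; linarith
    exact ⟨⟨q1, q2⟩, q3, by simp only; linarith⟩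
  have hScont : ContinuousOn (fun q : ℝ × ℝ => u q.1 q.2) S := by
    refine hcont.mono ?_
    rintro ⟨t, x⟩ ⟨q1, q2, q3, q4⟩
    simp only at q1 q2 
    exact ⟨⟨by simp only; linarith, q2⟩, trivial⟩
  obtain ⟨M, hM⟩ := hScomp.exists_bound_of_continuousOn hScont
  have hM0 : 0 ≤ M := (norm_nonneg _).trans (hM (t1, h1) ⟨by simp only; linarith, le_rfl,
    by simp only; linarith, by simp⟩)
  obtain ⟨A, hA⟩ : ∃ A, A = B + 1 + 2 * M / r + 2 * M / ρ := ⟨_, rfl⟩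
  have hq1 : 0 ≤ 2 * M / r := by positivity
  have hq2 : 0 ≤ 2 * M / ρ := by positivity
  have hAB : B + 1 ≤ A := by rw [hA]; linarith
  have hAr : M ≤ A * (r / 2) := by
    have : 2 * M / r ≤ A := by rw [hA]; linarith
    calc M = 2 * M / r * (r / 2) := by field_simp
      _ ≤ _ := by gcongr
  have hAρ : M ≤ A * (ρ / 2) := by
    have : 2 * M / ρ ≤ A := by rw [hA]; linarith
    calc M = 2 * M / ρ * (ρ / 2) := by field_simp
      _ ≤ _ := by gcongr
  have hA0 : 0 < A := by linarith
  -- lower bound of the profile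
  have hprof : ∀ t x, (t, x) ∈ S → (t1 - t) / 2 ≤ (h1 - x) - N * (h1 - x) ^ 2 + κ * (t1 - t) ∧
      ((h1 - x) / 2 ≤ (h1 - x) - N * (h1 - x) ^ 2 + κ * (t1 - t)) := by
    rintro t x ⟨q1, q2, q3, q4⟩
    simp only at q1 q2 q3 q4
    obtain ⟨τ, hτ⟩ : ∃ τ, τ = t1 - t := ⟨_, rfl⟩
    obtain ⟨y, hy⟩ : ∃ y, y = h1 - x := ⟨_, rfl⟩
    rw [← hτ, ← hy]
    have hτ0 : 0 ≤ τ := by linarith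
    have hτr : τ ≤ r := by linarith
    have hyρ : y ≤ ρ := by linarith
    have hyτ : -(Λ * τ) ≤ y := by rw [← hτ] at q4; linarith
    rcases le_or_gt 0 y with hy0 | hy0
    · have h3 : N * y ^ 2 ≤ y / 2 := by
        have : N * y ≤ 1 / 2 := le_trans (by gcongr) hρN
        nlinarith
      constructor <;> nlinarith
    · have h3 : N * y ^ 2 ≤ τ / 2 := by
        have h4 : y ^ 2 ≤ (Λ * τ) ^ 2 := by nlinarith
        calc N * y ^ 2 ≤ N * (Λ * τ) ^ 2 := by gcongr
          _ = (N * Λ ^ 2 * τ) * τ := by ring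
          _ ≤ (N * Λ ^ 2 * r) * τ := by gcongr
          _ ≤ 1 / 2 * τ := by gcongr
          _ = τ / 2 := by ring
      have h5 : κ * τ = Λ * τ + τ := by rw [hκ]; ring
      constructor <;> linarith
  have hcmp : ∀ t x, (t, x) ∈ S →
      u t x - A * ((h1 - x) - N * (h1 - x) ^ 2 + κ * (t1 - t)) ≤ 0 := by
    refine max_principle_compact (d := d) (K := 0) hd.le hScomp
      (z := fun t x => u t x - A * ((h1 - x) - N * (h1 - x) ^ 2 + κ * (t1 - t))) ?_ ?_
    · exact hScont.sub (by fun_prop)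
    · intro t x hq hpos
      obtain ⟨p1, p2⟩ := hprof t x hq
      have hu := hM (t, x) hq
      rw [Real.norm_eq_abs] at hu
      have hu' := (abs_le.1 hu).2
      simp only at hu'
      obtain ⟨q1, q2, q3, q4⟩ := hq
      simp only at q1 q2 q3 q4
      have p1' := mul_le_mul_of_nonneg_left p1 hA0.le
      have p2' := mul_le_mul_of_nonneg_left p2 hA0.le
      have htt : t ∈ Icc (t1 - r0) t1 := ⟨by linarith, q2⟩
      have hxh : x < h t := by
        by_contra hc
        have := hz t htt x (not_lt.1 hc)
        have : 0 ≤ A * ((t1 - t) / 2) := mul_nonneg hA0.le (by linarith)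
        linarith
      have htr : t1 - r < t := by
        rcases q1.lt_or_eq with hlt | he
        · exact hlt
        · have : (t1 - t) / 2 = r / 2 := by rw [← he]; ring
          rw [this] at p1'
          linarith
      have hxρ : h1 - ρ < x := by
        rcases q3.lt_or_eq with hlt | he
        · exact hlt
        · have : (h1 - x) / 2 = ρ / 2 := by rw [← he]; ring
          rw [this] at p2'
          linarith
      have hxs : x < h1 + Λ * (t1 - t) := by
        have := (abs_le.1 (hlip t htt)).2
        linarith
      obtain ⟨b, F, hpd, hF⟩ := hpde t ⟨by linarith, q2⟩ x (by linarith) hxh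
      have hpdw : PD (fun t x => A * ((h1 - x) - N * (h1 - x) ^ 2 + κ * (t1 - t))) t x
          (A * (- (2 * N))) (A * (-κ)) := by
        constructor
        · refine D2.const_mul ?_ A
          refine D2.of_hasDerivAt (φ' := fun y => -1 + 2 * N * (h1 - y)) ?_ ?_
          · intro y
            have e1 := (hasDerivAt_id y).const_sub h1
            have := (e1.sub ((e1.pow 2).const_mul N)).add_const (κ * (t1 - t))
            exact this.congr_deriv (by simp; ring)
          · have e1 := (((hasDerivAt_id x).const_sub h1).const_mul (2 * N)).const_add (-1)
            exact e1.congr_deriv (by ring)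
        · have e1 := (((((hasDerivAt_id t).const_sub t1).const_mul κ).const_add
            ((h1 - x) - N * (h1 - x) ^ 2)).const_mul A)
          exact e1.congr_deriv (by ring)
      refine ⟨?_, ?_, _, _, hpd.sub hpdw, ?_⟩
      · filter_upwards [Ioo_mem_nhds hxρ hxs] with y hy
        exact ⟨q1, q2, hy.1.le, hy.2.le⟩
      · have h4 : ∀ᶠ s in 𝓝[<] t, x < h1 + Λ * (t1 - s) :=
          nhdsWithin_le_nhds ((Continuous.tendsto (f := fun s => h1 + Λ * (t1 - s)) (by fun_prop) t).eventually
            (lt_mem_nhds hxs))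
        filter_upwards [h4, Ioo_mem_nhdsLT htr] with s hs hs2
        exact ⟨hs2.1.le, hs2.2.le.trans q2, q3, hs.le⟩
      · have h5 : F ≤ B := (abs_le.1 hF).2
        have h6 : A * (2 * d * N) = A * (κ + 1) := by rw [hNd]
        nlinarith
  refine ⟨A * κ, by positivity, ρ, hρ0, hρr0, r, hrp, hrr0, fun t ht y hy => ?_⟩
  have h3 := hcmp t (h1 - y) ⟨ht.1, ht.2, by simp only; linarith [hy.2], by
    simp only
    have : 0 ≤ Λ * (t1 - t) := mul_nonneg (by linarith) (by linarith [ht.2])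
    linarith [hy.1]⟩
  have h4 : h1 - (h1 - y) = y := by ring
  rw [h4] at h3
  have h5 : y - N * y ^ 2 + κ * (t1 - t) ≤ κ * (y + (t1 - t)) := by
    have : 0 ≤ N * y ^ 2 := by positivity
    have : y ≤ κ * y := le_mul_of_one_le_left hy.1 (by linarith)
    linarith
  calc u t (h1 - y) ≤ A * (y - N * y ^ 2 + κ * (t1 - t)) := by linarith
    _ ≤ A * (κ * (y + (t1 - t))) := by gcongr
    _ = _ := by ring

end

section
theorem D2.comp_const_sub {φ : ℝ → ℝ} {x b : ℝ} (c : ℝ) (h : D2 φ (c - x) b) :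
    D2 (fun y => φ (c - y)) x b := by
  obtain ⟨φ', h1, h2⟩ := h
  refine ⟨fun y => - φ' (c - y), ?_, ?_⟩
  · have ht : Tendsto (fun y => c - y) (𝓝 x) (𝓝 (c - x)) := Continuous.tendsto (by fun_prop) x
    filter_upwards [ht.eventually h1] with y hy
    have := HasDerivAt.comp_const_sub c y hy
    exact this
  · have := (HasDerivAt.comp_const_sub c x h2).neg
    exact this.congr_deriv (by ring)

set_option maxHeartbeats 1000000 in
theorem bdry_double_aux {d t1 r ρ Λ B C A h1 ε : ℝ} {u : ℝ → ℝ → ℝ} (hd : 0 < d)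
    (hr : 0 < r) (hρ : 0 < ρ) (hΛ : 1 ≤ Λ) (hC : 0 < C)
    (hε : |ε| = 1)
    (hA1 : B < d * A) (hA2 : 2 * C * Λ ≤ A * d) (hA3 : 2 * C ≤ A * ρ) (hA4 : 2 * C * ρ ≤ A * d * r)
    (hA0 : 0 < A)
    (hcont : ContinuousOn (fun q : ℝ × ℝ => u q.1 q.2) (Icc (t1 - r) t1 ×ˢ univ))
    (hu : ∀ t ∈ Icc (t1 - r) t1, ∀ y ∈ Icc 0 ρ, 0 ≤ u t (h1 - y) ∧ u t (h1 - y) ≤ C * (y + (t1 - t)))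
    (hpde : ∀ t ∈ Ioc (t1 - r) t1, ∀ y, Λ * (t1 - t) < y → y < ρ →
      ∃ b F, PD u t (h1 - y) b (d * b + F) ∧ |F| ≤ B) :
    ∀ t a b, t1 - r ≤ t → t ≤ t1 → Λ * (t1 - t) ≤ b → b ≤ a → a ≤ ρ →
      ε * (b * u t (h1 - a) - a * u t (h1 - b)) -
        A * (a ^ 3 + 8 * a ^ 2 * b - 4 * a * b ^ 2 - 3 * b ^ 3 + d * (t1 - t) * (a + b)) ≤ 0 := by
  set G : ℝ → ℝ → ℝ → ℝ := fun t a b => ε * (b * u t (h1 - a) - a * u t (h1 - b)) -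
        A * (a ^ 3 + 8 * a ^ 2 * b - 4 * a * b ^ 2 - 3 * b ^ 3 + d * (t1 - t) * (a + b)) with hG
  set S := {q : ℝ × ℝ × ℝ | t1 - r ≤ q.1 ∧ q.1 ≤ t1 ∧ Λ * (t1 - q.1) ≤ q.2.2 ∧ q.2.2 ≤ q.2.1 ∧
    q.2.1 ≤ ρ} with hS
  have hScomp : IsCompact S := by
    have hclosed : IsClosed S := by
      simp only [hS, Set.ofPred_and]
      refine (isClosed_le (by fun_prop) (by fun_prop)).inter
        ((isClosed_le (by fun_prop) (by fun_prop)).inter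
        ((isClosed_le (by fun_prop) (by fun_prop)).inter ((isClosed_le (by fun_prop) (by fun_prop)).inter
          (isClosed_le (by fun_prop) (by fun_prop)))))
    refine (isCompact_Icc.prod ((isCompact_Icc (a := 0) (b := ρ)).prod
      (isCompact_Icc (a := 0) (b := ρ)))).of_isClosed_subset
      (s := Icc (t1 - r) t1 ×ˢ (Icc 0 ρ ×ˢ Icc 0 ρ)) hclosed ?_
    rintro ⟨t, a, b⟩ ⟨q1, q2, q3, q4, q5⟩
    simp only at q1 q2 q3 q4 q5
    have : 0 ≤ Λ * (t1 - t) := mul_nonneg (by linarith) (by linarith)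
    exact ⟨⟨q1, q2⟩, ⟨by simp only; linarith, q5⟩, by simp only; linarith, by simp only; linarith⟩
  have hGc : ContinuousOn (fun q : ℝ × ℝ × ℝ => G q.1 q.2.1 q.2.2) S := by
    have e1 : ContinuousOn (fun q : ℝ × ℝ × ℝ => u q.1 (h1 - q.2.1)) S :=
      hcont.comp (f := fun q : ℝ × ℝ × ℝ => (q.1, h1 - q.2.1)) (by fun_prop)
        (fun q hq => ⟨⟨hq.1, hq.2.1⟩, trivial⟩)
    have e2 : ContinuousOn (fun q : ℝ × ℝ × ℝ => u q.1 (h1 - q.2.2)) S :=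
      hcont.comp (f := fun q : ℝ × ℝ × ℝ => (q.1, h1 - q.2.2)) (by fun_prop)
        (fun q hq => ⟨⟨hq.1, hq.2.1⟩, trivial⟩)
    simp only [hG]
    refine ContinuousOn.sub (continuousOn_const.mul (ContinuousOn.sub (ContinuousOn.mul ?_ e1)
      (ContinuousOn.mul ?_ e2))) (Continuous.continuousOn ?_)
    · exact Continuous.continuousOn (by fun_prop)
    · exact Continuous.continuousOn (by fun_prop)
    · fun_prop
  intro t a b q1 q2 q3 q4 q5
  by_contra hcon
  push Not at hcon
  have hmem : (t, a, b) ∈ S := ⟨q1, q2, q3, q4, q5⟩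
  have hcon' : 0 < G t a b := hcon
  obtain ⟨⟨t', a', b'⟩, hq, hmax⟩ := hScomp.exists_isMaxOn ⟨(t, a, b), q1, q2, q3, q4, q5⟩ hGc
  have hGpos : 0 < G t' a' b' := lt_of_lt_of_le hcon' (hmax hmem)
  clear hcon hcon' hmem q1 q2 q3 q4 q5
  clear t a b
  rename' t' => t, a' => a, b' => b
  have hmax' : ∀ t' a' b', (t', a', b') ∈ S → G t' a' b' ≤ G t a b := fun t' a' b' h => hmax h
  obtain ⟨q1, q2, q3, q4, q5⟩ := hq
  simp only at q1 q2 q3 q4 q5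
  obtain ⟨τ, hτ⟩ : ∃ τ, τ = t1 - t := ⟨_, rfl⟩
  have hτ0 : 0 ≤ τ := by linarith
  have hΛτ : τ ≤ Λ * τ := le_mul_of_one_le_left hτ0 hΛ
  rw [← hτ] at q3
  have hb0 : 0 ≤ b := by linarith
  have ha0 : 0 ≤ a := by linarith
  have hua := hu t ⟨q1, q2⟩ a ⟨ha0, q5⟩
  have hub := hu t ⟨q1, q2⟩ b ⟨hb0, by linarith⟩
  rw [← hτ] at hua hub
  have hWabs : ε * (b * u t (h1 - a) - a * u t (h1 - b)) ≤ 2 * C * (a * b) := by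
    have f1 : b * u t (h1 - a) ≤ b * (C * (2 * a)) := by
      gcongr; exact hua.2.trans (by gcongr; linarith)
    have f2 : a * u t (h1 - b) ≤ a * (C * (2 * b)) := by
      gcongr; exact hub.2.trans (by gcongr; linarith)
    have f3 : 0 ≤ b * u t (h1 - a) := mul_nonneg hb0 hua.1
    have f4 : 0 ≤ a * u t (h1 - b) := mul_nonneg ha0 hub.1
    calc _ ≤ |ε * (b * u t (h1 - a) - a * u t (h1 - b))| := le_abs_self _
      _ = |b * u t (h1 - a) - a * u t (h1 - b)| := by rw [abs_mul, hε, one_mul]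
      _ ≤ _ := by rw [abs_le]; constructor <;> linarith
  have hQ : a ^ 3 ≤ a ^ 3 + 8 * a ^ 2 * b - 4 * a * b ^ 2 - 3 * b ^ 3 := by
    have e1 : a * b ^ 2 ≤ a ^ 2 * b := by nlinarith [mul_nonneg ha0 hb0]
    have e2 : b ^ 3 ≤ a ^ 2 * b := by
      calc b ^ 3 = b ^ 2 * b := by ring
        _ ≤ _ := by gcongr
    have : 0 ≤ a ^ 2 * b := by positivity
    linarith
  have hQ0 : 0 ≤ a ^ 3 := by positivity
  have hGeq : G t a b = ε * (b * u t (h1 - a) - a * u t (h1 - b)) -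
        A * (a ^ 3 + 8 * a ^ 2 * b - 4 * a * b ^ 2 - 3 * b ^ 3 + d * τ * (a + b)) := by
    simp only [hG, hτ]
  have hdτ : 0 ≤ d * τ * (a + b) := by positivity
  have hdτa : d * τ * a ≤ d * τ * (a + b) := by gcongr; linarith
  -- lower bounds for Φ
  have hΦ1 : A * a ^ 3 ≤ A * (a ^ 3 + 8 * a ^ 2 * b - 4 * a * b ^ 2 - 3 * b ^ 3 + d * τ * (a + b)) := by
    gcongr; linarith
  have hΦ2 : A * (d * τ * a) ≤ A * (a ^ 3 + 8 * a ^ 2 * b - 4 * a * b ^ 2 - 3 * b ^ 3 + d * τ * (a + b)) := by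
    gcongr; linarith
  have hAa3 : 0 ≤ A * a ^ 3 := by positivity
  have s1 : Λ * τ < b := by
    rcases q3.lt_or_eq with hlt | he
    · exact hlt
    · exfalso
      have : 2 * C * (a * b) ≤ A * (d * τ * a) := by
        rw [← he]
        calc 2 * C * (a * (Λ * τ)) = 2 * C * Λ * (τ * a) := by ring
          _ ≤ A * d * (τ * a) := by gcongr
          _ = _ := by ring
      linarith
  have s2 : b < a := by
    rcases q4.lt_or_eq with hlt | he
    · exact hlt
    · exfalso
      have : b * u t (h1 - a) - a * u t (h1 - b) = 0 := by rw [he]; ring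
      rw [this] at hGeq
      linarith
  have s3 : a < ρ := by
    rcases q5.lt_or_eq with hlt | he
    · exact hlt
    · exfalso
      have : 2 * C * (a * b) ≤ A * a ^ 3 := by
        calc 2 * C * (a * b) ≤ A * ρ * (a * a) := by gcongr
          _ = A * a ^ 3 := by rw [he]; ring
      linarith
  have s4 : t1 - r < t := by
    rcases q1.lt_or_eq with hlt | he
    · exact hlt
    · exfalso
      have hτr : τ = r := by linarith
      have : 2 * C * (a * b) ≤ A * (d * τ * a) := by
        calc 2 * C * (a * b) ≤ 2 * C * (a * ρ) := by gcongr; linarith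
          _ = 2 * C * ρ * a := by ring
          _ ≤ A * d * r * a := by gcongr
          _ = _ := by rw [hτr]; ring
      linarith
  obtain ⟨b1, F1, pd1, hF1⟩ := hpde t ⟨s4, q2⟩ a (by rw [← hτ]; linarith) s3
  obtain ⟨b2, F2, pd2, hF2⟩ := hpde t ⟨s4, q2⟩ b (by rw [← hτ]; linarith) (by linarith)
  -- second derivative in a
  have da : ε * (b * b1 - 0) - A * (6 * a + 16 * b) ≤ 0 := by
    have e1 : D2 (fun a' => a' * u t (h1 - b)) a 0 := by
      refine D2.of_hasDerivAt (φ' := fun _ => u t (h1 - b)) (fun y => ?_) (hasDerivAt_const _ _)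
      exact ((hasDerivAt_id y).mul_const _).congr_deriv (by simp)
    have e2 : D2 (fun a' => a' ^ 3 + 8 * a' ^ 2 * b - 4 * a' * b ^ 2 - 3 * b ^ 3 + d * (t1 - t) * (a' + b)) a
        (6 * a + 16 * b) := by
      refine D2.of_hasDerivAt (φ' := fun y => 3 * y ^ 2 + 16 * y * b - 4 * b ^ 2 + d * (t1 - t))
        (fun y => ?_) ?_
      · have i := hasDerivAt_id y
        have := (((((i.pow 3).add (((i.pow 2).const_mul 8).mul_const b)).sub
          ((i.const_mul 4).mul_const (b ^ 2))).sub_const (3 * b ^ 3)).add ((i.add_const b).const_mul (d * (t1 - t))))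
        exact this.congr_deriv (by simp only [id, Nat.cast_ofNat, mul_one]; ring)
      · have i := hasDerivAt_id a
        have := ((((i.pow 2).const_mul 3).add ((i.const_mul 16).mul_const b)).sub_const (4 * b ^ 2)).add_const
          (d * (t1 - t))
        exact this.congr_deriv (by simp; ring)
    have e3 := (((pd1.1.comp_const_sub h1).const_mul b).sub e1 |>.const_mul ε).sub (e2.const_mul A)
    refine e3.nonpos ?_
    filter_upwards [Ioo_mem_nhds s2 s3] with a' ha'
    exact hmax' t a' b ⟨q1, q2, by simp only; rw [← hτ]; exact q3, ha'.1.le, ha'.2.le⟩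
  have db : ε * (0 - a * b2) - A * (-(8 * a) - 18 * b) ≤ 0 := by
    have e1 : D2 (fun b' => b' * u t (h1 - a)) b 0 := by
      refine D2.of_hasDerivAt (φ' := fun _ => u t (h1 - a)) (fun y => ?_) (hasDerivAt_const _ _)
      exact ((hasDerivAt_id y).mul_const _).congr_deriv (by simp)
    have e2 : D2 (fun b' => a ^ 3 + 8 * a ^ 2 * b' - 4 * a * b' ^ 2 - 3 * b' ^ 3 + d * (t1 - t) * (a + b')) b
        (-(8 * a) - 18 * b) := by
      refine D2.of_hasDerivAt (φ' := fun y => 8 * a ^ 2 - 8 * a * y - 9 * y ^ 2 + d * (t1 - t))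
        (fun y => ?_) ?_
      · have i := hasDerivAt_id y
        have := (((((i.const_mul (8 * a ^ 2)).const_add (a ^ 3)).sub
          ((i.pow 2).const_mul (4 * a))).sub ((i.pow 3).const_mul 3)).add ((i.const_add a).const_mul (d * (t1 - t))))
        exact this.congr_deriv (by simp; ring)
      · have i := hasDerivAt_id b
        have := (((i.const_mul (8 * a)).const_sub (8 * a ^ 2)).sub ((i.pow 2).const_mul 9)).add_const
          (d * (t1 - t))
        exact this.congr_deriv (by simp; ring)
    have e3 := (e1.sub ((pd2.1.comp_const_sub h1).const_mul a) |>.const_mul ε).sub (e2.const_mul A)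
    refine e3.nonpos ?_
    filter_upwards [Ioo_mem_nhds s1 s2] with b' hb'
    exact hmax' t a b' ⟨q1, q2, by simp only; rw [← hτ]; exact hb'.1.le, hb'.2.le, q5⟩
  have dt : 0 ≤ ε * (b * (d * b1 + F1) - a * (d * b2 + F2)) - A * (-(d * (a + b))) := by
    have e1 : HasDerivAt (fun s => a ^ 3 + 8 * a ^ 2 * b - 4 * a * b ^ 2 - 3 * b ^ 3 + d * (t1 - s) * (a + b))
        (-(d * (a + b))) t := by
      have := ((((hasDerivAt_id t).const_sub t1).const_mul d).mul_const (a + b)).const_add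
        (a ^ 3 + 8 * a ^ 2 * b - 4 * a * b ^ 2 - 3 * b ^ 3)
      exact this.congr_deriv (by ring)
    have e2 := (((pd1.2.const_mul b).sub (pd2.2.const_mul a)).const_mul ε).sub (e1.const_mul A)
    refine deriv_nonneg_of_left_max e2 ?_
    have h4 : ∀ᶠ s in 𝓝[<] t, Λ * (t1 - s) < b :=
      nhdsWithin_le_nhds ((Continuous.tendsto (f := fun s => Λ * (t1 - s)) (by fun_prop) t).eventually
        (gt_mem_nhds (by rw [← hτ]; exact s1)))
    filter_upwards [h4, Ioo_mem_nhdsLT s4] with s hs hs2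
    exact hmax' s a b ⟨hs2.1.le, hs2.2.le.trans q2, hs.le, q4, q5⟩
  have hab : 0 < a + b := by linarith
  have hFF : ε * (b * F1 - a * F2) ≤ B * (a + b) := by
    calc _ ≤ |ε * (b * F1 - a * F2)| := le_abs_self _
      _ = |b * F1 - a * F2| := by rw [abs_mul, hε, one_mul]
      _ ≤ |b * F1| + |a * F2| := abs_sub _ _
      _ = b * |F1| + a * |F2| := by rw [abs_mul, abs_mul, abs_of_nonneg ha0, abs_of_nonneg hb0]
      _ ≤ b * B + a * B := by gcongr
      _ = _ := by ring
  have hsum := mul_le_mul_of_nonneg_left (add_le_add da db) hd.le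
  have key : B * (a + b) < d * A * (a + b) := by gcongr
  nlinarith

/-- One-sided differentiability at the free boundary. -/
theorem bdry_deriv {d t1 r0 Λ B : ℝ} {u : ℝ → ℝ → ℝ} {h : ℝ → ℝ} (hd : 0 < d) (hr0 : 0 < r0)
    (hΛ : 1 ≤ Λ) (hB : 0 ≤ B)
    (hlip : ∀ t ∈ Icc (t1 - r0) t1, |h t - h t1| ≤ Λ * (t1 - t))
    (hcont : ContinuousOn (fun q : ℝ × ℝ => u q.1 q.2) (Icc (t1 - r0) t1 ×ˢ univ))
    (hnn : ∀ t ∈ Icc (t1 - r0) t1, ∀ x, h t1 - r0 ≤ x → 0 ≤ u t x)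
    (hz : ∀ t ∈ Icc (t1 - r0) t1, ∀ x, h t ≤ x → u t x = 0)
    (hpde : ∀ t ∈ Ioc (t1 - r0) t1, ∀ x, h t1 - r0 < x → x < h t →
      ∃ b F, PD u t x b (d * b + F) ∧ |F| ≤ B) :
    ∃ m, HasDerivWithinAt (u t1) (-m) (Iic (h t1)) (h t1) := by
  obtain ⟨C, hC, ρ, hρ, hρ0, r, hr, hrr0, hup⟩ := bdry_upper hd hr0 hΛ hB hlip hcont hz hpde
  set h1 := h t1 with hh1
  obtain ⟨A, hA⟩ : ∃ A, A = (B + 1) / d + 2 * C * Λ / d + 2 * C / ρ + 2 * C * ρ / (d * r) := ⟨_, rfl⟩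
  have i1 : 0 < (B + 1) / d := by positivity
  have i2 : 0 < 2 * C * Λ / d := by positivity
  have i3 : 0 < 2 * C / ρ := by positivity
  have i4 : 0 < 2 * C * ρ / (d * r) := by positivity
  have hA0 : 0 < A := by rw [hA]; positivity
  have j1 : (B + 1) / d ≤ A := by linarith
  have j2 : 2 * C * Λ / d ≤ A := by linarith
  have j3 : 2 * C / ρ ≤ A := by linarith
  have j4 : 2 * C * ρ / (d * r) ≤ A := by linarith
  rw [div_le_iff₀ (by positivity)] at j1 j2 j3 j4
  have hsub : Icc (t1 - r) t1 ⊆ Icc (t1 - r0) t1 := Icc_subset_Icc_left (by linarith)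
  have aux : ∀ ε : ℝ, |ε| = 1 → _ := fun ε hε =>
    bdry_double_aux (u := u) (h1 := h1) (t1 := t1) (B := B) hd hr hρ hΛ hC hε
    (by linarith) j2 j3 (by linarith) hA0 (hcont.mono (prod_mono hsub subset_rfl))
    (fun t ht y hy => ⟨hnn t (hsub ht) _ (by linarith [hy.2]), hup t ht y hy⟩)
    (fun t ht y hy hyρ => hpde t ⟨by linarith [ht.1], ht.2⟩ (h1 - y) (by linarith) (by
      have := (abs_le.1 (hlip t ⟨by linarith [ht.1], ht.2⟩)).1
      linarith))
  have hW : ∀ a b, 0 < b → b ≤ a → a ≤ ρ →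
      |b * u t1 (h1 - a) - a * u t1 (h1 - b)| ≤ 9 * A * a ^ 3 := by
    intro a b hb hba ha
    have k1 := aux 1 (by simp) t1 a b (by linarith) le_rfl (by simpa using hb.le) hba ha
    have k2 := aux (-1) (by simp) t1 a b (by linarith) le_rfl (by simpa using hb.le) hba ha
    have hQ : a ^ 3 + 8 * a ^ 2 * b - 4 * a * b ^ 2 - 3 * b ^ 3 ≤ 9 * a ^ 3 := by
      have ha0 : 0 < a := by linarith
      have : a ^ 2 * b ≤ a ^ 2 * a := by gcongr
      have : 0 ≤ a * b ^ 2 := by positivity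
      have : 0 ≤ b ^ 3 := by positivity
      nlinarith
    have hQ' := mul_le_mul_of_nonneg_left hQ hA0.le
    rw [sub_self] at k1 k2
    rw [abs_le]; constructor <;> nlinarith
  set q : ℝ → ℝ := fun y => u t1 (h1 - y) / y with hq
  have hq1 : ∀ a b, 0 < a → a / 2 ≤ b → b ≤ a → a ≤ ρ → |q a - q b| ≤ 18 * A * a := by
    intro a b ha hab hba haρ
    have hb : 0 < b := by linarith
    have e1 : q a - q b = (b * u t1 (h1 - a) - a * u t1 (h1 - b)) / (a * b) := by
      simp only [hq]; field_simp
    rw [e1, abs_div, abs_of_pos (by positivity : 0 < a * b), div_le_iff₀ (by positivity)]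
    refine (hW a b hb hba haρ).trans ?_
    have : 9 * A * a ^ 3 = 18 * A * a * (a * (a / 2)) := by ring
    rw [this]
    gcongr
  have hq2 : ∀ n : ℕ, ∀ a b, 0 < a → a / 2 ^ n ≤ b → b ≤ a → a ≤ ρ → |q a - q b| ≤ 36 * A * a := by
    intro n
    induction n with
    | zero =>
      intro a b ha hab hba haρ
      have : b = a := le_antisymm hba (by simpa using hab)
      rw [this]; simp; positivity
    | succ n ih =>
      intro a b ha hab hba haρ
      rcases le_or_gt (a / 2) b with hb | hb
      · refine (hq1 a b ha hb hba haρ).trans ?_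
        have : 0 ≤ A * a := by positivity
        linarith
      · have k1 := hq1 a (a / 2) ha le_rfl (by linarith) haρ
        have k2 := ih (a / 2) b (by linarith) (le_trans (le_of_eq (by rw [pow_succ]; field_simp)) hab) hb.le (by linarith)
        have := abs_sub_le (q a) (q (a / 2)) (q b)
        linarith
  have hq3 : ∀ a b, 0 < b → b ≤ a → a ≤ ρ → |q a - q b| ≤ 36 * A * a := by
    intro a b hb hba haρ
    have ha : 0 < a := by linarith
    obtain ⟨n, hn⟩ := exists_pow_lt_of_lt_one (div_pos hb ha) (by norm_num : (1/2:ℝ) < 1)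
    refine hq2 n a b ha ?_ hba haρ
    have : a / 2 ^ n = (1 / 2) ^ n * a := by rw [one_div, inv_pow]; field_simp
    rw [this]
    rw [lt_div_iff₀ ha] at hn
    exact hn.le
  have hlim : ∃ m, Tendsto q (𝓝[>] 0) (𝓝 m) := by
    apply cauchy_map_iff_exists_tendsto.1
    rw [Metric.cauchy_iff]
    refine ⟨inferInstance, fun ε hε => ?_⟩
    obtain ⟨a0, ha0, ha0ρ, ha0ε⟩ : ∃ a0 > 0, a0 ≤ ρ ∧ 36 * A * a0 < ε := by
      refine ⟨min ρ (ε / (72 * A)), lt_min hρ (by positivity), min_le_left _ _, ?_⟩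
      calc 36 * A * min ρ (ε / (72 * A)) ≤ 36 * A * (ε / (72 * A)) := by gcongr; exact min_le_right _ _
        _ = ε / 2 := by field_simp; norm_num
        _ < ε := by linarith
    refine ⟨q '' (Ioo 0 a0), image_mem_map (Ioo_mem_nhdsGT ha0), ?_⟩
    rintro _ ⟨x, hx, rfl⟩ _ ⟨y, hy, rfl⟩
    rw [Real.dist_eq]
    rcases le_total x y with hxy | hxy
    · rw [abs_sub_comm]
      refine (hq3 y x hx.1 hxy (by linarith [hy.2])).trans_lt ?_
      refine lt_of_le_of_lt ?_ ha0ε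
      have := hy.2.le; gcongr
    · refine (hq3 x y hy.1 hxy (by linarith [hx.2])).trans_lt ?_
      refine lt_of_le_of_lt ?_ ha0ε
      have := hx.2.le; gcongr
  obtain ⟨m, hm⟩ := hlim
  refine ⟨m, ?_⟩
  rw [hasDerivWithinAt_iff_tendsto_slope]
  have hset : Iic h1 \ {h1} = Iio h1 := by ext x; simp [lt_iff_le_and_ne]
  rw [hset]
  have hu0 : u t1 h1 = 0 := hz t1 ⟨by linarith, le_rfl⟩ h1 le_rfl
  have ht : Tendsto (fun x => h1 - x) (𝓝[<] h1) (𝓝[>] 0) := by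
    apply tendsto_nhdsWithin_of_tendsto_nhds_of_eventually_within
    · have : Tendsto (fun x => h1 - x) (𝓝 h1) (𝓝 (h1 - h1)) := Continuous.tendsto (by fun_prop) _
      rw [sub_self] at this
      exact this.mono_left nhdsWithin_le_nhds
    · filter_upwards [self_mem_nhdsWithin] with x hx
      simp only [mem_Iio, mem_Ioi] at hx ⊢; linarith
  refine ((hm.comp ht).neg).congr' ?_
  filter_upwards [self_mem_nhdsWithin] with x hx
  simp only [mem_Iio] at hx
  simp only [hq, Function.comp, slope_def_field, hu0]
  have h3 : h1 - (h1 - x) = x := by ring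
  rw [h3]
  have : h1 - x ≠ 0 := by linarith
  have : x - h1 ≠ 0 := by linarith
  field_simp
  ring

end

section
theorem slope_le {φ ψ : ℝ → ℝ} {m n x : ℝ} (hφ : HasDerivWithinAt φ (-m) (Iic x) x)
    (hψ : HasDerivWithinAt ψ (-n) (Iic x) x) (he : φ x = ψ x)
    (hle : ∀ᶠ y in 𝓝[<] x, φ y ≤ ψ y) : m ≤ n := by
  have h1 := hψ.sub hφ
  rw [hasDerivWithinAt_iff_tendsto_slope] at h1
  have hset : Iic x \ {x} = Iio x := by ext y; simp [lt_iff_le_and_ne]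
  rw [hset] at h1
  have : -n - -m ≤ 0 := by
    refine le_of_tendsto h1 ?_
    filter_upwards [hle, self_mem_nhdsWithin] with y hy hyx
    simp only [mem_Iio] at hyx
    simp only [slope_def_field, Pi.sub_apply, he]
    apply div_nonpos_of_nonneg_of_nonpos <;> linarith
  linarith

theorem slope_ge {φ : ℝ → ℝ} {m x k ρ : ℝ} (hφ : HasDerivWithinAt φ (-m) (Iic x) x)
    (h0 : φ x = 0) (hρ : 0 < ρ) (hle : ∀ y, 0 < y → y < ρ → k * y ≤ φ (x - y)) : k ≤ m := by
  have h1 : HasDerivWithinAt (fun y => k * (x - y)) (-k) (Iic x) x := by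
    have := ((hasDerivAt_id x).const_sub x).const_mul k
    exact (this.congr_deriv (by ring)).hasDerivWithinAt
  refine slope_le h1 hφ (by simp [h0]) ?_
  filter_upwards [Ioo_mem_nhdsLT (show x - ρ < x by linarith)] with y hy
  have := hle (x - y) (by linarith [hy.2]) (by linarith [hy.1])
  simpa using this

theorem hopf {d t1 r0 Λ K : ℝ} {u : ℝ → ℝ → ℝ} {h : ℝ → ℝ} (hd : 0 < d) (hr0 : 0 < r0)
    (hΛ : 1 ≤ Λ) (hK : 0 ≤ K)
    (hlip : ∀ t ∈ Icc (t1 - r0) t1, |h t - h t1| ≤ Λ * (t1 - t))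
    (hcont : ContinuousOn (fun q : ℝ × ℝ => u q.1 q.2) (Icc (t1 - r0) t1 ×ˢ univ))
    (hnn : ∀ t ∈ Icc (t1 - r0) t1, ∀ x, h t1 - r0 ≤ x → 0 ≤ u t x)
    (hpos : ∀ t ∈ Ico (t1 - r0) t1, ∀ x, h t1 - r0 < x → x < h t → 0 < u t x)
    (hz : u t1 (h t1) = 0)
    (hpde : ∀ t ∈ Ioc (t1 - r0) t1, ∀ x, h t1 - r0 < x → x < h t →
      ∃ b F, PD u t x b (d * b + F) ∧ - K * u t x ≤ F) {m : ℝ}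
    (hm : HasDerivWithinAt (u t1) (-m) (Iic (h t1)) (h t1)) : 0 < m := by
  set h1 := h t1 with hh1
  obtain ⟨ρ, hρ⟩ : ∃ ρ, ρ = r0 / 4 := ⟨_, rfl⟩
  obtain ⟨σ, hσ⟩ : ∃ σ, σ = Λ + 1 := ⟨_, rfl⟩
  have hσ0 : 0 < σ := by linarith
  have hρ0 : 0 < ρ := by linarith
  obtain ⟨τ, hτ⟩ : ∃ τ, τ = min (r0 / 2) (ρ / (2 * σ)) := ⟨_, rfl⟩
  have hτ0 : 0 < τ := by rw [hτ]; apply lt_min <;> positivity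
  have hτr : τ ≤ r0 / 2 := by rw [hτ]; exact min_le_left _ _
  have hτρ : σ * τ ≤ ρ / 2 := by
    have : τ ≤ ρ / (2 * σ) := by rw [hτ]; exact min_le_right _ _
    calc σ * τ ≤ σ * (ρ / (2 * σ)) := by gcongr
      _ = ρ / 2 := by field_simp
  have hℓ0 : 0 < ρ - σ * τ := by linarith
  -- initial slice
  have hsl : ∃ m0 > 0, ∀ x, |x - (h1 - ρ)| ≤ ρ - σ * τ → m0 ≤ u (t1 - τ) x := by
    have hc : IsCompact (Icc (h1 - ρ - (ρ - σ * τ)) (h1 - ρ + (ρ - σ * τ))) := isCompact_Icc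
    have hcu : ContinuousOn (u (t1 - τ)) (Icc (h1 - ρ - (ρ - σ * τ)) (h1 - ρ + (ρ - σ * τ))) :=
      hcont.comp (f := fun x => (t1 - τ, x)) (by fun_prop)
        (fun x _ => ⟨⟨by simp only; linarith, by simp only; linarith⟩, trivial⟩)
    obtain ⟨x0, hx0, hmin⟩ := hc.exists_isMinOn ⟨h1 - ρ, by constructor <;> linarith⟩ hcu
    refine ⟨u (t1 - τ) x0, ?_, fun x hx => hmin ?_⟩
    · refine hpos _ ⟨by linarith, by linarith⟩ x0 (by nlinarith [hx0.1]) ?_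
      have := (abs_le.1 (hlip (t1 - τ) ⟨by linarith, by linarith⟩)).1
      have e : σ * τ = Λ * τ + τ := by rw [hσ]; ring
      have e2 : t1 - (t1 - τ) = τ := by ring
      rw [e2] at this
      have := hx0.2
      linarith
    · have := abs_le.1 hx
      constructor <;> linarith [this.1, this.2]
  obtain ⟨m0, hm0, hsl⟩ := hsl
  obtain ⟨c, hc, hbump⟩ := bump_below (K := K) (ℓ0 := ρ - σ * τ) (σ := σ) (T := τ) (m := m0) (θ := 1)
    hd hK hℓ0 hσ0.le hτ0.le hm0 one_pos
  have hb := hbump u (t1 - τ) (h1 - ρ) τ hτ0.le le_rfl ?_ hsl ?_ ?_ t1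
  · have hkm : c * ρ ≤ m := by
      refine slope_ge hm hz hρ0 (fun y hy hyρ => ?_)
      have e : ρ - σ * τ + σ * (t1 - (t1 - τ)) = ρ := by ring
      have := hb (h1 - y) (by linarith) (by linarith) (by
        rw [e, abs_le]; constructor <;> linarith)
      rw [e] at this
      refine le_trans ?_ this
      have e2 : c * (ρ ^ 2 - (h1 - y - (h1 - ρ)) ^ 2) - c * ρ * y = c * (y * (ρ - y)) := by ring
      have : 0 ≤ c * (y * (ρ - y)) := by
        have : 0 ≤ ρ - y := by linarith
        positivity
      linarith
    have : 0 < c * ρ := by positivity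
    linarith
  · refine hcont.mono ?_
    rintro ⟨t, x⟩ ⟨q1, q2, q3⟩
    simp only at q1 q2
    exact ⟨⟨by simp only; linarith, by simp only; linarith⟩, trivial⟩
  · intro t x q1 q2 q3
    have : σ * (t - (t1 - τ)) ≤ σ * τ := by gcongr; linarith
    have := (abs_le.1 q3).1
    exact hnn t ⟨by linarith, by linarith⟩ x (by linarith)
  · intro t x q1 q2 q3 _
    have htt : t ≤ t1 := by linarith
    have k1 : σ * (t - (t1 - τ)) ≤ σ * τ := by gcongr; linarith
    have k2 := (abs_lt.1 q3)
    have k3 := (abs_le.1 (hlip t ⟨by linarith, by linarith⟩)).1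
    have e : σ * (t - (t1 - τ)) = σ * τ - Λ * (t1 - t) - (t1 - t) := by rw [hσ]; ring
    obtain ⟨b, F, hpd, hF⟩ := hpde t ⟨by linarith, by linarith⟩ x (by linarith [k2.1]) (by linarith [k2.2])
    exact ⟨b, _, hpd, by linarith⟩

end

section
/-- Zero-extended solution of the free boundary problem, without the Stefan conditions. -/
structure Raw (d : ℝ) (f : ℝ → ℝ → ℝ → ℝ) (u : ℝ → ℝ → ℝ) (g h : ℝ → ℝ) : Prop where
  gc : ContinuousOn g (Ici 0)
  hc : ContinuousOn h (Ici 0)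
  uc : ContinuousOn (fun q : ℝ × ℝ => u q.1 q.2) (Ici 0 ×ˢ univ)
  supp : ∀ t ≥ 0, ∀ x, (x ≤ g t ∨ h t ≤ x) → u t x = 0
  pde : ∀ t > 0, ∀ x, g t < x → x < h t → ∃ b, PD u t x b (d * b + f t x (u t x))
  init : ∀ x, g 0 < x → x < h 0 → 0 < u 0 x

namespace Raw
variable {d : ℝ} {f : ℝ → ℝ → ℝ → ℝ} {u : ℝ → ℝ → ℝ} {g h : ℝ → ℝ}

theorem dom (H : Raw d f u g h) {t x : ℝ} (ht : 0 ≤ t) (hu : u t x ≠ 0) : g t < x ∧ x < h t := by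
  constructor
  · by_contra hc; exact hu (H.supp t ht x (Or.inl (not_lt.1 hc)))
  · by_contra hc; exact hu (H.supp t ht x (Or.inr (not_lt.1 hc)))

theorem bounds (H : Raw d f u g h) (T : ℝ) : ∃ X > 0, ∀ t ∈ Icc 0 T, ∀ x, u t x ≠ 0 → |x| ≤ X := by
  obtain ⟨B1, h1⟩ := (isCompact_Icc (a := (0:ℝ)) (b := T)).exists_bound_of_continuousOn
    (H.gc.mono Icc_subset_Ici_self)
  obtain ⟨B2, h2⟩ := (isCompact_Icc (a := (0:ℝ)) (b := T)).exists_bound_of_continuousOn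
    (H.hc.mono Icc_subset_Ici_self)
  refine ⟨|B1| + |B2| + 1, by positivity, fun t ht x hx => ?_⟩
  have h3 := abs_le.1 (h1 t ht)
  have h4 := abs_le.1 (h2 t ht)
  obtain ⟨h5, h6⟩ := H.dom ht.1 hx
  have := le_abs_self B1
  have := le_abs_self B2
  have := abs_nonneg B1
  have := abs_nonneg B2
  rw [abs_le]; constructor <;> linarith [h3.1, h3.2, h4.1, h4.2]

theorem bdd (H : Raw d f u g h) (T : ℝ) : ∃ R > 0, ∀ t ∈ Icc 0 T, ∀ x, |u t x| ≤ R := by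
  obtain ⟨X, hX, hb⟩ := H.bounds T
  obtain ⟨R, hR⟩ := ((isCompact_Icc (a := (0:ℝ)) (b := T)).prod
    (isCompact_Icc (a := -X) (b := X))).exists_bound_of_continuousOn
    (H.uc.mono (prod_mono Icc_subset_Ici_self (subset_univ _)))
  refine ⟨|R| + 1, by positivity, fun t ht x => ?_⟩
  by_cases hx : u t x = 0
  · rw [hx, abs_zero]; positivity
  · have := hR (t, x) ⟨ht, abs_le.1 (hb t ht x hx)⟩
    rw [Real.norm_eq_abs] at this
    have := le_abs_self R
    simp only at *
    linarith

/-- reachability by positive curves from time zero -/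
def Reach (u : ℝ → ℝ → ℝ) (t x : ℝ) : Prop :=
  ∃ ξ : ℝ → ℝ, Continuous ξ ∧ ξ t = x ∧ ∀ s ∈ Icc 0 t, 0 < u s (ξ s)

theorem reach_ext {t0 x0 ρ t1 s y : ℝ}
    (hbox : ∀ r y, 0 ≤ r → |r - t0| < ρ → |y - x0| < ρ → 0 < u r y)
    {ξ : ℝ → ℝ} (hξ : Continuous ξ) (h0 : 0 ≤ t1) (hpos : ∀ s ∈ Icc 0 t1, 0 < u s (ξ s))
    (h1 : |t1 - t0| < ρ) (h2 : |ξ t1 - x0| < ρ) (h3 : t1 < s) (h4 : |s - t0| < ρ) (h5 : |y - x0| < ρ) :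
    Reach u s y := by
  have hst : 0 < s - t1 := by linarith
  refine ⟨fun r => ξ (min r t1) + max 0 (r - t1) / (s - t1) * (y - ξ t1), by fun_prop, ?_, ?_⟩
  · simp only
    rw [min_eq_right h3.le, max_eq_right hst.le, div_self hst.ne']; ring
  · intro r hr
    rcases le_total r t1 with hrt | hrt
    · simp only
      rw [min_eq_left hrt, max_eq_left (by linarith)]
      simpa using hpos r ⟨hr.1, hrt⟩
    · simp only
      rw [min_eq_right hrt, max_eq_right (by linarith)]
      obtain ⟨θ, hθ⟩ : ∃ θ, θ = (r - t1) / (s - t1) := ⟨_, rfl⟩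
      have hθ0 : 0 ≤ θ := by rw [hθ]; apply div_nonneg <;> linarith
      have hθ1 : θ ≤ 1 := by rw [hθ, div_le_one hst]; linarith [hr.2]
      rw [← hθ]
      rw [abs_lt] at h1 h2 h4 h5
      refine hbox _ _ hr.1 ?_ ?_
      · rw [abs_lt]; constructor <;> linarith [hr.2]
      · rw [abs_lt]
        have e : ξ t1 + θ * (y - ξ t1) - x0 = (1 - θ) * (ξ t1 - x0) + θ * (y - x0) := by ring
        rw [e]
        rcases eq_or_lt_of_le hθ0 with h | h
        · rw [← h]; simpa using h2
        · constructor <;> nlinarith [h2.1, h2.2, h5.1, h5.2]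

theorem box (H : Raw d f u g h) {t0 x0 : ℝ} (ht : 0 ≤ t0) (hu : 0 < u t0 x0) :
    ∃ ρ > 0, ∀ r y, 0 ≤ r → |r - t0| < ρ → |y - x0| < ρ → 0 < u r y := by
  have h1 := (H.uc (t0, x0) ⟨ht, trivial⟩).eventually (lt_mem_nhds hu)
  rw [eventually_nhdsWithin_iff, Metric.eventually_nhds_iff] at h1
  obtain ⟨ρ, hρ, h2⟩ := h1
  refine ⟨ρ, hρ, fun r y hr hr2 hy => h2 (y := (r, y)) ?_ ⟨hr, trivial⟩⟩
  rw [Prod.dist_eq, Real.dist_eq, Real.dist_eq]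
  exact max_lt hr2 hy

theorem reach_open (H : Raw d f u g h) {t x : ℝ} (ht : 0 ≤ t) (hR : Reach u t x) :
    ∀ᶠ q : ℝ × ℝ in 𝓝 (t, x), 0 ≤ q.1 → Reach u q.1 q.2 := by
  obtain ⟨ξ, hξ, hξt, hpos⟩ := hR
  obtain ⟨ρ, hρ, hbox⟩ := H.box ht (hξt ▸ hpos t ⟨ht, le_rfl⟩)
  rcases ht.eq_or_lt with he | hlt
  · subst he
    rw [Metric.eventually_nhds_iff]
    refine ⟨ρ, hρ, ?_⟩
    rintro ⟨s, y⟩ hq hs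
    rw [Prod.dist_eq, Real.dist_eq, Real.dist_eq] at hq
    obtain ⟨q1, q2⟩ := max_lt_iff.1 hq
    simp only at q1 q2 hs
    refine ⟨fun _ => y, continuous_const, rfl, fun r hr => hbox r y hr.1 ?_ q2⟩
    rw [sub_zero, abs_of_nonneg hr.1]
    rw [sub_zero, abs_of_nonneg hs] at q1
    linarith [hr.2]
  · -- choose an earlier time
    have e1 : ∀ᶠ s in 𝓝[<] t, |ξ s - x| < ρ := by
      apply nhdsWithin_le_nhds
      have : Tendsto (fun s => |ξ s - x|) (𝓝 t) (𝓝 |ξ t - x|) := Continuous.tendsto (by fun_prop) t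
      rw [hξt, sub_self, abs_zero] at this
      exact this.eventually (gt_mem_nhds hρ)
    have e2 : Ioo (max 0 (t - ρ)) t ∈ 𝓝[<] t := Ioo_mem_nhdsLT (max_lt hlt (by linarith))
    obtain ⟨t1, ht1, ht2⟩ := (e1.and e2).exists
    have k1 : 0 < t1 := (le_max_left _ _).trans_lt ht2.1
    have k2 : t - ρ < t1 := (le_max_right _ _).trans_lt ht2.1
    have k3 := ht2.2
    have e3 : ∀ᶠ q : ℝ × ℝ in 𝓝 (t, x), t1 < q.1 ∧ |q.1 - t| < ρ ∧ |q.2 - x| < ρ := by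
      refine (((continuous_fst).tendsto (t, x)).eventually (lt_mem_nhds k3)).and (Eventually.and ?_ ?_)
      · have : Tendsto (fun q : ℝ × ℝ => |q.1 - t|) (𝓝 (t, x)) (𝓝 |t - t|) := Continuous.tendsto (by fun_prop) (t, x)
        rw [sub_self, abs_zero] at this
        exact this.eventually (gt_mem_nhds hρ)
      · have : Tendsto (fun q : ℝ × ℝ => |q.2 - x|) (𝓝 (t, x)) (𝓝 |x - x|) := Continuous.tendsto (by fun_prop) (t, x)
        rw [sub_self, abs_zero] at this
        exact this.eventually (gt_mem_nhds hρ)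
    filter_upwards [e3] with q hq _
    exact reach_ext hbox hξ k1.le (fun s hs => hpos s ⟨hs.1, hs.2.trans k3.le⟩)
      (by rw [abs_lt]; constructor <;> linarith) ht1 hq.1 hq.2.1 hq.2.2

theorem reach_all (H : Raw d f u g h) (hf : FLip f) (hd : 0 < d) {T x0 : ℝ} (hT : 0 ≤ T)
    (hu : 0 < u T x0) : Reach u T x0 := by
  by_contra hnR
  obtain ⟨R, hR, hRb⟩ := H.bdd T
  obtain ⟨X, hX, hXb⟩ := H.bounds T
  obtain ⟨K, hK, -, hKf⟩ := hf.abs_le hR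
  obtain ⟨η, hη⟩ : ∃ η, η = u T x0 * Real.exp (-K * T) / 2 := ⟨_, rfl⟩
  have hη0 : 0 < η := by rw [hη]; positivity
  have hηT : η * Real.exp (K * T) = u T x0 / 2 := by
    rw [hη, div_mul_eq_mul_div, mul_assoc, ← Real.exp_add]; simp
  set S := {q : ℝ × ℝ | q.1 ∈ Icc 0 T ∧ η ≤ u q.1 q.2 ∧ ¬ Reach u q.1 q.2} with hS
  have hclosed : IsClosed S := by
    rw [← isSeqClosed_iff_isClosed]
    intro q q0 hq hlim
    have hm : ∀ n, (q n).1 ∈ Icc 0 T := fun n => (hq n).1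
    have h1 : q0.1 ∈ Icc 0 T := isClosed_Icc.mem_of_tendsto
      ((continuous_fst.tendsto q0).comp hlim) (Eventually.of_forall hm)
    have h2 : Tendsto (fun n => u (q n).1 (q n).2) atTop (𝓝 (u q0.1 q0.2)) := by
      have ht : Tendsto q atTop (𝓝[Ici 0 ×ˢ univ] q0) :=
        tendsto_nhdsWithin_of_tendsto_nhds_of_eventually_within _ hlim
          (Eventually.of_forall fun n => ⟨(hm n).1, trivial⟩)
      exact (H.uc q0 ⟨h1.1, trivial⟩).tendsto.comp ht
    refine ⟨h1, ge_of_tendsto h2 (Eventually.of_forall fun n => (hq n).2.1), fun hr => ?_⟩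
    obtain ⟨n, hn⟩ := (hlim.eventually (H.reach_open h1.1 hr)).exists
    exact (hq n).2.2 (hn (hm n).1)
  have hcomp : IsCompact S := by
    refine (isCompact_Icc.prod (isCompact_Icc (a := -X) (b := X))).of_isClosed_subset
      (s := Icc 0 T ×ˢ Icc (-X) X) hclosed ?_
    rintro ⟨t, x⟩ ⟨q1, q2, q3⟩
    simp only at q1 q2
    exact ⟨q1, abs_le.1 (hXb t q1 x (by linarith))⟩
  have key := max_principle_compact (d := d) (K := K) hd.le hcomp
    (z := fun t x => u t x - η * Real.exp (K * t)) ?_ ?_ T x0 ⟨⟨hT, le_rfl⟩, ?_, hnR⟩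
  · skip
    rw [hηT] at key
    linarith
  · exact (H.uc.mono (fun q hq => ⟨hq.1.1, trivial⟩)).sub (by fun_prop)
  · rintro t x ⟨q1, q2, q3⟩ hpos
    simp only at q1 q2 q3 hpos
    have hexp : 1 ≤ Real.exp (K * t) := Real.one_le_exp (mul_nonneg hK.le q1.1)
    have hηu : η < u t x := by nlinarith
    have hu0 : 0 < u t x := by linarith
    obtain ⟨ρ, hρ, hbox⟩ := H.box q1.1 hu0
    have ht : 0 < t := by
      rcases q1.1.eq_or_lt with he | hlt
      · exfalso
        subst he
        refine q3 ⟨fun _ => x, continuous_const, rfl, fun s hs => ?_⟩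
        have : s = 0 := le_antisymm hs.2 hs.1
        rw [this]; exact hu0
      · exact hlt
    refine ⟨?_, ?_, ?_⟩
    · have e1 : ∀ᶠ y in 𝓝 x, η < u t y := by
        have : Tendsto (fun y => ((t, y) : ℝ × ℝ)) (𝓝 x) (𝓝[Ici 0 ×ˢ univ] (t, x)) :=
          tendsto_nhdsWithin_of_tendsto_nhds_of_eventually_within _ (Continuous.tendsto (by fun_prop) x)
            (Eventually.of_forall fun n => ⟨q1.1, trivial⟩)
        exact ((H.uc (t, x) ⟨q1.1, trivial⟩).tendsto.comp this).eventually (lt_mem_nhds hηu)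
      have e2 : ∀ᶠ y in 𝓝 x, |y - x| < ρ := by
        have : Tendsto (fun y : ℝ => |y - x|) (𝓝 x) (𝓝 |x - x|) := Continuous.tendsto (by fun_prop) x
        rw [sub_self, abs_zero] at this
        exact this.eventually (gt_mem_nhds hρ)
      filter_upwards [e1, e2] with y hy1 hy2
      refine ⟨q1, hy1.le, fun hr => q3 ?_⟩
      obtain ⟨ξ, hξ, hξt, hpos⟩ := hr
      simp only at hξt hpos
      have e1 : ∀ᶠ s in 𝓝[<] t, |ξ s - x| < ρ := by
        apply nhdsWithin_le_nhds
        have : Tendsto (fun s => |ξ s - x|) (𝓝 t) (𝓝 |ξ t - x|) := Continuous.tendsto (by fun_prop) t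
        rw [hξt] at this
        exact this.eventually (gt_mem_nhds hy2)
      have e2 : Ioo (max 0 (t - ρ)) t ∈ 𝓝[<] t := Ioo_mem_nhdsLT (max_lt ht (by linarith))
      obtain ⟨t1, ht1, ht2⟩ := (e1.and e2).exists
      have k1 : 0 < t1 := (le_max_left _ _).trans_lt ht2.1
      have k2 : t - ρ < t1 := (le_max_right _ _).trans_lt ht2.1
      have k3 := ht2.2
      exact reach_ext hbox hξ k1.le (fun s hs => hpos s ⟨hs.1, hs.2.trans k3.le⟩)
        (by rw [abs_lt]; constructor <;> linarith) ht1 k3 (by simpa using hρ) (by simpa using hρ)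
    · have e1 : ∀ᶠ s in 𝓝[<] t, η < u s x := by
        have : Tendsto (fun s => ((s, x) : ℝ × ℝ)) (𝓝[<] t) (𝓝[Ici 0 ×ˢ univ] (t, x)) := by
          refine tendsto_nhdsWithin_of_tendsto_nhds_of_eventually_within _
            ((Continuous.tendsto (by fun_prop) t).mono_left nhdsWithin_le_nhds) ?_
          filter_upwards [Ioo_mem_nhdsLT ht] with s hs
          exact ⟨hs.1.le, trivial⟩
        exact ((H.uc (t, x) ⟨q1.1, trivial⟩).tendsto.comp this).eventually (lt_mem_nhds hηu)
      have e2 : Ioo (max 0 (t - ρ)) t ∈ 𝓝[<] t := Ioo_mem_nhdsLT (max_lt ht (by linarith))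
      filter_upwards [e1, e2] with s hs1 ht2
      have k1 : 0 < s := (le_max_left _ _).trans_lt ht2.1
      have k2 : t - ρ < s := (le_max_right _ _).trans_lt ht2.1
      have k3 := ht2.2
      refine ⟨⟨k1.le, k3.le.trans q1.2⟩, hs1.le, fun hr => q3 ?_⟩
      obtain ⟨ξ, hξ, hξt, hpos⟩ := hr
      simp only at hξt hpos
      exact reach_ext hbox hξ k1.le hpos
        (by rw [abs_lt]; constructor <;> linarith) (by rw [hξt]; simpa using hρ) k3 (by simpa using hρ) (by simpa using hρ)
    · obtain ⟨g1, g2⟩ := H.dom q1.1 hu0.ne'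
      obtain ⟨b, hpd⟩ := H.pde t ht x g1 g2
      have hpd2 : PD (fun t (_ : ℝ) => η * Real.exp (K * t)) t x 0 (η * (Real.exp (K * t) * K)) := by
        refine ⟨D2.const _ _, ?_⟩
        have := (((hasDerivAt_id t).const_mul K).exp).const_mul η
        exact this.congr_deriv (by simp)
      refine ⟨_, _, hpd.sub hpd2, ?_⟩
      have h1 := (abs_le.1 (hKf t x (u t x) hu0.le ((abs_le.1 (hRb t q1 x)).2))).2
      nlinarith
  · have : 1 ≤ Real.exp (K * T) := Real.one_le_exp (mul_nonneg hK.le hT)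
    simp only
    nlinarith

end Raw

end

section
namespace Raw
variable {d : ℝ} {f : ℝ → ℝ → ℝ → ℝ} {u : ℝ → ℝ → ℝ} {g h : ℝ → ℝ}

/-- positivity between two positive curves -/
theorem pos_between (H : Raw d f u g h) (hf : FLip f) (hd : 0 < d) {t0 T : ℝ} (ht0 : 0 ≤ t0)
    {ξl ξr : ℝ → ℝ} (hl : Continuous ξl) (hr : Continuous ξr)
    (pl : ∀ s ∈ Icc 0 T, 0 < u s (ξl s)) (pr : ∀ s ∈ Icc 0 T, 0 < u s (ξr s))
    (pb : ∀ y, ξl t0 ≤ y → y ≤ ξr t0 → 0 < u t0 y) :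
    ∀ s y, t0 ≤ s → s ≤ T → ξl s ≤ y → y ≤ ξr s → 0 < u s y := by
  set D := {q : ℝ × ℝ | t0 ≤ q.1 ∧ q.1 ≤ T ∧ ξl q.1 ≤ q.2 ∧ q.2 ≤ ξr q.1} with hDdef
  have hDclosed : IsClosed D := by
    simp only [hDdef, Set.ofPred_and]
    refine (isClosed_le (by fun_prop) (by fun_prop)).inter
      ((isClosed_le (by fun_prop) (by fun_prop)).inter
      ((isClosed_le (by fun_prop) (by fun_prop)).inter (isClosed_le (by fun_prop) (by fun_prop))))
  have hDcomp : IsCompact D := by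
    obtain ⟨B1, h1⟩ := (isCompact_Icc (a := t0) (b := T)).exists_bound_of_continuousOn hl.continuousOn
    obtain ⟨B2, h2⟩ := (isCompact_Icc (a := t0) (b := T)).exists_bound_of_continuousOn hr.continuousOn
    refine (isCompact_Icc.prod (isCompact_Icc (a := -B1) (b := B2))).of_isClosed_subset
      (s := Icc t0 T ×ˢ Icc (-B1) B2) hDclosed ?_
    rintro ⟨t, x⟩ ⟨q1, q2, q3, q4⟩
    simp only at q1 q2 q3 q4
    have h3 := (abs_le.1 (h1 t ⟨q1, q2⟩)).1
    have h4 := (abs_le.1 (h2 t ⟨q1, q2⟩)).2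
    exact ⟨⟨q1, q2⟩, by constructor <;> simp only <;> linarith⟩
  have hDuc : ContinuousOn (fun q : ℝ × ℝ => u q.1 q.2) D :=
    H.uc.mono (fun q hq => ⟨ht0.trans hq.1, trivial⟩)
  set Bd := D ∩ {q : ℝ × ℝ | q.1 = t0 ∨ q.2 = ξl q.1 ∨ q.2 = ξr q.1} with hBd
  have hBdpos : ∀ q ∈ Bd, 0 < u q.1 q.2 := by
    rintro ⟨t, x⟩ ⟨⟨q1, q2, q3, q4⟩, hq⟩
    simp only at q1 q2 q3 q4 hq
    rcases hq with hq | hq | hq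
    · simp only at hq; subst hq; exact pb x q3 q4
    · simp only at hq; rw [hq]; exact pl t ⟨by linarith, q2⟩
    · simp only at hq; rw [hq]; exact pr t ⟨by linarith, q2⟩
  have hBdcomp : IsCompact Bd := by
    refine hDcomp.inter_right ?_
    simp only [Set.ofPred_or]
    exact (isClosed_eq (by fun_prop) (by fun_prop)).union
      ((isClosed_eq (by fun_prop) (by fun_prop)).union (isClosed_eq (by fun_prop) (by fun_prop)))
  obtain ⟨m, hm, hmb⟩ : ∃ m > 0, ∀ q ∈ Bd, m ≤ u q.1 q.2 := by
    rcases Bd.eq_empty_or_nonempty with he | hne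
    · exact ⟨1, one_pos, fun q hq => by rw [he] at hq; exact absurd hq (notMem_empty _)⟩
    · obtain ⟨q0, hq0, hmin⟩ := hBdcomp.exists_isMinOn hne (hDuc.mono inter_subset_left)
      exact ⟨u q0.1 q0.2, hBdpos q0 hq0, fun q hq => hmin hq⟩
  obtain ⟨K, hK, -, hKf⟩ := hf.abs_le hm
  have key := min_principle_strict hDcomp
    (ζ := fun t x => u t x - m / 2 * Real.exp (-(K + 1) * (t - t0))) ?_ ?_
  · intro s y h1 h2 h3 h4
    have := key s y ⟨h1, h2, h3, h4⟩
    have : 0 < m / 2 * Real.exp (-(K + 1) * (s - t0)) := by positivity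
    linarith
  · exact hDuc.sub (by fun_prop)
  · rintro t x hq hle
    have hexp : Real.exp (-(K + 1) * (t - t0)) ≤ 1 := by
      apply Real.exp_le_one_iff.2
      have := mul_nonneg (by linarith : 0 ≤ K + 1) (by linarith [hq.1] : 0 ≤ t - t0)
      linarith
    have hult : u t x < m := by nlinarith
    have hnB : (t, x) ∉ Bd := fun hb => by have := hmb _ hb; simp only at this; linarith
    have hnB' : ¬ (t = t0 ∨ x = ξl t ∨ x = ξr t) := fun hb => hnB ⟨hq, hb⟩
    push Not at hnB'
    obtain ⟨n1, n2, n3⟩ := hnB'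
    obtain ⟨q1, q2, q3, q4⟩ := hq
    simp only at q1 q2 q3 q4
    have n1' : t0 < t := lt_of_le_of_ne q1 (Ne.symm n1)
    have n2' : ξl t < x := lt_of_le_of_ne q3 (Ne.symm n2)
    have n3' : x < ξr t := lt_of_le_of_ne q4 n3
    refine ⟨?_, ?_, ?_⟩
    · filter_upwards [Ioo_mem_nhds n2' n3'] with y hy
      exact ⟨q1, q2, hy.1.le, hy.2.le⟩
    · have e1 : ∀ᶠ s in 𝓝[<] t, ξl s < x :=
        nhdsWithin_le_nhds ((hl.tendsto t).eventually (gt_mem_nhds n2'))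
      have e2 : ∀ᶠ s in 𝓝[<] t, x < ξr s :=
        nhdsWithin_le_nhds ((hr.tendsto t).eventually (lt_mem_nhds n3'))
      filter_upwards [e1, e2, Ioo_mem_nhdsLT n1'] with s h1 h2 h3
      exact ⟨h3.1.le, h3.2.le.trans q2, h1.le, h2.le⟩
    · intro hz
      obtain ⟨E, hE⟩ : ∃ E, E = m / 2 * Real.exp (-(K + 1) * (t - t0)) := ⟨_, rfl⟩
      have hE0 : 0 < E := by rw [hE]; positivity
      have hu : u t x = E := by rw [hE]; linarith
      have hu0 : 0 < u t x := by linarith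
      obtain ⟨g1, g2⟩ := H.dom (by linarith : 0 ≤ t) hu0.ne'
      obtain ⟨b, hpd⟩ := H.pde t (by linarith) x g1 g2
      have hpd2 : PD (fun t (_ : ℝ) => m / 2 * Real.exp (-(K + 1) * (t - t0))) t x 0 (-(K + 1) * E) := by
        refine ⟨D2.const _ _, ?_⟩
        have := ((((hasDerivAt_id t).sub_const t0).const_mul (-(K + 1))).exp).const_mul (m / 2)
        exact this.congr_deriv (by rw [hE]; simp; ring)
      refine ⟨_, _, hpd.sub hpd2, fun hb => ?_⟩
      have h1 := (abs_le.1 (hKf t x (u t x) hu0.le hult.le)).1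
      rw [hu] at h1
      rw [hu]
      have hb' : 0 ≤ b := by linarith
      have := mul_nonneg hd.le hb'
      nlinarith

/-- The positivity set of each time slice is an interval. -/
theorem interval (H : Raw d f u g h) (hf : FLip f) (hd : 0 < d) {T xl xm xr : ℝ} (hT : 0 ≤ T)
    (h1 : xl ≤ xm) (h2 : xm ≤ xr) (hl : 0 < u T xl) (hr : 0 < u T xr) : 0 < u T xm := by
  rcases h1.eq_or_lt with he | h1'
  · rw [← he]; exact hl
  obtain ⟨ξl, cl, el, pl⟩ := H.reach_all hf hd hT hl
  obtain ⟨ξr, cr, er, pr⟩ := H.reach_all hf hd hT hr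
  obtain ⟨t0, ht0, ht0T, pb⟩ : ∃ t0, 0 ≤ t0 ∧ t0 ≤ T ∧ ∀ y, ξl t0 ≤ y → y ≤ ξr t0 → 0 < u t0 y := by
    set C := Icc 0 T ∩ {s | ξr s ≤ ξl s} with hC
    rcases C.eq_empty_or_nonempty with he | hne
    · refine ⟨0, le_rfl, hT, fun y hy1 hy2 => ?_⟩
      have k1 := (H.dom le_rfl (pl 0 ⟨le_rfl, hT⟩).ne').1
      have k2 := (H.dom le_rfl (pr 0 ⟨le_rfl, hT⟩).ne').2
      exact H.init y (by linarith) (by linarith)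
    · obtain ⟨t0, h0, hs⟩ := hne
      refine ⟨t0, h0.1, h0.2, fun y hy1 hy2 => ?_⟩
      have hs' : ξr t0 ≤ ξl t0 := hs
      have : y = ξl t0 := by linarith
      rw [this]; exact pl t0 h0
  exact H.pos_between hf hd ht0 cl cr pl pr pb T xm ht0T le_rfl (by rw [el]; exact h1) (by rw [er]; exact h2)

end Raw

end

section
theorem IsFBPSolution.raw {d μ g₀ h₀ : ℝ} {f : ℝ → ℝ → ℝ → ℝ} {u₀ : ℝ → ℝ} {u : ℝ → ℝ → ℝ}
    {g h : ℝ → ℝ} (S : IsFBPSolution d μ f g₀ h₀ u₀ u g h) (hgh : g₀ < h₀) (hm : memH g₀ h₀ u₀) :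
    Raw d f u g h := by
  have gc := S.g_smooth.continuousOn
  have hc := S.h_smooth.continuousOn
  have hsupp : ∀ t ≥ 0, ∀ x, (x ≤ g t ∨ h t ≤ x) → u t x = 0 := by
    intro t ht x hx
    have hbl : u t (g t) = 0 := by
      rcases ht.lt_or_eq with h1 | h1
      · exact S.bc_left t h1
      · rw [← h1, S.g_init, S.init g₀ ⟨le_rfl, hgh.le⟩]; exact hm.2.1
    have hbr : u t (h t) = 0 := by
      rcases ht.lt_or_eq with h1 | h1
      · exact S.bc_right t h1
      · rw [← h1, S.h_init, S.init h₀ ⟨hgh.le, le_rfl⟩]; exact hm.2.2.1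
    rcases hx with hx | hx
    · rcases hx.lt_or_eq with h1 | h1
      · exact S.ext t ht x (Or.inl h1)
      · rw [h1]; exact hbl
    · rcases hx.lt_or_eq with h1 | h1
      · exact S.ext t ht x (Or.inr h1)
      · rw [← h1]; exact hbr
  have hcl : IsClosed (Ici (0:ℝ) ×ˢ (univ : Set ℝ)) := isClosed_Ici.prod isClosed_univ
  have gcp : ContinuousOn (fun q : ℝ × ℝ => g q.1) (Ici (0:ℝ) ×ˢ (univ : Set ℝ)) :=
    gc.comp continuousOn_fst (fun q hq => hq.1)
  have hcp : ContinuousOn (fun q : ℝ × ℝ => h q.1) (Ici (0:ℝ) ×ˢ (univ : Set ℝ)) :=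
    hc.comp continuousOn_fst (fun q hq => hq.1)
  have c1 := hcl.isClosed_le gcp continuousOn_snd
  have c2 := hcl.isClosed_le continuousOn_snd hcp
  have c3 := hcl.isClosed_le continuousOn_snd gcp
  have c4 := hcl.isClosed_le hcp continuousOn_snd
  refine ⟨gc, hc, ?_, hsupp, ?_, ?_⟩
  · have d1 : ContinuousOn (fun q : ℝ × ℝ => u q.1 q.2)
      ({x ∈ Ici (0:ℝ) ×ˢ (univ : Set ℝ) | g x.1 ≤ x.2} ∩
      {x ∈ Ici (0:ℝ) ×ˢ (univ : Set ℝ) | x.2 ≤ h x.1}) := by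
      refine S.u_cont.mono ?_
      rintro ⟨a, b⟩ ⟨⟨⟨h1, _⟩, h2⟩, ⟨_, h3⟩⟩
      exact ⟨h1, h2, h3⟩
    have d2 : ContinuousOn (fun q : ℝ × ℝ => u q.1 q.2)
      ({x ∈ Ici (0:ℝ) ×ˢ (univ : Set ℝ) | x.2 ≤ g x.1} ∪
        {x ∈ Ici (0:ℝ) ×ˢ (univ : Set ℝ) | h x.1 ≤ x.2}) := by
      refine (continuousOn_const (c := (0:ℝ))).congr ?_
      rintro ⟨a, b⟩ (⟨⟨h1, _⟩, h2⟩ | ⟨⟨h1, _⟩, h2⟩)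
      · exact hsupp a h1 b (Or.inl h2)
      · exact hsupp a h1 b (Or.inr h2)
    refine (d1.union_of_isClosed d2 (c1.inter c2) (c3.union c4)).mono ?_
    rintro ⟨a, b⟩ ⟨h1, h1'⟩
    by_cases h2 : b ≤ g a
    · exact Or.inr (Or.inl ⟨⟨h1, h1'⟩, h2⟩)
    by_cases h3 : h a ≤ b
    · exact Or.inr (Or.inr ⟨⟨h1, h1'⟩, h3⟩)
    exact Or.inl ⟨⟨⟨h1, h1'⟩, (not_le.1 h2).le⟩, ⟨⟨h1, h1'⟩, (not_le.1 h3).le⟩⟩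
  · intro t ht x h1 h2
    refine S.pde.pd ?_
    filter_upwards [Ioo_mem_nhds h1 h2] with y hy
    exact ⟨ht, hy.1, hy.2⟩
  · intro x h1 h2
    rw [S.g_init] at h1
    rw [S.h_init] at h2
    rw [S.init x ⟨h1.le, h2.le⟩]
    exact hm.2.2.2 x ⟨h1, h2⟩

theorem left_pos_of_neg_slope {φ : ℝ → ℝ} {m x : ℝ} (hφ : HasDerivWithinAt φ (-m) (Iic x) x)
    (h0 : φ x = 0) (hm : 0 < m) : ∀ᶠ y in 𝓝[<] x, 0 < φ y := by
  rw [hasDerivWithinAt_iff_tendsto_slope] at hφ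
  have hset : Iic x \ {x} = Iio x := by ext y; simp [lt_iff_le_and_ne]
  rw [hset] at hφ
  filter_upwards [hφ.eventually (gt_mem_nhds (show -m < 0 by linarith)), self_mem_nhdsWithin]
    with y hy hyx
  simp only [mem_Iio] at hyx
  rw [slope_def_field, h0, sub_zero] at hy
  by_contra hc
  have : 0 ≤ φ y / (y - x) := div_nonneg_of_nonpos (not_lt.1 hc) (by linarith)
  linarith

theorem Raw.right_pos {d μ : ℝ} {f : ℝ → ℝ → ℝ → ℝ} {u : ℝ → ℝ → ℝ}
    {g h : ℝ → ℝ} (H : Raw d f u g h) (hf : FLip f) (hd : 0 < d) (hμ : 0 < μ)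
    (hs : ContDiffOn ℝ 1 h (Ici 0))
    (st : ∀ t > (0:ℝ), HasDerivAt h (-μ * derivWithin (u t) (Iic (h t)) (h t)) t)
    (hinf : Tendsto h atTop atTop) {T0 : ℝ} (hT0 : 0 < T0) (hu0 : ∀ t ≥ T0, 0 < u t 0) :
    ∃ T > 0, ∀ t ≥ T, (∀ x, 0 ≤ x → x < h t → 0 < u t x) ∧
      ∃ m > 0, HasDerivWithinAt (u t) (-m) (Iic (h t)) (h t) ∧ HasDerivAt h (μ * m) t := by
  -- local claim
  have hB : ∀ t ≥ T0, 0 < deriv h t → (∀ x, 0 ≤ x → x < h t → 0 < u t x) ∧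
      ∃ m > 0, HasDerivWithinAt (u t) (-m) (Iic (h t)) (h t) ∧ HasDerivAt h (μ * m) t := by
    intro t ht hp
    have ht0 : 0 < t := by linarith
    have hst := st t ht0
    rw [hst.deriv] at hp
    have hneg : derivWithin (u t) (Iic (h t)) (h t) < 0 := by nlinarith
    have hdiff : DifferentiableWithinAt ℝ (u t) (Iic (h t)) (h t) := by
      by_contra hc
      rw [derivWithin_zero_of_not_differentiableWithinAt hc] at hneg
      exact lt_irrefl _ hneg
    have hder := hdiff.hasDerivWithinAt
    obtain ⟨m, hm⟩ : ∃ m, m = - derivWithin (u t) (Iic (h t)) (h t) := ⟨_, rfl⟩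
    have hm' : derivWithin (u t) (Iic (h t)) (h t) = -m := by rw [hm]; ring
    rw [hm'] at hder
    have hm0 : 0 < m := by linarith
    refine ⟨fun x hx0 hx => ?_, m, hm0, hder, ?_⟩
    · have hev := left_pos_of_neg_slope hder (H.supp t ht0.le _ (Or.inr le_rfl)) hm0
      obtain ⟨y, hy, hy2⟩ := (hev.and (Ioo_mem_nhdsLT hx)).exists
      exact H.interval hf hd ht0.le hx0 hy2.1.le (hu0 t ht) hy
    · exact hst.congr_deriv (by rw [hm']; ring)
  have hdc : ContinuousOn (deriv h) (Ioi 0) :=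
    (hs.mono Ioi_subset_Ici_self).continuousOn_deriv_of_isOpen isOpen_Ioi le_rfl
  -- step A
  obtain ⟨T, hTT0, hTp⟩ : ∃ T ≥ T0, 0 < deriv h T := by
    by_contra hc
    push Not at hc
    have hanti : AntitoneOn h (Ici T0) := by
      refine antitoneOn_of_deriv_nonpos (convex_Ici T0)
        (H.hc.mono (Ici_subset_Ici.2 hT0.le)) ?_ ?_
      · rw [interior_Ici]
        intro t ht
        exact (st t (by have : T0 < t := ht; linarith)).differentiableAt.differentiableWithinAt
      · rw [interior_Ici]
        intro t ht
        exact hc t (le_of_lt ht)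
    obtain ⟨t, h1, h2⟩ := ((hinf.eventually_gt_atTop (h T0)).and (eventually_ge_atTop T0)).exists
    have := hanti (mem_Ici.2 le_rfl) (mem_Ici.2 h2) h2
    linarith
  have hT : 0 < T := by linarith
  -- step C
  have hall : ∀ t ≥ T, 0 < deriv h t := by
    by_contra hc
    push Not at hc
    obtain ⟨t', ht'T, ht'⟩ := hc
    have hclosed : IsClosed {t ∈ Icc T t' | deriv h t ≤ 0} :=
      isClosed_Icc.isClosed_le (hdc.mono (fun t ht => by
        have := ht.1; exact mem_Ioi.2 (by linarith))) continuousOn_const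
    have hne : {t ∈ Icc T t' | deriv h t ≤ 0}.Nonempty := ⟨t', ⟨ht'T, le_rfl⟩, ht'⟩
    have hbd : BddBelow {t ∈ Icc T t' | deriv h t ≤ 0} := ⟨T, fun t ht => ht.1.1⟩
    have hmem := hclosed.csInf_mem hne hbd
    obtain ⟨s, hs'⟩ : ∃ s, s = sInf {t ∈ Icc T t' | deriv h t ≤ 0} := ⟨_, rfl⟩
    rw [← hs'] at hmem
    obtain ⟨⟨hTs, hst'⟩, hsn⟩ := hmem
    have hbefore : ∀ t, T ≤ t → t < s → 0 < deriv h t := by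
      intro t h1 h2
      by_contra hc
      have := csInf_le hbd (show t ∈ {t ∈ Icc T t' | deriv h t ≤ 0} from
        ⟨⟨h1, by linarith⟩, not_lt.1 hc⟩)
      rw [← hs'] at this
      linarith
    have hTs' : T < s := by
      rcases hTs.lt_or_eq with h1 | h1
      · exact h1
      · rw [h1] at hTp; linarith
    have hs0 : 0 < s := by linarith
    have hhs : 0 < h s := (H.dom hs0.le (hu0 s (by linarith)).ne').2
    obtain ⟨r0, hr0⟩ : ∃ r0, r0 = min (s - T) (h s) := ⟨_, rfl⟩
    have hr0p : 0 < r0 := by rw [hr0]; exact lt_min (by linarith) hhs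
    have hr1 : r0 ≤ s - T := hr0 ▸ min_le_left _ _
    have hr2 : r0 ≤ h s := hr0 ▸ min_le_right _ _
    -- Lipschitz
    obtain ⟨Λ, hΛ⟩ := (isCompact_Icc (a := T) (b := s)).exists_bound_of_continuousOn
      (hdc.mono (fun t ht => by have := ht.1; exact mem_Ioi.2 (by linarith)))
    have hlip : ∀ t ∈ Icc (s - r0) s, |h t - h s| ≤ (|Λ| + 1) * (s - t) := by
      intro t ht
      have hder : ∀ y ∈ Icc T s, HasDerivWithinAt h (deriv h y) (Icc T s) y := by
        intro y hy
        exact (st y (by linarith [hy.1])).differentiableAt.hasDerivAt.hasDerivWithinAt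
      have := (convex_Icc T s).norm_image_sub_le_of_norm_hasDerivWithin_le hder
        (C := |Λ| + 1) (fun y hy => by have := hΛ y hy; have := le_abs_self Λ; linarith)
        (x := s) (y := t) ⟨hTs, le_rfl⟩ ⟨by linarith [ht.1], ht.2⟩
      rw [Real.norm_eq_abs, Real.norm_eq_abs, abs_sub_comm t s,
        abs_of_nonneg (by linarith [ht.2] : 0 ≤ s - t)] at this
      exact this
    have hsub : Icc (s - r0) s ×ˢ (univ : Set ℝ) ⊆ Ici (0:ℝ) ×ˢ univ :=
      prod_mono (fun t ht => by have := ht.1; exact mem_Ici.2 (by linarith)) le_rfl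
    have hposb : ∀ t, T ≤ t → t < s → ∀ x, 0 ≤ x → 0 ≤ u t x := by
      intro t h1 h2 x hx
      by_cases hxh : x < h t
      · exact ((hB t (by linarith) (hbefore t h1 h2)).1 x hx hxh).le
      · rw [H.supp t (by linarith) x (Or.inr (not_lt.1 hxh))]
    have hnn : ∀ t ∈ Icc (s - r0) s, ∀ x, h s - r0 ≤ x → 0 ≤ u t x := by
      intro t ht x hx
      have hx0 : 0 ≤ x := by linarith
      rcases ht.2.lt_or_eq with h1 | h1
      · exact hposb t (by linarith [ht.1]) h1 x hx0
      · rw [h1]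
        have hcw : ContinuousWithinAt (fun τ => u τ x) (Icc T s) s := by
          have := (H.uc.comp (f := fun τ : ℝ => (τ, x)) (s := Icc T s) (by fun_prop)
            (fun τ hτ => ⟨by have := hτ.1; exact mem_Ici.2 (by linarith), mem_univ _⟩))
          exact this s ⟨hTs, le_rfl⟩
        have hcw' : Tendsto (fun τ => u τ x) (𝓝[<] s) (𝓝 (u s x)) := by
          refine hcw.tendsto.mono_left ?_
          rw [← nhdsWithin_Ioo_eq_nhdsLT hTs']
          exact nhdsWithin_mono _ Ioo_subset_Icc_self
        refine ge_of_tendsto hcw' ?_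
        filter_upwards [Ioo_mem_nhdsLT hTs'] with τ hτ
        exact hposb τ hτ.1.le hτ.2 x hx0
    obtain ⟨R, hR, hRb⟩ := H.bdd s
    obtain ⟨K, hK, -, hKb⟩ := hf.abs_le hR
    have hfb : ∀ t ∈ Ioc (s - r0) s, ∀ x, h s - r0 < x → x < h t →
        (∃ b, PD u t x b (d * b + f t x (u t x))) ∧ |f t x (u t x)| ≤ K * u t x ∧ u t x ≤ R := by
      intro t ht x h1 h2
      have ht0 : 0 < t := by linarith [ht.1]
      have hu1 := hnn t ⟨ht.1.le, ht.2⟩ x h1.le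
      have hu2 := (abs_le.1 (hRb t ⟨ht0.le, ht.2⟩ x)).2
      have hg := (H.dom ht0.le (hu0 t (by linarith [ht.1])).ne').1
      exact ⟨H.pde t ht0 x (by linarith) h2, hKb t x _ hu1 hu2, hu2⟩
    have hL1 : (1:ℝ) ≤ |Λ| + 1 := by have := abs_nonneg Λ; linarith
    obtain ⟨m, hm⟩ := bdry_deriv (B := K * R) hd hr0p hL1 (by positivity) hlip
      (H.uc.mono hsub) hnn
      (fun t ht x hx => H.supp t (by linarith [ht.1]) x (Or.inr hx))
      (fun t ht x h1 h2 => by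
        obtain ⟨⟨b, hb⟩, h3, h4⟩ := hfb t ht x h1 h2
        exact ⟨b, _, hb, h3.trans (mul_le_mul_of_nonneg_left h4 hK.le)⟩)
    have hm0 := hopf (K := K) hd hr0p hL1 hK.le hlip (H.uc.mono hsub) hnn
      (fun t ht x h1 h2 => (hB t (by linarith [ht.1]) (hbefore t (by linarith [ht.1]) ht.2)).1 x
        (by linarith) h2)
      (H.supp s hs0.le _ (Or.inr le_rfl))
      (fun t ht x h1 h2 => by
        obtain ⟨⟨b, hb⟩, h3, h4⟩ := hfb t ht x h1 h2
        exact ⟨b, _, hb, by linarith [(abs_le.1 h3).1]⟩) hm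
    rw [(st s hs0).deriv, hm.derivWithin (uniqueDiffWithinAt_Iic _)] at hsn
    nlinarith
  exact ⟨T, hT, fun t ht => hB t (by linarith) (hall t ht)⟩

end

section
theorem SolvesPDE.refl {d : ℝ} {f : ℝ → ℝ → ℝ → ℝ} {u : ℝ → ℝ → ℝ} {s s' : Set (ℝ × ℝ)}
    (h : SolvesPDE d f u s) (hs : ∀ t x, (t, x) ∈ s' → (t, -x) ∈ s) :
    SolvesPDE d (fun t x w => f t (-x) w) (fun t x => u t (-x)) s' := by
  rintro ⟨t, x⟩ hq
  obtain ⟨h1, h2, h3⟩ := h _ (hs t x hq)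
  simp only at h1 h2 h3 ⊢
  have e1 : deriv (fun y => u t (-y)) = fun y => -deriv (u t) (-y) := by
    funext y; exact deriv_comp_neg (u t) y
  refine ⟨?_, ?_, ?_⟩
  · exact DifferentiableAt.comp x h1 (by fun_prop)
  · rw [e1]
    exact (DifferentiableAt.comp x h2 (f := fun y : ℝ => -y) (by fun_prop)).neg
  · have e2 : deriv (deriv (fun y => u t (-y))) x = deriv (deriv (u t)) (-x) := by
      rw [e1]
      have := deriv_comp_neg (deriv (u t)) x
      rw [deriv.fun_neg, this, neg_neg]
    rw [e2]; exact h3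

theorem IsFBPSolution.refl {d μ g₀ h₀ : ℝ} {f : ℝ → ℝ → ℝ → ℝ} {u₀ : ℝ → ℝ} {u : ℝ → ℝ → ℝ}
    {g h : ℝ → ℝ} (S : IsFBPSolution d μ f g₀ h₀ u₀ u g h) :
    IsFBPSolution d μ (fun t x w => f t (-x) w) (-h₀) (-g₀) (fun x => u₀ (-x))
      (fun t x => u t (-x)) (fun t => - h t) (fun t => - g t) where
  g_init := by rw [S.h_init]
  h_init := by rw [S.g_init]
  g_smooth := S.h_smooth.neg
  h_smooth := S.g_smooth.neg
  u_cont := by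
    refine S.u_cont.comp (f := fun q : ℝ × ℝ => (q.1, -q.2)) (by fun_prop) ?_
    rintro ⟨t, x⟩ ⟨h1, h2, h3⟩
    simp only at h1 h2 h3
    exact ⟨h1, by simp only; linarith, by simp only; linarith⟩
  pde := by
    refine S.pde.refl ?_
    rintro t x ⟨h1, h2, h3⟩
    simp only at h1 h2 h3
    exact ⟨h1, by simp only; linarith, by simp only; linarith⟩
  bc_left := fun t ht => by simpa using S.bc_right t ht
  bc_right := fun t ht => by simpa using S.bc_left t ht
  stefan_left := fun t ht => by
    have := (S.stefan_right t ht).neg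
    refine this.congr_deriv ?_
    have e := derivWithin_comp_neg (u t) (Ici (-h t)) (-h t)
    rw [neg_neg, neg_Ici, neg_neg] at e
    rw [e]; ring
  stefan_right := fun t ht => by
    have := (S.stefan_left t ht).neg
    refine this.congr_deriv ?_
    have e := derivWithin_comp_neg (u t) (Iic (-g t)) (-g t)
    rw [neg_neg, neg_Iic, neg_neg] at e
    rw [e]; ring
  init := fun x hx => S.init (-x) ⟨by linarith [hx.2], by linarith [hx.1]⟩
  ext := fun t ht x hx => S.ext t ht (-x) (by
    rcases hx with h1 | h1
    · right; linarith
    · left; linarith)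

theorem memH.refl {g₀ h₀ : ℝ} {φ : ℝ → ℝ} (H : memH g₀ h₀ φ) :
    memH (-h₀) (-g₀) (fun x => φ (-x)) := by
  obtain ⟨h1, h2, h3, h4⟩ := H
  refine ⟨h1.comp (f := fun x : ℝ => -x) (by fun_prop) ?_, by simpa, by simpa, fun x hx => ?_⟩
  · intro x hx; exact ⟨by linarith [hx.2], by linarith [hx.1]⟩
  · exact h4 _ ⟨by linarith [hx.2], by linarith [hx.1]⟩

theorem FLip.refl {f : ℝ → ℝ → ℝ → ℝ} (h : FLip f) : FLip (fun t x w => f t (-x) w) where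
  zero := fun t x => h.zero t (-x)
  lip := fun R hR => by
    obtain ⟨K, hK, hh⟩ := h.lip R hR
    exact ⟨K, hK, fun t x => hh t (-x)⟩

theorem PD.shift {u : ℝ → ℝ → ℝ} {t x a e b c : ℝ} (h : PD u (t + a) (x + e) b c) :
    PD (fun s y => u (s + a) (y + e)) t x b c := by
  obtain ⟨⟨φ', h1, h2⟩, h3⟩ := h
  refine ⟨⟨fun y => φ' (y + e), ?_, h2.comp_add_const x e⟩, ?_⟩
  · have : Tendsto (fun y : ℝ => y + e) (𝓝 x) (𝓝 (x + e)) := (Continuous.tendsto (by fun_prop) x)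
    filter_upwards [this.eventually h1] with y hy
    exact hy.comp_add_const y e
  · exact HasDerivAt.comp_add_const t a h3

theorem PD.refl {u : ℝ → ℝ → ℝ} {t x b c : ℝ} (h : PD u t (-x) b c) :
    PD (fun s y => u s (-y)) t x b c := by
  obtain ⟨h1, h2⟩ := h
  refine ⟨?_, h2⟩
  have := D2.comp_const_sub (φ := u t) (b := b) (x := x) 0 (by simpa using h1)
  simpa using this

/-- reaction term and periodic state -/
structure Setting (d ω L : ℝ) (f : ℝ → ℝ → ℝ → ℝ) (p : ℝ → ℝ → ℝ) : Prop where
  hd : 0 < d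
  hω : 0 < ω
  hL : 0 < L
  lip : FLip f
  ft : ∀ t x u, 0 ≤ u → f (t + ω) x u = f t x u
  fx : ∀ t x u, 0 ≤ u → f t (x + L) u = f t x u
  ppos : ∀ t x, 0 < p t x
  pt : ∀ t x, p (t + ω) x = p t x
  px : ∀ t x, p t (x + L) = p t x
  pc : Continuous (fun q : ℝ × ℝ => p q.1 q.2)
  ppde : ∀ t x, ∃ b, PD p t x b (d * b + f t x (p t x))

namespace Setting
variable {d ω L : ℝ} {f : ℝ → ℝ → ℝ → ℝ} {p : ℝ → ℝ → ℝ}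

theorem refl (S : Setting d ω L f p) :
    Setting d ω L (fun t x w => f t (-x) w) (fun t x => p t (-x)) where
  hd := S.hd
  hω := S.hω
  hL := S.hL
  lip := S.lip.refl
  ft := fun t x u hu => S.ft t (-x) u hu
  fx := fun t x u hu => by
    have := S.fx t (-(x + L)) u hu
    rw [← this]; congr 1; ring
  ppos := fun t x => S.ppos t (-x)
  pt := fun t x => S.pt t (-x)
  px := fun t x => by
    have := S.px t (-(x + L))
    rw [← this]; congr 1; ring
  pc := S.pc.comp (f := fun q : ℝ × ℝ => (q.1, -q.2)) (by fun_prop)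
  ppde := fun t x => by
    obtain ⟨b, hb⟩ := S.ppde t (-x)
    exact ⟨b, hb.refl⟩

theorem bounds (S : Setting d ω L f p) :
    ∃ m > 0, ∃ M > 0, ∀ t x, m ≤ p t x ∧ p t x ≤ M := by
  have hK : IsCompact (Icc (0:ℝ) ω ×ˢ Icc (0:ℝ) L) := isCompact_Icc.prod isCompact_Icc
  have hne : (Icc (0:ℝ) ω ×ˢ Icc (0:ℝ) L).Nonempty :=
    ⟨(0, 0), ⟨le_rfl, S.hω.le⟩, ⟨le_rfl, S.hL.le⟩⟩
  obtain ⟨q1, -, h1⟩ := hK.exists_isMinOn hne S.pc.continuousOn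
  obtain ⟨q2, -, h2⟩ := hK.exists_isMaxOn hne S.pc.continuousOn
  refine ⟨_, S.ppos q1.1 q1.2, _, S.ppos q2.1 q2.2, fun t x => ?_⟩
  obtain ⟨t', ht', x', hx', e⟩ := per_reduce S.hω S.hL S.pt S.px t x
  rw [e]
  exact ⟨h1 (show (t', x') ∈ _ from ⟨ht', hx'⟩), h2 (show (t', x') ∈ _ from ⟨ht', hx'⟩)⟩

theorem ftn (S : Setting d ω L f p) (n : ℕ) : ∀ t x u, 0 ≤ u → f (t + n * ω) x u = f t x u := by
  induction n with
  | zero => intro t x u _; simp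
  | succ n ih =>
    intro t x u hu
    have : t + ((n + 1 : ℕ) : ℝ) * ω = (t + n * ω) + ω := by push_cast; ring
    rw [this, S.ft _ _ _ hu, ih t x u hu]

theorem fxn (S : Setting d ω L f p) (n : ℕ) : ∀ t x u, 0 ≤ u → f t (x + n * L) u = f t x u := by
  induction n with
  | zero => intro t x u _; simp
  | succ n ih =>
    intro t x u hu
    have : x + ((n + 1 : ℕ) : ℝ) * L = (x + n * L) + L := by push_cast; ring
    rw [this, S.fx _ _ _ hu, ih t x u hu]

theorem ptn (S : Setting d ω L f p) (n : ℕ) : ∀ t x, p (t + n * ω) x = p t x := by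
  induction n with
  | zero => intro t x; simp
  | succ n ih =>
    intro t x
    have : t + ((n + 1 : ℕ) : ℝ) * ω = (t + n * ω) + ω := by push_cast; ring
    rw [this, S.pt, ih t x]

theorem pxn (S : Setting d ω L f p) (n : ℕ) : ∀ t x, p t (x + n * L) = p t x := by
  induction n with
  | zero => intro t x; simp
  | succ n ih =>
    intro t x
    have : x + ((n + 1 : ℕ) : ℝ) * L = (x + n * L) + L := by push_cast; ring
    rw [this, S.px, ih t x]

end Setting

theorem p_continuous {ω : ℝ} (hω : 0 < ω) {p u : ℝ → ℝ → ℝ} (hpt : ∀ t x, p (t + ω) x = p t x)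
    (uc : ContinuousOn (fun q : ℝ × ℝ => u q.1 q.2) (Ici 0 ×ˢ univ))
    (hconv : ∀ A > (0:ℝ), ∀ ε > 0, ∃ T, ∀ t ≥ T, ∀ x ∈ Set.Icc (-A) A, |u t x - p t x| ≤ ε) :
    Continuous (fun q : ℝ × ℝ => p q.1 q.2) := by
  have ptn : ∀ (n : ℕ) t x, p (t + n * ω) x = p t x := by
    intro n
    induction n with
    | zero => intro t x; simp
    | succ n ih =>
      intro t x
      have : t + ((n + 1 : ℕ) : ℝ) * ω = (t + n * ω) + ω := by push_cast; ring
      rw [this, hpt, ih t x]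
  rw [continuous_iff_continuousAt]
  rintro ⟨t0, x0⟩
  apply continuousAt_of_locally_uniform_approx_of_continuousAt
  intro U hU
  obtain ⟨ε, hε, hεU⟩ := Metric.mem_uniformity_dist.1 hU
  obtain ⟨T, hT⟩ := hconv (|x0| + 1) (by positivity) (ε / 2) (by positivity)
  obtain ⟨n, hn⟩ := exists_nat_gt ((max T 1 - t0 + 1) / ω)
  rw [div_lt_iff₀ hω] at hn
  refine ⟨Ioi (t0 - 1) ×ˢ Ioo (x0 - 1) (x0 + 1), ?_, fun q => u (q.1 + n * ω) q.2, ?_, ?_⟩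
  · exact prod_mem_nhds (Ioi_mem_nhds (by linarith)) (Ioo_mem_nhds (by linarith) (by linarith))
  · have h1 : ContinuousAt (fun q : ℝ × ℝ => u q.1 q.2) (t0 + n * ω, x0) := by
      refine uc.continuousAt (prod_mem_nhds (Ici_mem_nhds ?_) univ_mem)
      have := le_max_right T 1
      linarith
    exact ContinuousAt.comp (f := fun q : ℝ × ℝ => (q.1 + n * ω, q.2)) (x := (t0, x0)) h1
      (by fun_prop)
  · rintro ⟨t, x⟩ ⟨h1, h2⟩
    apply hεU
    simp only [mem_Ioi] at h1
    have h3 := le_max_left T 1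
    have := hT (t + n * ω) (by linarith) x ⟨by linarith [neg_abs_le x0, h2.1],
      by linarith [le_abs_self x0, h2.2]⟩
    rw [ptn] at this
    rw [dist_comm, Real.dist_eq]
    simp only
    linarith

end

section
/-- Positive nice solution of the free boundary problem on `[0,∞)`. -/
structure PFBP (d μ : ℝ) (f : ℝ → ℝ → ℝ → ℝ) (p u : ℝ → ℝ → ℝ) (g h : ℝ → ℝ) : Prop where
  gc : ContinuousOn g (Ici 0)
  hc : ContinuousOn h (Ici 0)
  uc : ContinuousOn (fun q : ℝ × ℝ => u q.1 q.2) (Ici 0 ×ˢ univ)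
  supp : ∀ t ≥ 0, ∀ x, (x ≤ g t ∨ h t ≤ x) → u t x = 0
  pos : ∀ t ≥ 0, ∀ x, g t < x → x < h t → 0 < u t x
  lt : ∀ t ≥ 0, g t < h t
  pde : ∀ t > 0, ∀ x, g t < x → x < h t → ∃ b, PD u t x b (d * b + f t x (u t x))
  sr : ∀ t > 0, ∃ m > 0, HasDerivWithinAt (u t) (-m) (Iic (h t)) (h t) ∧ HasDerivAt h (μ * m) t
  sl : ∀ t > 0, ∃ m > 0, HasDerivWithinAt (u t) m (Ici (g t)) (g t) ∧ HasDerivAt g (-(μ * m)) t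
  ltp : ∀ t ≥ 0, ∀ x, u t x < p t x

namespace PFBP
variable {d μ ω L : ℝ} {f : ℝ → ℝ → ℝ → ℝ} {p u : ℝ → ℝ → ℝ} {g h : ℝ → ℝ}

theorem nonneg (H : PFBP d μ f p u g h) {t : ℝ} (ht : 0 ≤ t) (x : ℝ) : 0 ≤ u t x := by
  by_cases h1 : x ≤ g t ∨ h t ≤ x
  · rw [H.supp t ht x h1]
  · push Not at h1
    exact (H.pos t ht x h1.1 h1.2).le

theorem dom (H : PFBP d μ f p u g h) {t x : ℝ} (ht : 0 ≤ t) (hu : 0 < u t x) :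
    g t < x ∧ x < h t := by
  constructor
  · by_contra hc; rw [H.supp t ht x (Or.inl (not_lt.1 hc))] at hu; exact lt_irrefl _ hu
  · by_contra hc; rw [H.supp t ht x (Or.inr (not_lt.1 hc))] at hu; exact lt_irrefl _ hu

theorem shift (H : PFBP d μ f p u g h) (S : Setting d ω L f p) (n k : ℕ) :
    PFBP d μ f p (fun t x => u (t + n * ω) (x + k * L)) (fun t => g (t + n * ω) - k * L)
      (fun t => h (t + n * ω) - k * L) := by
  have hn : 0 ≤ n * ω := mul_nonneg (Nat.cast_nonneg n) S.hω.le
  have hmaps : MapsTo (fun t : ℝ => t + n * ω) (Ici 0) (Ici 0) := fun t ht => by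
    simp only [mem_Ici] at *; linarith
  refine ⟨?_, ?_, ?_, ?_, ?_, ?_, ?_, ?_, ?_, ?_⟩
  · exact (H.gc.comp (by fun_prop) hmaps).sub continuousOn_const
  · exact (H.hc.comp (by fun_prop) hmaps).sub continuousOn_const
  · exact H.uc.comp (f := fun q : ℝ × ℝ => (q.1 + n * ω, q.2 + k * L)) (by fun_prop)
      (fun q hq => ⟨hmaps hq.1, mem_univ _⟩)
  · intro t ht x hx
    refine H.supp _ (by linarith) _ ?_
    rcases hx with h1 | h1
    · left; linarith
    · right; linarith
  · intro t ht x h1 h2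
    exact H.pos _ (by linarith) _ (by linarith) (by linarith)
  · intro t ht
    have := H.lt (t + n * ω) (by linarith)
    linarith
  · intro t ht x h1 h2
    obtain ⟨b, hb⟩ := H.pde (t + n * ω) (by linarith) (x + k * L) (by linarith) (by linarith)
    refine ⟨b, ?_⟩
    rw [S.ftn n _ _ _ (H.nonneg (by linarith) _), S.fxn k _ _ _ (H.nonneg (by linarith) _)] at hb
    exact hb.shift
  · intro t ht
    obtain ⟨m, hm, h1, h2⟩ := H.sr (t + n * ω) (by linarith)
    refine ⟨m, hm, ?_, (h2.comp_add_const t (n * ω)).sub_const _⟩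
    have h1' : HasDerivWithinAt (u (t + n * ω)) (-m) (Iic (h (t + n * ω)))
        ((h (t + n * ω) - k * L) + k * L) := by rw [sub_add_cancel]; exact h1
    have := HasDerivWithinAt.comp (h (t + n * ω) - k * L) (h := fun y => y + k * L)
      (s := Iic (h (t + n * ω) - k * L)) h1'
      ((hasDerivAt_id (h (t + n * ω) - k * L)).add_const (k * L)).hasDerivWithinAt
      (fun y hy => by simp only [mem_Iic] at *; linarith)
    exact this.congr_deriv (by ring)
  · intro t ht
    obtain ⟨m, hm, h1, h2⟩ := H.sl (t + n * ω) (by linarith)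
    refine ⟨m, hm, ?_, (h2.comp_add_const t (n * ω)).sub_const _⟩
    have h1' : HasDerivWithinAt (u (t + n * ω)) m (Ici (g (t + n * ω)))
        ((g (t + n * ω) - k * L) + k * L) := by rw [sub_add_cancel]; exact h1
    have := HasDerivWithinAt.comp (g (t + n * ω) - k * L) (h := fun y => y + k * L)
      (s := Ici (g (t + n * ω) - k * L)) h1'
      ((hasDerivAt_id (g (t + n * ω) - k * L)).add_const (k * L)).hasDerivWithinAt
      (fun y hy => by simp only [mem_Ici] at *; linarith)
    exact this.congr_deriv (by ring)
  · intro t ht x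
    have := H.ltp (t + n * ω) (by linarith) (x + k * L)
    rwa [S.ptn, S.pxn] at this

/-- comparison between a solution and a supersolution which is a solution where needed -/
theorem _root_.Setting.raw_le (S : Setting d ω L f p) (H : Raw d f u g h)
    (h0 : ∀ x, u 0 x ≤ p 0 x) : ∀ t ≥ 0, ∀ x, u t x ≤ p t x := by
  intro T hT x
  obtain ⟨m, hm, M, hM, hb⟩ := S.bounds
  obtain ⟨R, hR, hRb⟩ := H.bdd T
  obtain ⟨K, hK, hKl⟩ := S.lip.lip (R + M) (by positivity)
  have := max_principle_strip (d := d) (K := K) (T := T) (C := R) (z := fun t x => u t x - p t x) S.hd.le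
    ((H.uc.mono (prod_mono Icc_subset_Ici_self le_rfl)).sub S.pc.continuousOn)
    (fun t ht x => by have := (abs_le.1 (hRb t ht x)).2; have := S.ppos t x; linarith)
    (fun x => by have := h0 x; linarith)
    (fun t ht x hz => by
      have hp := S.ppos t x
      obtain ⟨hg, hh⟩ := H.dom ht.1.le (x := x) (by linarith : 0 < u t x).ne'
      obtain ⟨b, hb1⟩ := H.pde t ht.1 x hg hh
      obtain ⟨b', hb2⟩ := S.ppde t x
      refine ⟨_, _, hb1.sub hb2, ?_⟩
      have h1 := (abs_le.1 (hRb t ⟨ht.1.le, ht.2⟩ x)).2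
      have h2 := (hb t x).2
      have := hKl t x (u t x) (p t x) (by linarith) (by linarith) hp.le (by linarith)
      rw [abs_of_pos hz] at this
      have := (abs_le.1 this).2
      linarith) T ⟨hT, le_rfl⟩ x
  linarith

theorem _root_.Setting.raw_lt (S : Setting d ω L f p) (H : Raw d f u g h)
    (h0 : ∀ x, u 0 x ≤ p 0 x) : ∀ t ≥ 0, 0 < t → ∀ x, u t x < p t x := by
  intro T hT hT0 x0
  have hle := S.raw_le H h0
  obtain ⟨m, hm, M, hM, hb⟩ := S.bounds
  obtain ⟨X, hX, hXb⟩ := H.bounds T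
  obtain ⟨K, hK, hKl⟩ := S.lip.lip M hM
  obtain ⟨σ, hσ⟩ : ∃ σ, σ = (|x0 - (X + 2)|) / T := ⟨_, rfl⟩
  have hσ0 : 0 ≤ σ := by rw [hσ]; positivity
  have hσT : σ * T = |x0 - (X + 2)| := by rw [hσ]; field_simp
  obtain ⟨c, hc, hbump⟩ := bump_below (d := d) (K := K) (ℓ0 := 1) (σ := σ) (T := T) (m := m) (θ := m)
    S.hd hK.le one_pos hσ0 hT hm hm
  have := hbump (fun t x => p t x - u t x) 0 (X + 2) T hT le_rfl
    ((S.pc.continuousOn.sub H.uc).mono (fun q hq => ⟨hq.1, mem_univ _⟩))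
    (fun x hx => by
      have hx' := abs_le.1 hx
      have : u 0 x = 0 := by
        by_contra hne
        have := hXb 0 ⟨le_rfl, hT⟩ x hne
        have := le_abs_self x
        linarith
      simp only [this]
      linarith [(hb 0 x).1])
    (fun t x h1 h2 h3 => by have := hle t h1 x; linarith)
    (fun t x h1 h2 h3 h4 => by
      have hup : 0 < u t x := by linarith [(hb t x).1]
      obtain ⟨hg, hh⟩ := H.dom h1.le (x := x) hup.ne'
      obtain ⟨b, hb1⟩ := H.pde t h1 x hg hh
      obtain ⟨b', hb2⟩ := S.ppde t x
      refine ⟨_, _, hb2.sub hb1, ?_⟩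
      have h6 := (hb t x).2
      have h7 := hle t h1.le x
      have := hKl t x (p t x) (u t x) (by linarith) (by linarith) hup.le (by linarith)
      rw [abs_of_nonneg (by linarith : 0 ≤ p t x - u t x)] at this
      have := (abs_le.1 this).1
      linarith) T x0 hT (by linarith) (by rw [sub_zero, hσT]; linarith)
  rw [sub_zero, hσT] at this
  have h9 : 0 < c * ((1 + |x0 - (X + 2)|) ^ 2 - (x0 - (X + 2)) ^ 2) := by
    apply mul_pos hc
    have := abs_nonneg (x0 - (X + 2))
    have e := sq_abs (x0 - (X + 2))
    nlinarith
  linarith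

end PFBP

theorem IsFBPSolution.pfbp {d μ ω L g₀ h₀ : ℝ} {f : ℝ → ℝ → ℝ → ℝ} {p : ℝ → ℝ → ℝ} {u₀ : ℝ → ℝ}
    {u : ℝ → ℝ → ℝ} {g h : ℝ → ℝ} (sol : IsFBPSolution d μ f g₀ h₀ u₀ u g h)
    (S : Setting d ω L f p) (hμ : 0 < μ) (hgh : g₀ < h₀) (hm : memH g₀ h₀ u₀)
    (h0 : ∀ x ∈ Set.Icc g₀ h₀, u₀ x ≤ p 0 x) (hinf : Tendsto h atTop atTop)
    (ginf : Tendsto g atTop atBot)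
    (hconv : ∀ A > (0:ℝ), ∀ ε > 0, ∃ T, ∀ t ≥ T, ∀ x ∈ Set.Icc (-A) A, |u t x - p t x| ≤ ε) :
    ∃ n : ℕ, PFBP d μ f p (fun t x => u (t + n * ω) x) (fun t => g (t + n * ω))
      (fun t => h (t + n * ω)) := by
  have H := sol.raw hgh hm
  have solr := sol.refl
  have Hr := solr.raw (by linarith) hm.refl
  obtain ⟨m, hm0, M, hM, hb⟩ := S.bounds
  obtain ⟨T0, hT0⟩ := hconv 1 one_pos (m / 2) (by positivity)
  have hu0 : ∀ t ≥ max T0 1, 0 < u t 0 := by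
    intro t ht
    have := hT0 t ((le_max_left _ _).trans ht) 0 (by norm_num)
    have := (abs_le.1 this).1
    linarith [(hb t 0).1]
  have hmx : 0 < max T0 1 := lt_of_lt_of_le one_pos (le_max_right _ _)
  obtain ⟨T1, hT1, hr⟩ := H.right_pos S.lip S.hd hμ sol.h_smooth sol.stefan_right hinf hmx hu0
  obtain ⟨T2, hT2, hl⟩ := Hr.right_pos S.lip.refl S.hd hμ solr.h_smooth solr.stefan_right
    (tendsto_neg_atBot_atTop.comp ginf) hmx (fun t ht => by simpa using hu0 t ht)
  obtain ⟨n, hn⟩ := exists_nat_gt ((T1 + T2 + max T0 1) / ω)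
  rw [div_lt_iff₀ S.hω] at hn
  have hn0 : 0 < n * ω := by linarith
  have hmaps : MapsTo (fun t : ℝ => t + n * ω) (Ici 0) (Ici 0) := fun t ht => by
    simp only [mem_Ici] at *; linarith
  have hu0' : ∀ x, u 0 x ≤ p 0 x := by
    intro x
    by_cases hx : x ∈ Icc g₀ h₀
    · rw [sol.init x hx]; exact h0 x hx
    · have : x ≤ g 0 ∨ h 0 ≤ x := by
        rw [sol.g_init, sol.h_init]
        by_contra hc
        push Not at hc
        exact hx ⟨hc.1.le, hc.2.le⟩
      rw [H.supp 0 le_rfl x this]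
      exact (S.ppos 0 x).le
  refine ⟨n, ?_, ?_, ?_, ?_, ?_, ?_, ?_, ?_, ?_, ?_⟩
  · exact (H.gc.comp (by fun_prop) hmaps)
  · exact (H.hc.comp (by fun_prop) hmaps)
  · exact H.uc.comp (f := fun q : ℝ × ℝ => (q.1 + n * ω, q.2)) (by fun_prop)
      (fun q hq => ⟨hmaps hq.1, mem_univ _⟩)
  · intro t ht x hx
    exact H.supp _ (by linarith) _ hx
  · intro t ht x h1 h2
    rcases le_total 0 x with hx | hx
    · exact (hr (t + n * ω) (by linarith)).1 x hx h2
    · have := (hl (t + n * ω) (by linarith)).1 (-x) (by linarith) (by linarith)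
      simpa using this
  · intro t ht
    have := H.dom (t := t + n * ω) (x := 0) (by linarith) (hu0 _ (by linarith)).ne'
    linarith
  · intro t ht x h1 h2
    obtain ⟨b, hb⟩ := H.pde (t + n * ω) (by linarith) x (by linarith) (by linarith)
    refine ⟨b, ?_⟩
    have hnn : 0 ≤ u (t + n * ω) x := by
      rcases le_total 0 x with hx | hx
      · exact ((hr (t + n * ω) (by linarith)).1 x hx h2).le
      · have := (hl (t + n * ω) (by linarith)).1 (-x) (by linarith) (by linarith)
        simpa using this.le
    rw [S.ftn n _ _ _ hnn] at hb
    have := PD.shift (u := u) (t := t) (x := x) (a := n * ω) (e := 0) (by simpa using hb)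
    simpa using this
  · intro t ht
    obtain ⟨m, hm, h1, h2⟩ := (hr (t + n * ω) (by linarith)).2
    exact ⟨m, hm, h1, h2.comp_add_const t (n * ω)⟩
  · intro t ht
    obtain ⟨m, hm, h1, h2⟩ := (hl (t + n * ω) (by linarith)).2
    refine ⟨m, hm, ?_, ?_⟩
    · have h1' : HasDerivWithinAt (fun x => u (t + n * ω) (-x)) (-m) (Iic (-g (t + n * ω)))
        ((fun y : ℝ => -y) (g (t + n * ω))) := h1
      have := HasDerivWithinAt.comp (g (t + n * ω)) (h := fun y => -y)
        (s := Ici (g (t + n * ω))) h1'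
        ((hasDerivAt_id (g (t + n * ω))).neg).hasDerivWithinAt
        (fun y hy => by simp only [mem_Ici, mem_Iic] at *; linarith)
      have e : ((fun x => u (t + n * ω) (-x)) ∘ fun y => -y) = u (t + n * ω) := by
        funext y; simp
      rw [e] at this
      exact this.congr_deriv (by ring)
    · have := (HasDerivAt.comp_add_const t (n * ω) h2).neg
      exact this.congr_of_eventuallyEq (Eventually.of_forall fun s => by simp)
  · intro t ht x
    have := S.raw_lt H hu0' (t + n * ω) (by linarith) (by linarith) x
    rwa [S.ptn] at this

end

section
theorem first_touch {ψ1 ψ2 : ℝ → ℝ} {T : ℝ} (c1 : ContinuousOn ψ1 (Icc 0 T))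
    (c2 : ContinuousOn ψ2 (Icc 0 T)) (h1 : 0 < ψ1 0) (h2 : 0 < ψ2 0)
    (H : ∀ t1 ∈ Ioc 0 T, (∀ s ∈ Ico 0 t1, 0 < ψ1 s ∧ 0 < ψ2 s) → 0 < ψ1 t1 ∧ 0 < ψ2 t1) :
    ∀ t ∈ Icc 0 T, 0 < ψ1 t ∧ 0 < ψ2 t := by
  intro t ht
  by_contra hbad
  have hne : ({t ∈ Icc 0 T | ψ1 t ≤ 0} ∪ {t ∈ Icc 0 T | ψ2 t ≤ 0}).Nonempty := by
    rw [not_and_or] at hbad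
    rcases hbad with hb | hb
    · exact ⟨t, Or.inl ⟨ht, not_lt.1 hb⟩⟩
    · exact ⟨t, Or.inr ⟨ht, not_lt.1 hb⟩⟩
  have hcl : IsClosed ({t ∈ Icc 0 T | ψ1 t ≤ 0} ∪ {t ∈ Icc 0 T | ψ2 t ≤ 0}) :=
    (isClosed_Icc.isClosed_le c1 continuousOn_const).union
      (isClosed_Icc.isClosed_le c2 continuousOn_const)
  have hbd : BddBelow ({t ∈ Icc 0 T | ψ1 t ≤ 0} ∪ {t ∈ Icc 0 T | ψ2 t ≤ 0}) := by
    refine ⟨0, ?_⟩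
    rintro s (hs | hs)
    · exact hs.1.1
    · exact hs.1.1
  have hmem := hcl.csInf_mem hne hbd
  obtain ⟨s, hs'⟩ : ∃ s, s = sInf ({t ∈ Icc 0 T | ψ1 t ≤ 0} ∪ {t ∈ Icc 0 T | ψ2 t ≤ 0}) := ⟨_, rfl⟩
  rw [← hs'] at hmem
  have hsI : s ∈ Icc 0 T := by
    rcases hmem with h | h
    · exact h.1
    · exact h.1
  have hs0 : 0 < s := by
    rcases hsI.1.lt_or_eq with h | h
    · exact h
    · rw [← h] at hmem
      rcases hmem with h | h
      · linarith [h.2]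
      · linarith [h.2]
  have := H s ⟨hs0, hsI.2⟩ (fun r hr => by
    by_contra hc
    have hrI : r ∈ Icc 0 T := ⟨hr.1, hr.2.le.trans hsI.2⟩
    have hrm : r ∈ ({t ∈ Icc 0 T | ψ1 t ≤ 0} ∪ {t ∈ Icc 0 T | ψ2 t ≤ 0}) := by
      rw [not_and_or] at hc
      rcases hc with hb | hb
      · exact Or.inl ⟨hrI, not_lt.1 hb⟩
      · exact Or.inr ⟨hrI, not_lt.1 hb⟩
    have := csInf_le hbd hrm
    rw [← hs'] at this
    linarith [hr.2])
  rcases hmem with h | h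
  · linarith [h.2, this.1]
  · linarith [h.2, this.2]

theorem slope_le_right {φ ψ : ℝ → ℝ} {m n x : ℝ} (hφ : HasDerivWithinAt φ m (Ici x) x)
    (hψ : HasDerivWithinAt ψ n (Ici x) x) (he : φ x = ψ x)
    (hle : ∀ᶠ y in 𝓝[>] x, φ y ≤ ψ y) : m ≤ n := by
  have h1 := hψ.sub hφ
  rw [hasDerivWithinAt_iff_tendsto_slope] at h1
  have hset : Ici x \ {x} = Ioi x := by
    ext y; simp [lt_iff_le_and_ne]
  rw [hset] at h1
  have : 0 ≤ n - m := by
    refine ge_of_tendsto h1 ?_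
    filter_upwards [hle, self_mem_nhdsWithin] with y hy hyx
    simp only [mem_Ioi] at hyx
    simp only [slope_def_field, Pi.sub_apply, he]
    apply div_nonneg <;> linarith
  linarith

/-- continuity from the left: nonnegativity passes to the limit -/
theorem nonneg_left_limit {ψ : ℝ → ℝ} {T : ℝ} (hT : 0 < T) (c : ContinuousOn ψ (Icc 0 T))
    (h : ∀ s ∈ Ico 0 T, 0 < ψ s) : 0 ≤ ψ T := by
  have hcw := (c T ⟨hT.le, le_rfl⟩).tendsto
  have hcw' : Tendsto ψ (𝓝[<] T) (𝓝 (ψ T)) := by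
    refine hcw.mono_left ?_
    rw [← nhdsWithin_Ioo_eq_nhdsLT hT]
    exact nhdsWithin_mono _ Ioo_subset_Icc_self
  refine ge_of_tendsto hcw' ?_
  filter_upwards [Ioo_mem_nhdsLT hT] with τ hτ
  exact (h τ ⟨hτ.1.le, hτ.2⟩).le

/-- if a function is positive before and zero at `T` then its derivative is nonpositive -/
theorem deriv_nonpos_of_touch {ψ : ℝ → ℝ} {T c : ℝ} (hT : 0 < T)
    (h : ∀ s ∈ Ico 0 T, 0 < ψ s) (h0 : ψ T = 0) (hd : HasDerivAt ψ c T) : c ≤ 0 := by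
  have h1 : HasDerivWithinAt ψ (-(-c)) (Iic T) T := by rw [neg_neg]; exact hd.hasDerivWithinAt
  have h2 : HasDerivWithinAt (fun _ : ℝ => (0:ℝ)) (-0) (Iic T) T := by
    rw [neg_zero]; exact hasDerivWithinAt_const _ _ _
  have := slope_le h2 h1 h0.symm (by
    filter_upwards [Ioo_mem_nhdsLT hT] with τ hτ
    exact (h τ ⟨hτ.1.le, hτ.2⟩).le)
  linarith

namespace PFBP
variable {d μ ω L : ℝ} {f : ℝ → ℝ → ℝ → ℝ} {p u : ℝ → ℝ → ℝ} {g h : ℝ → ℝ}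

theorem compare_aux {μ1 μ2 T : ℝ} {u1 u2 : ℝ → ℝ → ℝ} {g1 h1 g2 h2 : ℝ → ℝ} (S : Setting d ω L f p)
    (H1 : PFBP d μ1 f p u1 g1 h1) (H2 : PFBP d μ2 f p u2 g2 h2) (h0 : ∀ x, u1 0 x ≤ u2 0 x)
    (hh : ∀ t ∈ Icc 0 T, h1 t ≤ h2 t) (hg : ∀ t ∈ Icc 0 T, g2 t ≤ g1 t) :
    ∀ t ∈ Icc 0 T, ∀ x, u1 t x ≤ u2 t x := by
  obtain ⟨m, hm, M, hM, hb⟩ := S.bounds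
  obtain ⟨K, hK, hKl⟩ := S.lip.lip M hM
  have := max_principle_strip (d := d) (K := K) (T := T) (C := M) (z := fun t x => u1 t x - u2 t x) S.hd.le
    ((H1.uc.mono (prod_mono Icc_subset_Ici_self le_rfl)).sub
      (H2.uc.mono (prod_mono Icc_subset_Ici_self le_rfl)))
    (fun t ht x => by
      have := H1.ltp t ht.1 x
      have := H2.nonneg ht.1 x
      linarith [(hb t x).2])
    (fun x => by have := h0 x; linarith)
    (fun t ht x hz => by
      have hu2 := H2.nonneg ht.1.le x
      obtain ⟨e1, e2⟩ := H1.dom ht.1.le (x := x) (by linarith : 0 < u1 t x)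
      have ht' : t ∈ Icc 0 T := ⟨ht.1.le, ht.2⟩
      obtain ⟨b, hb1⟩ := H1.pde t ht.1 x e1 e2
      obtain ⟨b', hb2⟩ := H2.pde t ht.1 x (by linarith [hg t ht']) (by linarith [hh t ht'])
      refine ⟨_, _, hb1.sub hb2, ?_⟩
      have := H1.ltp t ht.1.le x
      have := H2.ltp t ht.1.le x
      have h2 := (hb t x).2
      have := hKl t x (u1 t x) (u2 t x) (by linarith) (by linarith) hu2 (by linarith)
      rw [abs_of_pos hz] at this
      have := (abs_le.1 this).2
      linarith)
  intro t ht x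
  linarith [this t ht x]

theorem compare {μ1 μ2 : ℝ} {u1 u2 : ℝ → ℝ → ℝ} {g1 h1 g2 h2 : ℝ → ℝ} (S : Setting d ω L f p)
    (H1 : PFBP d μ1 f p u1 g1 h1) (H2 : PFBP d μ2 f p u2 g2 h2) (hμ : 0 < μ1) (hμ12 : μ1 < μ2)
    (h0 : ∀ x, u1 0 x ≤ u2 0 x) (hh0 : h1 0 < h2 0) (hg0 : g2 0 < g1 0) :
    ∀ t ≥ 0, h1 t < h2 t := by
  intro T hT
  have hsub : Icc 0 T ⊆ Ici 0 := Icc_subset_Ici_self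
  have ch : ContinuousOn (fun t => h2 t - h1 t) (Ici 0) := H2.hc.sub H1.hc
  have cg : ContinuousOn (fun t => g1 t - g2 t) (Ici 0) := H1.gc.sub H2.gc
  have := first_touch (T := T) (ch.mono hsub) (cg.mono hsub) (by simpa using hh0)
    (by simpa using hg0) (fun t1 ht1 hb => by
      have hh1 : 0 ≤ h2 t1 - h1 t1 := nonneg_left_limit (ψ := fun t => h2 t - h1 t) ht1.1 (ch.mono Icc_subset_Ici_self)
        (fun s hs => (hb s hs).1)
      have hg1 : 0 ≤ g1 t1 - g2 t1 := nonneg_left_limit (ψ := fun t => g1 t - g2 t) ht1.1 (cg.mono Icc_subset_Ici_self)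
        (fun s hs => (hb s hs).2)
      have hle := compare_aux (T := t1) S H1 H2 h0
        (fun t ht => by
          rcases ht.2.lt_or_eq with e | e
          · linarith [(hb t ⟨ht.1, e⟩).1]
          · rw [e]; linarith)
        (fun t ht => by
          rcases ht.2.lt_or_eq with e | e
          · linarith [(hb t ⟨ht.1, e⟩).2]
          · rw [e]; linarith) t1 ⟨ht1.1.le, le_rfl⟩
      constructor
      · rcases hh1.lt_or_eq with e | e
        · exact e
        exfalso
        obtain ⟨m1, hm1, a1, b1⟩ := H1.sr t1 ht1.1
        obtain ⟨m2, hm2, a2, b2⟩ := H2.sr t1 ht1.1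
        have e' : h2 t1 = h1 t1 := by linarith
        rw [e'] at a2
        have hm12 := slope_le a1 a2 (by
          rw [H1.supp t1 ht1.1.le _ (Or.inr le_rfl), H2.supp t1 ht1.1.le _ (Or.inr e'.le)])
          (Eventually.of_forall fun y => hle y)
        have := deriv_nonpos_of_touch ht1.1 (fun s hs => (hb s hs).1) e.symm (b2.sub b1)
        nlinarith
      · rcases hg1.lt_or_eq with e | e
        · exact e
        exfalso
        obtain ⟨m1, hm1, a1, b1⟩ := H1.sl t1 ht1.1
        obtain ⟨m2, hm2, a2, b2⟩ := H2.sl t1 ht1.1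
        have e' : g2 t1 = g1 t1 := by linarith
        rw [e'] at a2
        have hm12 := slope_le_right a1 a2 (by
          rw [H1.supp t1 ht1.1.le _ (Or.inl le_rfl), H2.supp t1 ht1.1.le _ (Or.inl e'.ge)])
          (Eventually.of_forall fun y => hle y)
        have := deriv_nonpos_of_touch ht1.1 (fun s hs => (hb s hs).2) e.symm (b1.sub b2)
        nlinarith)
  have := (this T ⟨hT, le_rfl⟩).1
  linarith

end PFBP

end

section
/-- locally uniform convergence to `p` -/
def LocConv (p w : ℝ → ℝ → ℝ) : Prop :=
  ∀ A > (0:ℝ), ∀ ε > 0, ∃ T, ∀ t ≥ T, ∀ x ∈ Icc (-A) A, |w t x - p t x| ≤ ε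

/-- convergence to `p` on `0 ≤ x ≤ c t`, `c < c0` -/
def InnerConv (p w : ℝ → ℝ → ℝ) (c0 : ℝ) : Prop :=
  ∀ c, 0 < c → c < c0 → ∀ ε > 0, ∃ T, ∀ t ≥ T, ∀ x ∈ Icc 0 (c * t), |w t x - p t x| ≤ ε

/-- nonnegative bounded classical solution of the Cauchy problem with uniform tails. -/
structure Cau (d : ℝ) (f : ℝ → ℝ → ℝ → ℝ) (φ : ℝ → ℝ) (v : ℝ → ℝ → ℝ) : Prop where
  vc : ContinuousOn (fun q : ℝ × ℝ => v q.1 q.2) (Ici 0 ×ˢ univ)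
  init : ∀ x, v 0 x = φ x
  nn : ∀ t ≥ 0, ∀ x, 0 ≤ v t x
  ub : ∃ M > 0, ∀ t ≥ 0, ∀ x, v t x ≤ M
  pde : ∀ t > 0, ∀ x, ∃ b, PD v t x b (d * b + f t x (v t x))
  tail : ∀ T, ∀ ε > 0, ∃ X > 0, ∀ t ∈ Icc 0 T, ∀ x, X ≤ |x| → v t x ≤ ε

/-- a positive solution of the free boundary problem spreading with speed `c` to the right -/
structure Good (d μ : ℝ) (f : ℝ → ℝ → ℝ → ℝ) (p u : ℝ → ℝ → ℝ) (g h : ℝ → ℝ) (c : ℝ) : Prop where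
  sol : PFBP d μ f p u g h
  loc : LocConv p u
  inner : InnerConv p u c
  hinf : Tendsto h atTop atTop
  ginf : Tendsto g atTop atBot
  speed : Tendsto (fun t => h t / t) atTop (𝓝 c)

variable {d μ ω L : ℝ} {f : ℝ → ℝ → ℝ → ℝ} {p u : ℝ → ℝ → ℝ} {g h : ℝ → ℝ}

theorem PFBP.eventually_above (S : Setting d ω L f p) (H : PFBP d μ f p u g h) {w : ℝ → ℝ → ℝ}
    (hw : LocConv p w) (hwn : ∀ t ≥ 0, ∀ x, 0 ≤ w t x) :
    ∃ N : ℝ, ∀ n : ℕ, N ≤ n → ∀ x, u 0 x ≤ w (n * ω) x := by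
  have hc : ContinuousOn (fun x => p 0 x - u 0 x) (Icc (g 0) (h 0)) := by
    refine ContinuousOn.sub ?_ ?_
    · exact (S.pc.comp (f := fun x : ℝ => ((0:ℝ), x)) (by fun_prop)).continuousOn
    · exact H.uc.comp (f := fun x : ℝ => ((0:ℝ), x)) (by fun_prop)
        (fun x _ => ⟨mem_Ici.2 le_rfl, mem_univ _⟩)
  obtain ⟨x0, -, hx0⟩ := isCompact_Icc.exists_isMinOn (nonempty_Icc.2 (H.lt 0 le_rfl).le) hc
  obtain ⟨δ, hδ⟩ : ∃ δ, δ = p 0 x0 - u 0 x0 := ⟨_, rfl⟩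
  have hδ0 : 0 < δ := by have := H.ltp 0 le_rfl x0; linarith
  obtain ⟨T, hT⟩ := hw (|g 0| + |h 0| + 1) (by positivity) δ hδ0
  refine ⟨T / ω, fun n hn x => ?_⟩
  rw [div_le_iff₀ S.hω] at hn
  have hnω : 0 ≤ n * ω := mul_nonneg (Nat.cast_nonneg n) S.hω.le
  by_cases hx : x ∈ Icc (g 0) (h 0)
  · have h1 := hT (n * ω) hn x ⟨by
      linarith [neg_abs_le (g 0), hx.1, abs_nonneg (h 0)], by
      linarith [le_abs_self (h 0), hx.2, abs_nonneg (g 0)]⟩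
    have h2 := S.ptn n 0 x
    rw [zero_add] at h2
    rw [h2] at h1
    have h3 : p 0 x0 - u 0 x0 ≤ p 0 x - u 0 x := hx0 hx
    linarith [(abs_le.1 h1).1]
  · have : x ≤ g 0 ∨ h 0 ≤ x := by
      by_contra hc
      push Not at hc
      exact hx ⟨hc.1.le, hc.2.le⟩
    rw [H.supp 0 le_rfl x this]
    exact hwn _ hnω x

theorem PFBP.le_cauchy (S : Setting d ω L f p) (H : PFBP d μ f p u g h) {v : ℝ → ℝ → ℝ} {φ : ℝ → ℝ}
    (V : Cau d f φ v) (n : ℕ) (h0 : ∀ x, u 0 x ≤ v (n * ω) x) :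
    ∀ t ≥ 0, ∀ x, u t x ≤ v (t + n * ω) x := by
  intro T hT
  obtain ⟨m, hm, M, hM, hb⟩ := S.bounds
  obtain ⟨M', hM', hvb⟩ := V.ub
  obtain ⟨K, hK, hKl⟩ := S.lip.lip (M + M') (by positivity)
  have hn : 0 ≤ n * ω := mul_nonneg (Nat.cast_nonneg n) S.hω.le
  have := max_principle_strip (d := d) (K := K) (T := T) (C := M)
    (z := fun t x => u t x - v (t + n * ω) x) S.hd.le
    ((H.uc.mono (prod_mono Icc_subset_Ici_self le_rfl)).sub
      (V.vc.comp (f := fun q : ℝ × ℝ => (q.1 + n * ω, q.2)) (by fun_prop) (fun q hq => ⟨by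
        have := hq.1.1
        simp only [mem_Ici]; linarith, mem_univ _⟩)))
    (fun t ht x => by
      have := H.ltp t ht.1 x
      have := V.nn (t + n * ω) (by linarith [ht.1]) x
      linarith [(hb t x).2])
    (fun x => by have := h0 x; simp only [zero_add]; linarith)
    (fun t ht x hz => by
      have hu2 := V.nn (t + n * ω) (by linarith [ht.1]) x
      obtain ⟨e1, e2⟩ := H.dom ht.1.le (x := x) (by linarith : 0 < u t x)
      obtain ⟨b, hb1⟩ := H.pde t ht.1 x e1 e2
      obtain ⟨b', hb2⟩ := V.pde (t + n * ω) (by linarith [ht.1]) x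
      rw [S.ftn n _ _ _ hu2] at hb2
      have hb3 := PD.shift (u := v) (t := t) (x := x) (a := n * ω) (e := 0) (by simpa using hb2)
      simp only [add_zero] at hb3
      refine ⟨_, _, hb1.sub hb3, ?_⟩
      have := H.ltp t ht.1.le x
      have h2 := (hb t x).2
      have := hvb (t + n * ω) (by linarith [ht.1]) x
      have := hKl t x (u t x) (v (t + n * ω) x) (by linarith) (by linarith) hu2 (by linarith)
      rw [abs_of_pos hz] at this
      have := (abs_le.1 this).2
      linarith) T ⟨hT, le_rfl⟩
  intro x
  linarith [this x]

theorem tendsto_shift_div {h : ℝ → ℝ} {c : ℝ} (a : ℝ) (hs : Tendsto (fun t => h t / t) atTop (𝓝 c)) :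
    Tendsto (fun t => h (t + a) / t) atTop (𝓝 c) := by
  have h1 : Tendsto (fun t : ℝ => t + a) atTop atTop := tendsto_atTop_add_const_right _ _ tendsto_id
  have h2 := hs.comp h1
  have h3 : Tendsto (fun t : ℝ => (t + a) / t) atTop (𝓝 1) := by
    have : Tendsto (fun t : ℝ => 1 + a / t) atTop (𝓝 (1 + 0)) :=
      tendsto_const_nhds.add (tendsto_const_nhds.div_atTop tendsto_id)
    rw [add_zero] at this
    refine this.congr' ?_
    filter_upwards [eventually_gt_atTop 0] with t ht
    field_simp
  have := h2.mul h3
  rw [mul_one] at this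
  refine this.congr' ?_
  filter_upwards [eventually_gt_atTop 0, eventually_gt_atTop (-a)] with t ht ht2
  have : t + a ≠ 0 := by linarith
  simp only [Function.comp]
  field_simp

theorem Good.mono {μ1 μ2 c1 c2 : ℝ} {u1 u2 : ℝ → ℝ → ℝ} {g1 h1 g2 h2 : ℝ → ℝ} (S : Setting d ω L f p)
    (G1 : Good d μ1 f p u1 g1 h1 c1) (G2 : Good d μ2 f p u2 g2 h2 c2) (hμ : 0 < μ1) (hμ12 : μ1 < μ2) :
    c1 ≤ c2 := by
  obtain ⟨N, hN⟩ := G1.sol.eventually_above S G2.loc (fun t ht x => G2.sol.nonneg ht x)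
  have hnt : Tendsto (fun n : ℕ => (n : ℝ) * ω) atTop atTop :=
    tendsto_natCast_atTop_atTop.atTop_mul_const S.hω
  obtain ⟨n, ⟨n1, n2⟩, n3⟩ := (((tendsto_natCast_atTop_atTop (R := ℝ)).eventually_ge_atTop N).and
    ((G2.hinf.comp hnt).eventually_gt_atTop (h1 0)) |>.and
    ((G2.ginf.comp hnt).eventually_lt_atBot (g1 0))).exists
  simp only [Function.comp] at n2 n3
  have H2 := G2.sol.shift S n 0
  have := G1.sol.compare S H2 hμ hμ12 (fun x => by simpa using hN n n1 x) (by simpa using n2)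
    (by simpa using n3)
  refine le_of_tendsto_of_tendsto G1.speed (tendsto_shift_div (n * ω) G2.speed) ?_
  filter_upwards [eventually_gt_atTop 0] with t ht
  have := this t ht.le
  simp only [Nat.cast_zero, zero_mul, sub_zero] at this
  exact div_le_div_of_nonneg_right this.le ht.le

theorem Good.le_cbar {c cb : ℝ} {φ : ℝ → ℝ} {v : ℝ → ℝ → ℝ} (S : Setting d ω L f p)
    (G : Good d μ f p u g h c) (V : Cau d f φ v) (hl : LocConv p v) (hcb : 0 < cb)
    (hout : ∀ c' > cb, ∀ ε > 0, ∃ T, ∀ t ≥ T, ∀ x, c' * t ≤ x → |v t x| ≤ ε) : c ≤ cb := by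
  by_contra hc
  push Not at hc
  obtain ⟨m, hm, M, hM, hb⟩ := S.bounds
  obtain ⟨N, hN⟩ := G.sol.eventually_above S hl V.nn
  obtain ⟨n, hn⟩ := exists_nat_ge N
  have hle := G.sol.le_cauchy S V n (hN n hn)
  have hnω : 0 ≤ n * ω := mul_nonneg (Nat.cast_nonneg n) S.hω.le
  obtain ⟨c1, h1, h2⟩ := exists_between hc
  obtain ⟨c', h3, h4⟩ := exists_between h1
  obtain ⟨T1, hT1⟩ := G.inner c1 (by linarith) h2 (m / 2) (by positivity)
  obtain ⟨T2, hT2⟩ := hout c' h3 (m / 4) (by positivity)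
  obtain ⟨t, ht⟩ : ∃ t, t = max (max T1 T2) (c' * (n * ω) / (c1 - c')) := ⟨_, rfl⟩
  have ht1 : T1 ≤ t := by rw [ht]; exact (le_max_left _ _).trans (le_max_left _ _)
  have ht2 : T2 ≤ t := by rw [ht]; exact (le_max_right _ _).trans (le_max_left _ _)
  have ht3 : c' * (n * ω) / (c1 - c') ≤ t := by rw [ht]; exact le_max_right _ _
  have hc'p : 0 < c' := by linarith
  have hc1p : 0 < c1 - c' := by linarith
  have ht0 : 0 ≤ t := le_trans (by positivity) ht3
  rw [div_le_iff₀ hc1p] at ht3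
  have k1 := hT1 t ht1 (c1 * t) ⟨by
    have : 0 < c1 := by linarith
    positivity, le_rfl⟩
  have k2 := hT2 (t + n * ω) (by linarith) (c1 * t) (by nlinarith)
  have k3 := hle t ht0 (c1 * t)
  have k4 := (hb t (c1 * t)).1
  linarith [(abs_le.1 k1).1, (abs_le.1 k2).2]

end

section
/-- tent initial datum -/
def tent (m : ℝ) (x : ℝ) : ℝ := m / 4 * max 0 (1 - |x|)

theorem tent_nonneg {m : ℝ} (hm : 0 < m) (x : ℝ) : 0 ≤ tent m x :=
  mul_nonneg (by positivity) (le_max_left _ _)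

theorem tent_le {m : ℝ} (hm : 0 < m) (x : ℝ) : tent m x ≤ m / 4 := by
  have : max 0 (1 - |x|) ≤ 1 := max_le zero_le_one (by linarith [abs_nonneg x])
  unfold tent
  nlinarith

theorem tent_eq {m x : ℝ} (hx : |x| ≤ 1) : tent m x = m / 4 * (1 - |x|) := by
  unfold tent
  rw [max_eq_right (by linarith)]

theorem tent_zero {m x : ℝ} (hx : 1 ≤ |x|) : tent m x = 0 := by
  unfold tent
  rw [max_eq_left (by linarith), mul_zero]

variable {d μ ω L : ℝ} {f : ℝ → ℝ → ℝ → ℝ} {p u : ℝ → ℝ → ℝ} {g h : ℝ → ℝ}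

/-- the supports of the Cauchy solution above level `ε` move with finite speed -/
theorem Cau.cone {m T ε ℓ0 : ℝ} {v : ℝ → ℝ → ℝ} (V : Cau d f (tent m) v) (hm : 0 < m)
    (hε : 0 < ε) (hℓ : 0 < ℓ0) (hℓ1 : ℓ0 < 1) (hφ : m / 4 * (1 - ℓ0) < ε) :
    ∃ σ ≥ 0, ∀ t ∈ Icc 0 T, ∀ x, ℓ0 + σ * t ≤ |x| → v t x ≤ ε := by
  obtain ⟨X, hX, hXt⟩ := V.tail T ε hε
  have hini : ∀ x, ℓ0 ≤ |x| → v 0 x < ε := by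
    intro x hx
    rw [V.init]
    rcases le_total 1 |x| with h1 | h1
    · rw [tent_zero h1]; exact hε
    · rw [tent_eq h1]; nlinarith
  have hcl0 : IsClosed (Icc 0 T ×ˢ Icc (-X) X : Set (ℝ × ℝ)) := isClosed_Icc.prod isClosed_Icc
  have hvc : ContinuousOn (fun q : ℝ × ℝ => v q.1 q.2) (Icc 0 T ×ˢ Icc (-X) X) :=
    V.vc.mono (prod_mono Icc_subset_Ici_self (subset_univ _))
  obtain ⟨C, hC⟩ : ∃ C : Set (ℝ × ℝ), C = {q ∈ (Icc 0 T ×ˢ Icc (-X) X : Set (ℝ × ℝ)) | ε ≤ v q.1 q.2} ∩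
      {q | ℓ0 ≤ |q.2|} := ⟨_, rfl⟩
  have hCc : IsCompact C := by
    refine (isCompact_Icc.prod isCompact_Icc : IsCompact (Icc 0 T ×ˢ Icc (-X) X : Set (ℝ × ℝ))).of_isClosed_subset ?_ ?_
    · rw [hC]
      exact (hcl0.isClosed_le continuousOn_const hvc).inter
        (isClosed_le continuous_const (by fun_prop))
    · rw [hC]; exact fun q hq => hq.1.1
  have key : ∃ τ > 0, ∀ q ∈ C, τ ≤ q.1 := by
    rcases C.eq_empty_or_nonempty with h1 | h1
    · exact ⟨1, one_pos, fun q hq => by rw [h1] at hq; exact absurd hq (notMem_empty _)⟩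
    · obtain ⟨q0, hq0, hmin⟩ := hCc.exists_isMinOn h1 (continuousOn_fst)
      refine ⟨q0.1, ?_, fun q hq => hmin hq⟩
      rw [hC] at hq0
      obtain ⟨⟨⟨h2, h3⟩, h4⟩, h5⟩ := hq0
      rcases h2.1.lt_or_eq with h6 | h6
      · exact h6
      · exfalso
        have := hini q0.2 h5
        rw [h6] at this
        linarith
  obtain ⟨τ, hτ, hτC⟩ := key
  refine ⟨X / τ, by positivity, fun t ht x hx => ?_⟩
  by_contra hc
  push Not at hc
  have hxX : |x| < X := by
    by_contra h2
    have := hXt t ht x (not_lt.1 h2)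
    linarith
  have hσt : 0 ≤ X / τ * t := mul_nonneg (by positivity) ht.1
  have hmem : (t, x) ∈ C := by
    rw [hC]
    refine ⟨⟨⟨ht, abs_le.1 hxX.le⟩, hc.le⟩, ?_⟩
    show ℓ0 ≤ |x|
    linarith
  have h3 := hτC _ hmem
  simp only at h3
  have : X ≤ X / τ * t := by
    rw [div_mul_eq_mul_div, le_div_iff₀ hτ]
    exact mul_le_mul_of_nonneg_left h3 hX.le
  linarith

theorem PFBP.near_cauchy {m T : ℝ} {v : ℝ → ℝ → ℝ} (S : Setting d ω L f p) (hm : 0 < m)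
    (V : Cau d f (tent m) v) (hT : 0 < T) :
    ∃ μ0 > 0, ∀ μ ≥ μ0, ∀ u g h, PFBP d μ f p u g h → (∀ x, tent m x ≤ u 0 x) →
      ∀ x, v T x - m / 4 ≤ u T x := by
  obtain ⟨m', hm', M, hM, hb⟩ := S.bounds
  obtain ⟨M', hM', hvb⟩ := V.ub
  obtain ⟨K, hK, hKl, hKa⟩ := S.lip.abs_le (R := M + M') (by positivity)
  obtain ⟨ε, hε⟩ : ∃ ε, ε = m / 4 * Real.exp (-(K * T)) := ⟨_, rfl⟩
  have hε0 : 0 < ε := by rw [hε]; positivity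
  have hεm : ε ≤ m / 4 := by
    rw [hε]
    have : Real.exp (-(K * T)) ≤ 1 := by
      rw [Real.exp_le_one_iff]
      have : 0 < K * T := by positivity
      linarith
    nlinarith
  have hεT : ε * Real.exp (K * T) = m / 4 := by
    rw [hε, mul_assoc, ← Real.exp_add]; simp
  obtain ⟨ℓ0, hℓ0⟩ : ∃ ℓ0, ℓ0 = 1 - 2 * ε / m := ⟨_, rfl⟩
  have e1 : 2 * ε / m ≤ 1 / 2 := by rw [div_le_iff₀ hm]; linarith
  have e2 : 0 < 2 * ε / m := by positivity
  have hℓ : 0 < ℓ0 := by linarith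
  have hℓ1 : ℓ0 < 1 := by linarith
  have hφ0 : m / 4 * (1 - ℓ0) = ε / 2 := by rw [hℓ0]; field_simp; ring
  obtain ⟨σ, hσ, hcone⟩ := V.cone (T := T) hm hε0 hℓ hℓ1 (by linarith)
  obtain ⟨c, hc, hbump⟩ := bump_below (d := d) (K := K) (ℓ0 := ℓ0) (σ := σ) (T := T) (m := ε / 2)
    (θ := 1) S.hd hK.le hℓ hσ hT.le (by positivity) one_pos
  refine ⟨σ / (c * ℓ0) + 1, by positivity, fun μ hμ u g h H h0 => ?_⟩
  have hμσ : σ < μ * (c * ℓ0) := by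
    have : σ / (c * ℓ0) < μ := by linarith
    rwa [div_lt_iff₀ (by positivity)] at this
  have hμ0 : 0 < μ := lt_of_lt_of_le (by positivity) hμ
  have hini : ∀ x, |x| ≤ ℓ0 → ε / 2 ≤ u 0 x := by
    intro x hx
    refine le_trans ?_ (h0 x)
    rw [tent_eq (by linarith)]
    rw [← hφ0]
    nlinarith
  have ch : ContinuousOn (fun t => h t - (ℓ0 + σ * t)) (Ici 0) := H.hc.sub (by fun_prop)
  have cg : ContinuousOn (fun t => - g t - (ℓ0 + σ * t)) (Ici 0) := H.gc.neg.sub (by fun_prop)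
  have i1 := H.dom (t := 0) (x := ℓ0) le_rfl
    (lt_of_lt_of_le (by positivity) (hini ℓ0 (abs_of_pos hℓ).le))
  have i2 := H.dom (t := 0) (x := -ℓ0) le_rfl
    (lt_of_lt_of_le (by positivity) (hini (-ℓ0) (by rw [abs_neg, abs_of_pos hℓ])))
  have hfb : ∀ t ≥ 0, ∀ x, |f t x (u t x)| ≤ K * u t x := fun t ht x =>
    hKa t x _ (H.nonneg ht x) (by linarith [H.ltp t ht x, (hb t x).2])
  have hout := first_touch (T := T) (ch.mono Icc_subset_Ici_self) (cg.mono Icc_subset_Ici_self)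
    (by simp only [mul_zero, add_zero]; linarith [i1.2]) (by simp only [mul_zero, add_zero]; linarith [i2.1])
    (fun t1 ht1 hbf => by
      have hh1 : 0 ≤ h t1 - (ℓ0 + σ * t1) := nonneg_left_limit (ψ := fun t => h t - (ℓ0 + σ * t)) ht1.1
        (ch.mono Icc_subset_Ici_self) (fun s hs => (hbf s hs).1)
      have hg1 : 0 ≤ - g t1 - (ℓ0 + σ * t1) := nonneg_left_limit
        (ψ := fun t => - g t - (ℓ0 + σ * t)) ht1.1
        (cg.mono Icc_subset_Ici_self) (fun s hs => (hbf s hs).2)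
      have hin : ∀ t, 0 ≤ t → t ≤ t1 → ℓ0 + σ * t ≤ h t ∧ g t ≤ -(ℓ0 + σ * t) := by
        intro t h1 h2
        rcases h2.lt_or_eq with e | e
        · have := hbf t ⟨h1, e⟩
          constructor <;> linarith [this.1, this.2]
        · rw [e]; constructor <;> linarith
      have hlow := hbump u 0 0 t1 ht1.1.le ht1.2
        (H.uc.mono (fun q hq => ⟨hq.1, mem_univ _⟩))
        (fun x hx => hini x (by simpa using hx))
        (fun t x h1 _ _ => H.nonneg h1 x)
        (fun t x h1 h2 h3 _ => by
          rw [sub_zero, sub_zero] at h3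
          have h3' := abs_lt.1 h3
          obtain ⟨k1, k2⟩ := hin t h1.le (by linarith)
          obtain ⟨b, hb1⟩ := H.pde t h1 x (by linarith) (by linarith)
          refine ⟨b, _, hb1, ?_⟩
          linarith [(abs_le.1 (hfb t h1.le x)).1])
      obtain ⟨ℓ, hℓd⟩ : ∃ ℓ, ℓ = ℓ0 + σ * t1 := ⟨_, rfl⟩
      have hσt : 0 ≤ σ * t1 := mul_nonneg hσ ht1.1.le
      have hℓp : ℓ0 ≤ ℓ := by linarith
      have hlow1 : ∀ x, |x| ≤ ℓ → c * (ℓ ^ 2 - x ^ 2) ≤ u t1 x := by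
        intro x hx
        have := hlow t1 x ht1.1.le (by linarith) (by rw [sub_zero, sub_zero, ← hℓd]; exact hx)
        rwa [sub_zero, sub_zero, ← hℓd] at this
      have hlow2 : ∀ y, 0 < y → y < ℓ → c * ℓ * y ≤ u t1 (ℓ - y) := by
        intro y h1 h2
        refine le_trans ?_ (hlow1 (ℓ - y) (by rw [abs_of_pos (by linarith)]; linarith))
        have : 0 ≤ c * (y * (ℓ - y)) := by
          have : 0 < ℓ - y := by linarith
          positivity
        nlinarith
      have hlow3 : ∀ y, -ℓ < y → y < 0 → c * ℓ * (y + ℓ) ≤ u t1 y := by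
        intro y h1 h2
        refine le_trans ?_ (hlow1 y (by rw [abs_of_neg h2]; linarith))
        have : 0 ≤ c * ((-y) * (ℓ + y)) := by
          have : 0 < ℓ + y := by linarith
          have : 0 < - y := by linarith
          positivity
        nlinarith
      constructor
      · rcases hh1.lt_or_eq with e | e
        · exact e
        exfalso
        obtain ⟨n, hn, a1, b1⟩ := H.sr t1 ht1.1
        have hht : h t1 = ℓ := by linarith
        rw [hht] at a1
        have hcn := slope_ge a1 (H.supp t1 ht1.1.le _ (Or.inr hht.le)) (by linarith : 0 < ℓ) hlow2
        have hder : HasDerivAt (fun t => h t - (ℓ0 + σ * t)) (μ * n - σ) t1 := by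
          have := ((hasDerivAt_id t1).const_mul σ).const_add ℓ0
          exact (b1.sub this).congr_deriv (by ring)
        have := deriv_nonpos_of_touch ht1.1 (fun s hs => (hbf s hs).1) e.symm hder
        have : μ * (c * ℓ0) ≤ μ * n := by
          apply mul_le_mul_of_nonneg_left _ hμ0.le
          nlinarith
        linarith
      · rcases hg1.lt_or_eq with e | e
        · exact e
        exfalso
        obtain ⟨n, hn, a1, b1⟩ := H.sl t1 ht1.1
        have hht : g t1 = -ℓ := by linarith
        rw [hht] at a1
        have hlin : HasDerivWithinAt (fun y => c * ℓ * (y + ℓ)) (c * ℓ) (Ici (-ℓ)) (-ℓ) := by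
          have := ((hasDerivAt_id (-ℓ)).add_const ℓ).const_mul (c * ℓ)
          exact (this.congr_deriv (by ring)).hasDerivWithinAt
        have hcn := slope_le_right hlin a1 (by
          rw [H.supp t1 ht1.1.le _ (Or.inl hht.ge)]; ring) (by
          filter_upwards [Ioo_mem_nhdsGT (show -ℓ < 0 by linarith)] with y hy
          exact hlow3 y hy.1 hy.2)
        have hder : HasDerivAt (fun t => - g t - (ℓ0 + σ * t)) (μ * n - σ) t1 := by
          have := ((hasDerivAt_id t1).const_mul σ).const_add ℓ0
          exact (b1.neg.sub this).congr_deriv (by ring)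
        have := deriv_nonpos_of_touch ht1.1 (fun s hs => (hbf s hs).2) e.symm hder
        have : μ * (c * ℓ0) ≤ μ * n := by
          apply mul_le_mul_of_nonneg_left _ hμ0.le
          nlinarith
        linarith)
  have hz := max_principle_strip (d := d) (K := K) (T := T) (C := M')
    (z := fun t x => v t x - ε * Real.exp (K * t) - u t x) S.hd.le
    (((V.vc.mono (prod_mono Icc_subset_Ici_self le_rfl)).sub
      (by fun_prop)).sub (H.uc.mono (prod_mono Icc_subset_Ici_self le_rfl)))
    (fun t ht x => by
      have := H.nonneg ht.1 x
      have := hvb t ht.1 x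
      have : 0 < ε * Real.exp (K * t) := by positivity
      linarith)
    (fun x => by
      have := h0 x
      simp only [V.init, mul_zero, Real.exp_zero, mul_one]
      linarith)
    (fun t ht x hz => by
      have ht' : t ∈ Icc 0 T := ⟨ht.1.le, ht.2⟩
      have hun := H.nonneg ht.1.le x
      have hex : ε ≤ ε * Real.exp (K * t) := by
        have : 1 ≤ Real.exp (K * t) := Real.one_le_exp (mul_nonneg hK.le ht.1.le)
        nlinarith
      have hx : |x| < ℓ0 + σ * t := by
        by_contra hcx
        have := hcone t ht' x (not_lt.1 hcx)
        linarith
      have hx' := abs_lt.1 hx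
      obtain ⟨k1, k2⟩ := hout t ht'
      obtain ⟨b, hb1⟩ := H.pde t ht.1 x (by linarith) (by linarith)
      obtain ⟨b', hb2⟩ := V.pde t ht.1 x
      have hpe : PD (fun s _ => ε * Real.exp (K * s)) t x 0 (K * (ε * Real.exp (K * t))) := by
        refine ⟨D2.const _ _, ?_⟩
        have := (((hasDerivAt_id t).const_mul K).exp).const_mul ε
        exact this.congr_deriv (by simp only [id]; ring)
      refine ⟨_, _, (hb2.sub hpe).sub hb1, ?_⟩
      have := hvb t ht.1.le x
      have := H.ltp t ht.1.le x
      have := (hb t x).2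
      have := hKl t x (v t x) (u t x) (V.nn t ht.1.le x) (by linarith) hun (by linarith)
      rw [abs_of_pos (by linarith : 0 < v t x - u t x)] at this
      have := (abs_le.1 this).2
      linarith) T ⟨hT.le, le_rfl⟩
  intro x
  have := hz x
  rw [hεT] at this
  linarith

end

section
variable {d μ ω L : ℝ} {f : ℝ → ℝ → ℝ → ℝ} {p u : ℝ → ℝ → ℝ} {g h : ℝ → ℝ}

theorem Good.lower {m cb : ℝ} {v : ℝ → ℝ → ℝ} (S : Setting d ω L f p) (hm : 0 < m)
    (hmp : ∀ t x, m ≤ p t x) (V : Cau d f (tent m) v) (hv : InnerConv p v cb)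
    {c1 η : ℝ} (hc1 : 0 < c1) (hc1b : c1 < cb) (hη : 0 < η) :
    ∃ μ0 > 0, ∀ μ ≥ μ0, ∀ u g h c, Good d μ f p u g h c → c1 - η ≤ c := by
  obtain ⟨T0, hT0⟩ := hv c1 hc1 hc1b (m / 4) (by positivity)
  have hnt : Tendsto (fun n : ℕ => (n : ℝ) * ω) atTop atTop :=
    tendsto_natCast_atTop_atTop.atTop_mul_const S.hω
  have hL := S.hL
  obtain ⟨N, hN⟩ := (hnt.eventually_ge_atTop
    (max T0 (max ((2 + L) / c1) (max ((1 + L) / η) 1)))).exists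
  obtain ⟨T, hTd⟩ : ∃ T, T = (N : ℝ) * ω := ⟨_, rfl⟩
  rw [← hTd] at hN
  simp only [max_le_iff] at hN
  obtain ⟨hN1, hN2, hN3, hN4⟩ := hN
  rw [div_le_iff₀ hc1] at hN2
  rw [div_le_iff₀ hη] at hN3
  have hTp : 0 < T := by linarith
  obtain ⟨j, hjd⟩ : ∃ j, j = ⌊(T * c1 - 1) / L⌋₊ := ⟨_, rfl⟩
  have hj1 : j * L ≤ T * c1 - 1 := by
    have := Nat.floor_le (a := (T * c1 - 1) / L) (div_nonneg (by linarith) hL.le)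
    rw [← hjd, le_div_iff₀ hL] at this
    exact this
  have hj2 : T * c1 - 1 < (j + 1) * L := by
    have := Nat.lt_floor_add_one ((T * c1 - 1) / L)
    rw [← hjd, div_lt_iff₀ hL] at this
    exact this
  obtain ⟨μ0, hμ0, hμ⟩ := PFBP.near_cauchy S hm V hTp
  refine ⟨μ0, hμ0, fun μ hμle u g h c G => ?_⟩
  -- one step
  have step : ∀ u g h, PFBP d μ f p u g h → (∀ x, tent m x ≤ u 0 x) →
      ∀ x, tent m x ≤ u T (x + j * L) := by
    intro u g h H h0 x
    by_cases hx : 1 ≤ |x|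
    · rw [tent_zero hx]; exact H.nonneg hTp.le _
    · push Not at hx
      have hx' := abs_lt.1 hx
      have e1 := hμ μ hμle u g h H h0 (x + j * L)
      have e2 := hT0 T hN1 (x + j * L) ⟨by linarith, by linarith⟩
      have e3 := hmp T (x + j * L)
      have e4 := tent_le hm x
      have := (abs_le.1 e2).1
      linarith
  obtain ⟨T1, hT1⟩ := G.loc 1 one_pos (m / 2) (by positivity)
  obtain ⟨n0, hn0⟩ := (hnt.eventually_ge_atTop T1).exists
  have H0 := G.sol.shift S n0 0
  obtain ⟨U, hU⟩ : ∃ U : ℝ → ℝ → ℝ, U = fun t x => u (t + n0 * ω) (x + (0:ℕ) * L) := ⟨_, rfl⟩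
  obtain ⟨A, hA⟩ : ∃ A : ℝ → ℝ, A = fun t => g (t + n0 * ω) - (0:ℕ) * L := ⟨_, rfl⟩
  obtain ⟨B, hB⟩ : ∃ B : ℝ → ℝ, B = fun t => h (t + n0 * ω) - (0:ℕ) * L := ⟨_, rfl⟩
  rw [← hU, ← hA, ← hB] at H0
  have ind : ∀ n : ℕ, ∀ x, tent m x ≤ U (n * T) (x + n * (j * L)) := by
    intro n
    induction n with
    | zero =>
      intro x
      simp only [hU, Nat.cast_zero, zero_mul, zero_add, add_zero]
      by_cases hx : 1 ≤ |x|
      · rw [tent_zero hx]; exact G.sol.nonneg (mul_nonneg (Nat.cast_nonneg _) S.hω.le) _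
      · push Not at hx
        have hx' := abs_lt.1 hx
        have e2 := hT1 (n0 * ω) hn0 x ⟨by linarith, by linarith⟩
        have e3 := hmp (n0 * ω) x
        have e4 := tent_le hm x
        have := (abs_le.1 e2).1
        linarith
    | succ n ih =>
      intro x
      have := step _ _ _ (H0.shift S (n * N) (n * j)) (fun x => by
        have := ih x
        refine this.trans_eq ?_
        push_cast
        rw [hTd]
        congr 1 <;> ring) x
      refine this.trans_eq ?_
      push_cast
      rw [hTd]
      congr 1 <;> ring
  have hpos : ∀ n : ℕ, (n:ℝ) * (j * L) ≤ B (n * T) := by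
    intro n
    have h1 := ind n 0
    rw [tent_eq (by simp)] at h1
    simp only [abs_zero, zero_add] at h1
    exact (H0.dom (mul_nonneg (Nat.cast_nonneg _) hTp.le) (by linarith)).2.le
  have hlim : Tendsto (fun n : ℕ => B (n * T) / (n * T)) atTop (𝓝 c) := by
    have := (tendsto_shift_div (n0 * ω) G.speed).comp
      ((tendsto_natCast_atTop_atTop (R := ℝ)).atTop_mul_const hTp)
    refine this.congr fun n => ?_
    simp [hB]
  have : (j * L) / T ≤ c := by
    refine ge_of_tendsto hlim ?_
    filter_upwards [eventually_gt_atTop 0] with n hn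
    have hn' : (0:ℝ) < n := by exact_mod_cast hn
    rw [div_le_div_iff₀ hTp (by positivity)]
    have := hpos n
    nlinarith
  refine le_trans ?_ this
  rw [le_div_iff₀ hTp]
  nlinarith

theorem right_side {m cb : ℝ} {v : ℝ → ℝ → ℝ} {cp : ℝ → ℝ} (S : Setting d ω L f p) (hm : 0 < m)
    (hmp : ∀ t x, m ≤ p t x) (V : Cau d f (tent m) v) (hl : LocConv p v) (hv : InnerConv p v cb)
    (hcb : 0 < cb)
    (hout : ∀ c' > cb, ∀ ε > 0, ∃ T, ∀ t ≥ T, ∀ x, c' * t ≤ x → |v t x| ≤ ε)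
    (hG : ∀ μ > 0, ∃ u g h, Good d μ f p u g h (cp μ)) :
    MonotoneOn cp (Ioi 0) ∧ Tendsto cp atTop (𝓝 cb) := by
  constructor
  · intro a ha b hb hab
    rcases eq_or_lt_of_le hab with rfl | hab
    · exact le_rfl
    · obtain ⟨_, _, _, G1⟩ := hG a ha
      obtain ⟨_, _, _, G2⟩ := hG b hb
      exact Good.mono S G1 G2 ha hab
  · rw [Metric.tendsto_atTop]
    intro ε hε
    obtain ⟨δ, hδ1, hδ2, hδ3⟩ : ∃ δ, 0 < δ ∧ δ < cb ∧ δ ≤ ε / 4 :=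
      ⟨min (cb / 2) (ε / 4), by positivity, by
        have := min_le_left (cb / 2) (ε / 4); linarith, min_le_right _ _⟩
    obtain ⟨μ0, h0, h1⟩ := Good.lower S hm hmp V hv (c1 := cb - δ) (η := δ) (by linarith)
      (by linarith) hδ1
    refine ⟨μ0, fun μ hμ => ?_⟩
    obtain ⟨_, _, _, G⟩ := hG μ (lt_of_lt_of_le h0 hμ)
    have e1 := G.le_cbar S V hl hcb hout
    have e2 := h1 μ hμ _ _ _ _ G
    rw [Real.dist_eq, abs_lt]
    constructor <;> linarith

end

section
theorem tent_neg (m x : ℝ) : tent m (-x) = tent m x := by simp [tent]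

theorem tent_continuous (m : ℝ) : Continuous (tent m) := by unfold tent; fun_prop

theorem tent_compact (m : ℝ) : HasCompactSupport (tent m) := by
  refine HasCompactSupport.intro (K := Icc (-1) 1) isCompact_Icc fun x hx => tent_zero ?_
  by_contra hc
  push Not at hc
  have := abs_lt.1 hc
  exact hx ⟨this.1.le, this.2.le⟩

theorem Cau.refl {d : ℝ} {f : ℝ → ℝ → ℝ → ℝ} {φ : ℝ → ℝ} {v : ℝ → ℝ → ℝ} (V : Cau d f φ v) :
    Cau d (fun t x w => f t (-x) w) (fun x => φ (-x)) (fun t x => v t (-x)) where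
  vc := V.vc.comp (f := fun q : ℝ × ℝ => (q.1, -q.2)) (by fun_prop) (fun q hq => ⟨hq.1, mem_univ _⟩)
  init := fun x => V.init (-x)
  nn := fun t ht x => V.nn t ht (-x)
  ub := by
    obtain ⟨M, hM, h⟩ := V.ub
    exact ⟨M, hM, fun t ht x => h t ht (-x)⟩
  pde := fun t ht x => by
    obtain ⟨b, hb⟩ := V.pde t ht (-x)
    exact ⟨b, hb.refl⟩
  tail := fun T ε hε => by
    obtain ⟨X, hX, h⟩ := V.tail T ε hε
    exact ⟨X, hX, fun t ht x hx => h t ht (-x) (by rwa [abs_neg])⟩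

theorem mkGood {d μ ω L g₀ h₀ c : ℝ} {f : ℝ → ℝ → ℝ → ℝ} {p : ℝ → ℝ → ℝ} {u₀ : ℝ → ℝ}
    {u : ℝ → ℝ → ℝ} {g h : ℝ → ℝ} (sol : IsFBPSolution d μ f g₀ h₀ u₀ u g h)
    (S : Setting d ω L f p) (hμ : 0 < μ) (hgh : g₀ < h₀) (hm : memH g₀ h₀ u₀)
    (h0 : ∀ x ∈ Set.Icc g₀ h₀, u₀ x ≤ p 0 x) (hinf : Tendsto h atTop atTop)
    (ginf : Tendsto g atTop atBot) (hconv : LocConv p u) (hin : InnerConv p u c)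
    (hs : Tendsto (fun t => h t / t) atTop (𝓝 c)) :
    ∃ u g h, Good d μ f p u g h c := by
  obtain ⟨n, H⟩ := sol.pfbp S hμ hgh hm h0 hinf ginf hconv
  have hn : 0 ≤ n * ω := mul_nonneg (Nat.cast_nonneg n) S.hω.le
  have ht : Tendsto (fun t : ℝ => t + n * ω) atTop atTop :=
    tendsto_atTop_add_const_right _ _ tendsto_id
  refine ⟨_, _, _, H, ?_, ?_, hinf.comp ht, ginf.comp ht, tendsto_shift_div _ hs⟩
  · intro A hA ε hε
    obtain ⟨T, hT⟩ := hconv A hA ε hε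
    refine ⟨T, fun t ht x hx => ?_⟩
    have := hT (t + n * ω) (by linarith) x hx
    rwa [S.ptn] at this
  · intro c' h1 h2 ε hε
    obtain ⟨T, hT⟩ := hin c' h1 h2 ε hε
    refine ⟨T, fun t ht x hx => ?_⟩
    have := hT (t + n * ω) (by linarith) x ⟨hx.1, hx.2.trans (by nlinarith)⟩
    rwa [S.ptn] at this

theorem final_of_exist
    (d ω L : ℝ) (hd : 0 < d) (hω : 0 < ω) (hL : 0 < L)
    (f : ℝ → ℝ → ℝ → ℝ) (hf : BasicAssumptions ω L f)
    (p : ℝ → ℝ → ℝ) (hp : HypH d ω L f p)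
    (hex : ∀ m > 0, ∃ v, IsCauchySolution d f (tent m) v ∧ Cau d f (tent m) v)
    (cbarplus cbarminus : ℝ) (hcbp : 0 < cbarplus) (hcbm : 0 < cbarminus)
    (hcauchy : ∀ v₀ : ℝ → ℝ, Continuous v₀ → HasCompactSupport v₀ →
      (∀ x, 0 ≤ v₀ x) → (∀ x, v₀ x ≤ p 0 x) → (∃ x, v₀ x ≠ 0) →
      ∀ v : ℝ → ℝ → ℝ, IsCauchySolution d f v₀ v →
        (∀ c₁ c₂ : ℝ, -cbarminus < -c₂ → -c₂ < c₁ → c₁ < cbarplus →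
          ∀ ε > 0, ∃ T, ∀ t ≥ T, ∀ x ∈ Set.Icc (-c₂ * t) (c₁ * t), |v t x - p t x| ≤ ε) ∧
        (∀ c₁' c₂' : ℝ, cbarminus < c₂' → cbarplus < c₁' →
          ∀ ε > 0, ∃ T, ∀ t ≥ T, ∀ x : ℝ, (x ≤ -c₂' * t ∨ c₁' * t ≤ x) → |v t x| ≤ ε))
    (cplus cminus : ℝ → ℝ)
    (hpos : ∀ μ > (0:ℝ), 0 < cplus μ ∧ 0 < cminus μ)
    (hconcl : ∀ μ > (0:ℝ), Theorem11Conclusion d μ f p (cminus μ) (cplus μ))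
    (hexists : ∀ μ > (0:ℝ), ∃ (g₀ h₀ : ℝ) (u₀ : ℝ → ℝ) (u : ℝ → ℝ → ℝ) (g h : ℝ → ℝ),
      g₀ < h₀ ∧ memH g₀ h₀ u₀ ∧ (∀ x ∈ Set.Icc g₀ h₀, u₀ x ≤ p 0 x) ∧
      IsFBPSolution d μ f g₀ h₀ u₀ u g h ∧
      Tendsto h atTop atTop ∧ Tendsto g atTop atBot ∧
      (∀ A > (0:ℝ), ∀ ε > 0, ∃ T, ∀ t ≥ T, ∀ x ∈ Set.Icc (-A) A, |u t x - p t x| ≤ ε)) :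
    MonotoneOn cplus (Set.Ioi 0) ∧ MonotoneOn cminus (Set.Ioi 0) ∧
    Tendsto cplus atTop (𝓝 cbarplus) ∧ Tendsto cminus atTop (𝓝 cbarminus) := by
  have hpc : Continuous (fun q : ℝ × ℝ => p q.1 q.2) := by
    obtain ⟨g₀, h₀, u₀, u, g, h, hgh, hm, h0, sol, hinf, ginf, hconv⟩ := hexists 1 one_pos
    exact p_continuous hω hp.per_t (sol.raw hgh hm).uc hconv
  have S : Setting d ω L f p :=
    ⟨hd, hω, hL, BasicAssumptions.flip hω hL hf, hf.per_t, hf.per_x, hp.pos, hp.per_t, hp.per_x, hpc,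
      fun t x => hp.sol.pd (Eventually.of_forall fun y => mem_univ _)⟩
  obtain ⟨m, hm, M, hM, hb⟩ := S.bounds
  obtain ⟨v, hv, V⟩ := hex m hm
  obtain ⟨hin, hout⟩ := hcauchy (tent m) (tent_continuous m) (tent_compact m) (tent_nonneg hm)
    (fun x => by have := tent_le hm x; have := (hb 0 x).1; linarith)
    ⟨0, by rw [tent_eq (by simp)]; simp; exact hm.ne'⟩ v hv
  have hloc : LocConv p v := by
    intro A hA ε hε
    obtain ⟨T, hT⟩ := hin (cbarplus / 2) (cbarminus / 2) (by linarith) (by linarith) (by linarith) ε hε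
    refine ⟨max T (max (A / (cbarplus / 2)) (A / (cbarminus / 2))), fun t ht x hx => ?_⟩
    simp only [ge_iff_le, max_le_iff] at ht
    obtain ⟨h1, h2, h3⟩ := ht
    rw [div_le_iff₀ (by linarith)] at h2 h3
    exact hT t h1 x ⟨by linarith [hx.1], by linarith [hx.2]⟩
  have R1 := right_side (cp := cplus) S hm (fun t x => (hb t x).1) V hloc
    (cb := cbarplus) (fun c h1 h2 ε hε => by
      obtain ⟨T, hT⟩ := hin c (cbarminus / 2) (by linarith) (by linarith) h2 ε hε
      refine ⟨max T 0, fun t ht x hx => hT t (le_trans (le_max_left _ _) ht) x ⟨?_, hx.2⟩⟩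
      have : 0 ≤ t := le_trans (le_max_right _ _) ht
      nlinarith [hx.1]) hcbp (fun c' hc' ε hε => by
      obtain ⟨T, hT⟩ := hout c' (cbarminus + 1) (by linarith) hc' ε hε
      exact ⟨T, fun t ht x hx => hT t ht x (Or.inr hx)⟩) (fun μ hμ => by
      obtain ⟨g₀, h₀, u₀, u, g, h, hgh, hm, h0, sol, hinf, ginf, hconv⟩ := hexists μ hμ
      obtain ⟨k1, k2, k3⟩ := hconcl μ hμ g₀ h₀ hgh u₀ hm h0 u g h sol hinf ginf hconv
      obtain ⟨q1, q2⟩ := hpos μ hμ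
      refine mkGood sol S hμ hgh hm h0 hinf ginf hconv (fun c h1 h2 ε hε => ?_) k3
      obtain ⟨T, hT⟩ := k1 c (cminus μ / 2) (by linarith) (by linarith) h2 ε hε
      refine ⟨max T 0, fun t ht x hx => hT t (le_trans (le_max_left _ _) ht) x ⟨?_, hx.2⟩⟩
      have : 0 ≤ t := le_trans (le_max_right _ _) ht
      nlinarith [hx.1])
  have V' : Cau d (fun t x w => f t (-x) w) (tent m) (fun t x => v t (-x)) := by
    have := V.refl
    simp only [tent_neg] at this
    exact this
  have R2 := right_side (cp := cminus) S.refl hm (fun t x => (hb t (-x)).1) V'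
    (fun A hA ε hε => by
      obtain ⟨T, hT⟩ := hloc A hA ε hε
      exact ⟨T, fun t ht x hx => hT t ht (-x) ⟨by linarith [hx.2], by linarith [hx.1]⟩⟩)
    (cb := cbarminus) (fun c h1 h2 ε hε => by
      obtain ⟨T, hT⟩ := hin (cbarplus / 2) c (by linarith) (by linarith) (by linarith) ε hε
      refine ⟨max T 0, fun t ht x hx => hT t (le_trans (le_max_left _ _) ht) (-x) ⟨by linarith [hx.2], ?_⟩⟩
      have : 0 ≤ t := le_trans (le_max_right _ _) ht
      nlinarith [hx.1]) hcbm (fun c' hc' ε hε => by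
      obtain ⟨T, hT⟩ := hout (cbarplus + 1) c' hc' (by linarith) ε hε
      exact ⟨T, fun t ht x hx => hT t ht (-x) (Or.inl (by linarith))⟩) (fun μ hμ => by
      obtain ⟨g₀, h₀, u₀, u, g, h, hgh, hm, h0, sol, hinf, ginf, hconv⟩ := hexists μ hμ
      obtain ⟨k1, k2, k3⟩ := hconcl μ hμ g₀ h₀ hgh u₀ hm h0 u g h sol hinf ginf hconv
      obtain ⟨q1, q2⟩ := hpos μ hμ
      refine mkGood sol.refl S.refl hμ (by linarith) hm.refl
        (fun x hx => h0 (-x) ⟨by linarith [hx.2], by linarith [hx.1]⟩)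
        (tendsto_neg_atBot_atTop.comp ginf) (tendsto_neg_atTop_atBot.comp hinf)
        (fun A hA ε hε => by
          obtain ⟨T, hT⟩ := hconv A hA ε hε
          exact ⟨T, fun t ht x hx => hT t ht (-x) ⟨by linarith [hx.2], by linarith [hx.1]⟩⟩)
        (fun c h1 h2 ε hε => ?_) ?_
      · obtain ⟨T, hT⟩ := k1 (cplus μ / 2) c (by linarith) (by linarith) (by linarith) ε hε
        refine ⟨max T 0, fun t ht x hx => hT t (le_trans (le_max_left _ _) ht) (-x) ⟨by linarith [hx.2], ?_⟩⟩
        have : 0 ≤ t := le_trans (le_max_right _ _) ht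
        nlinarith [hx.1]
      · have := k2.neg
        rw [neg_neg] at this
        refine this.congr fun t => ?_
        rw [neg_div])
  exact ⟨R1.1, R2.1, R1.2, R2.2⟩

end

section
open MeasureTheory in
theorem integrable_exp_abs {a : ℝ} (ha : 0 < a) : Integrable (fun z : ℝ => Real.exp (-a * |z|)) := by
  rw [← integrableOn_univ, ← Iic_union_Ioi (a := (0:ℝ)), integrableOn_union]
  constructor
  · refine (integrableOn_exp_mul_Iic ha 0).congr_fun (fun z hz => ?_) measurableSet_Iic
    simp only [abs_of_nonpos (mem_Iic.1 hz)]; congr 1; ring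
  · refine (integrableOn_exp_mul_Ioi (a := -a) (by linarith) 0).congr_fun (fun z hz => ?_) measurableSet_Ioi
    simp only [abs_of_pos (mem_Ioi.1 hz)]

/-- admissible weights -/
structure Wt (W : ℝ → ℝ) : Prop where
  cont : Continuous W
  bd : ∃ C > 0, ∀ z, |W z| ≤ C * Real.exp (-2 * |z|)

open MeasureTheory in
theorem Wt.integrable_mul {W : ℝ → ℝ} (hW : Wt W) {G : ℝ → ℝ} (hG : Continuous G) {A B : ℝ}
    (hB : ∀ z, |G z| ≤ A + B * Real.exp |z|) : Integrable (fun z => G z * W z) := by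
  obtain ⟨C, hC, h⟩ := hW.bd
  have i1 := (integrable_exp_abs (a := 2) (by norm_num)).const_mul (C * |A|)
  have i2 := (integrable_exp_abs (a := 1) (by norm_num)).const_mul (C * |B|)
  refine (i1.add i2).mono' (hG.mul hW.cont).aestronglyMeasurable (Eventually.of_forall fun z => ?_)
  rw [Real.norm_eq_abs, abs_mul]
  have e : Real.exp |z| * Real.exp (-2 * |z|) = Real.exp (-1 * |z|) := by
    rw [← Real.exp_add]; congr 1; ring
  have h1 := hB z
  have h2 : A + B * Real.exp |z| ≤ |A| + |B| * Real.exp |z| :=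
    add_le_add (le_abs_self _) (mul_le_mul_of_nonneg_right (le_abs_self _) (Real.exp_pos _).le)
  calc |G z| * |W z| ≤ (|A| + |B| * Real.exp |z|) * (C * Real.exp (-2 * |z|)) :=
        mul_le_mul (h1.trans h2) (h z) (abs_nonneg _) (by positivity)
    _ = C * |A| * Real.exp (-2 * |z|) + C * |B| * (Real.exp |z| * Real.exp (-2 * |z|)) := by ring
    _ = _ := by rw [e]; rfl

open MeasureTheory in
theorem Wt.integrable {W : ℝ → ℝ} (hW : Wt W) : Integrable W := by
  have := hW.integrable_mul (G := fun _ => 1) continuous_const (A := 1) (B := 0) (by simp)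
  simpa using this

open MeasureTheory in
theorem Wt.integrable_bdd {W : ℝ → ℝ} (hW : Wt W) {G : ℝ → ℝ} (hG : Continuous G) {B : ℝ}
    (hB : ∀ z, |G z| ≤ B) : Integrable (fun z => G z * W z) :=
  hW.integrable_mul hG (A := B) (B := 0) (by simpa using hB)

/-- Gaussian weights -/
def gam (z : ℝ) : ℝ := (√(2 * Real.pi))⁻¹ * Real.exp (-z ^ 2 / 2)
def gam1 (z : ℝ) : ℝ := z * gam z
def gam2 (z : ℝ) : ℝ := (z ^ 2 - 1) * gam z

theorem gam_pos (z : ℝ) : 0 < gam z := by unfold gam; positivity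

theorem gam_continuous : Continuous gam := by unfold gam; fun_prop

theorem gam_bd (z : ℝ) : gam z * Real.exp |z| ≤ ((√(2 * Real.pi))⁻¹ * Real.exp (9/2)) * Real.exp (-2 * |z|) := by
  unfold gam
  rw [mul_assoc, mul_assoc, ← Real.exp_add, ← Real.exp_add]
  refine mul_le_mul_of_nonneg_left (Real.exp_le_exp.2 ?_) (by positivity)
  have : z ^ 2 = |z| ^ 2 := (sq_abs z).symm
  rw [this]
  nlinarith [sq_nonneg (|z| - 3)]

theorem wt_of_bd {q : ℝ → ℝ} (hq : Continuous q) {A : ℝ} (hA : 0 < A) (h : ∀ z, |q z| ≤ A * Real.exp |z|) :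
    Wt (fun z => q z * gam z) := by
  refine ⟨hq.mul gam_continuous, A * ((√(2 * Real.pi))⁻¹ * Real.exp (9/2)), by positivity, fun z => ?_⟩
  rw [abs_mul, abs_of_pos (gam_pos z)]
  calc |q z| * gam z ≤ A * Real.exp |z| * gam z := mul_le_mul_of_nonneg_right (h z) (gam_pos z).le
    _ = A * (gam z * Real.exp |z|) := by ring
    _ ≤ A * (((√(2 * Real.pi))⁻¹ * Real.exp (9/2)) * Real.exp (-2 * |z|)) :=
      mul_le_mul_of_nonneg_left (gam_bd z) hA.le
    _ = _ := by ring

theorem wt_gam : Wt gam := by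
  have := wt_of_bd (q := fun _ => 1) continuous_const (A := 1) one_pos
    (fun z => by simp)
  simpa using this

theorem wt_gam1 : Wt gam1 := by
  refine wt_of_bd (q := fun z => z) continuous_id (A := 1) one_pos (fun z => ?_)
  have := Real.add_one_le_exp |z|
  linarith

theorem wt_gam2 : Wt gam2 := by
  refine wt_of_bd (q := fun z => z ^ 2 - 1) (by fun_prop) (A := 2) two_pos (fun z => ?_)
  have := Real.quadratic_le_exp_of_nonneg (abs_nonneg z)
  rw [sq_abs] at this
  rw [abs_le]
  constructor <;> nlinarith [sq_nonneg z, abs_nonneg z]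

theorem gam_deriv (z : ℝ) : HasDerivAt gam (-gam1 z) z := by
  unfold gam1 gam
  have h1 : HasDerivAt (fun z : ℝ => -z ^ 2 / 2) (-z) z := by
    have := ((hasDerivAt_pow 2 z).neg).div_const 2
    exact this.congr_deriv (by simp; ring)
  exact (h1.exp.const_mul _).congr_deriv (by ring)

theorem gam1_deriv (z : ℝ) : HasDerivAt gam1 (-gam2 z) z := by
  unfold gam2
  have := (hasDerivAt_id z).mul (gam_deriv z)
  exact this.congr_deriv (by simp only [gam1, id]; ring)

theorem gam_integral : ∫ z, gam z = 1 := by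
  unfold gam
  rw [MeasureTheory.integral_const_mul]
  have := integral_gaussian (1/2)
  have e : (fun x : ℝ => Real.exp (-x ^ 2 / 2)) = fun x => Real.exp (-(1/2) * x ^ 2) := by
    ext x; congr 1; ring
  rw [e, this, show Real.pi / (1/2) = 2 * Real.pi by ring]
  exact inv_mul_cancel₀ (by positivity)

theorem change_var {W G : ℝ → ℝ} {σ : ℝ} (hσ : 0 < σ) (x : ℝ) :
    ∫ z, G (x + σ * z) * W z = σ⁻¹ * ∫ y, G y * W ((y - x) / σ) := by
  have h1 := MeasureTheory.Measure.integral_comp_mul_left (fun y => G (x + y) * W (y / σ)) σ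
  have h2 := MeasureTheory.integral_add_left_eq_self (μ := MeasureTheory.volume)
    (fun y => G y * W ((y - x) / σ)) x
  simp only [add_sub_cancel_left] at h2
  rw [h2, abs_of_pos (inv_pos.2 hσ), smul_eq_mul] at h1
  rw [← h1]
  congr 1; ext z
  rw [mul_div_cancel_left₀ _ hσ.ne']

open MeasureTheory in
theorem deriv_space {W W1 G : ℝ → ℝ} (hW : Wt W) (hW1 : Wt W1) (hd : ∀ z, HasDerivAt W (-W1 z) z)
    (hG : Continuous G) {B : ℝ} (hB : ∀ z, |G z| ≤ B) {σ : ℝ} (hσ : 0 < σ) (x : ℝ) :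
    HasDerivAt (fun x => ∫ z, G (x + σ * z) * W z) (σ⁻¹ * ∫ z, G (x + σ * z) * W1 z) x := by
  simp only [change_var hσ]
  refine HasDerivAt.const_mul _ ?_
  rw [← integral_const_mul]
  obtain ⟨C, hC, hCb⟩ := hW1.bd
  have hB0 : 0 ≤ B := (abs_nonneg _).trans (hB 0)
  have hi : Integrable (fun y => G y * W ((y - x) / σ)) := by
    have := hW.integrable_bdd (G := fun z => G (σ * z + x)) (by fun_prop) (B := B) (fun z => hB _)
    have := ((this.comp_div hσ.ne').comp_sub_right x)
    refine this.congr (Eventually.of_forall fun y => ?_)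
    simp only
    congr 2; field_simp; ring
  refine (hasDerivAt_integral_of_dominated_loc_of_deriv_le (s := Metric.ball x σ)
    (bound := fun y => σ⁻¹ * B * C * Real.exp 2 * Real.exp (-(2 / σ) * |y - x|))
    (F' := fun x' y => σ⁻¹ * (G y * W1 ((y - x') / σ)))
    (Metric.ball_mem_nhds x hσ) ?_ hi ?_ ?_ ?_ ?_).2
  · refine Eventually.of_forall fun x' => Continuous.aestronglyMeasurable ?_
    exact hG.mul (hW.cont.comp (by fun_prop))
  · refine Continuous.aestronglyMeasurable ?_
    exact continuous_const.mul (hG.mul (hW1.cont.comp (by fun_prop)))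
  · refine Eventually.of_forall fun y x' hx' => ?_
    rw [Real.norm_eq_abs, abs_mul, abs_mul, abs_of_pos (inv_pos.2 hσ)]
    have h1 := hCb ((y - x') / σ)
    have h2 : Real.exp (-2 * |(y - x') / σ|) ≤ Real.exp 2 * Real.exp (-(2 / σ) * |y - x|) := by
      rw [← Real.exp_add]
      refine Real.exp_le_exp.2 ?_
      rw [abs_div, abs_of_pos hσ]
      have h3 : |y - x| ≤ |y - x'| + σ := by
        rw [Metric.mem_ball, Real.dist_eq] at hx'
        calc |y - x| = |(y - x') + (x' - x)| := by congr 1; ring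
          _ ≤ _ := (abs_add_le _ _).trans (by linarith)
      have h4 : |y - x| / σ ≤ |y - x'| / σ + 1 := by
        rw [div_add_one hσ.ne']; exact div_le_div_of_nonneg_right h3 hσ.le
      have : -(2 / σ) * |y - x| = -2 * (|y - x| / σ) := by ring
      rw [this]; linarith
    calc σ⁻¹ * (|G y| * |W1 ((y - x') / σ)|)
        ≤ σ⁻¹ * (B * (C * (Real.exp 2 * Real.exp (-(2 / σ) * |y - x|)))) := by
          refine mul_le_mul_of_nonneg_left ?_ (inv_pos.2 hσ).le
          exact mul_le_mul (hB y) (h1.trans (mul_le_mul_of_nonneg_left h2 hC.le)) (abs_nonneg _) hB0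
      _ = _ := by ring
  · exact ((integrable_exp_abs (a := 2 / σ) (by positivity)).comp_sub_right x).const_mul _
  · refine Eventually.of_forall fun y x' hx' => ?_
    have h1 : HasDerivAt (fun x' => (y - x') / σ) (-1 / σ) x' :=
      ((hasDerivAt_id x').const_sub y).div_const σ
    have := ((hd ((y - x') / σ)).comp x' h1).const_mul (G y)
    exact this.congr_deriv (by field_simp)

theorem gam2_integral : ∫ z, gam2 z = 0 := by
  have h1 := deriv_space (G := fun _ => 1) wt_gam1 wt_gam2 gam1_deriv continuous_const (B := 1)
    (by simp) (σ := 1) one_pos 0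
  have := h1.unique (hasDerivAt_const _ _)
  simpa using this

open MeasureTheory in
theorem deriv_sigma {G : ℝ → ℝ} 
    (hG : Continuous G) {B : ℝ} (hB : ∀ z, |G z| ≤ B) {σ : ℝ} (hσ : 0 < σ) (x : ℝ) :
    HasDerivAt (fun σ => ∫ z, G (x + σ * z) * gam z) (σ⁻¹ * ∫ z, G (x + σ * z) * gam2 z) σ := by
  have key : ∀ W : ℝ → ℝ, ∀ σ > 0, ∫ z, G (x + σ * z) * W z = ∫ y, σ⁻¹ * (G y * W ((y - x) / σ)) := by
    intro W σ hσ
    rw [change_var hσ, integral_const_mul]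
  have hev : (fun σ => ∫ z, G (x + σ * z) * gam z) =ᶠ[𝓝 σ]
      fun σ => ∫ y, σ⁻¹ * (G y * gam ((y - x) / σ)) := by
    filter_upwards [lt_mem_nhds hσ] with s hs
    exact key _ s hs
  refine HasDerivAt.congr_of_eventuallyEq ?_ hev
  rw [key _ σ hσ, ← integral_const_mul]
  obtain ⟨C, hC, hCb⟩ := wt_gam2.bd
  have hB0 : 0 ≤ B := (abs_nonneg _).trans (hB 0)
  have hi : Integrable (fun y => σ⁻¹ * (G y * gam ((y - x) / σ))) := by
    have := wt_gam.integrable_bdd (G := fun z => G (σ * z + x)) (by fun_prop) (B := B) (fun z => hB _)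
    have := ((this.comp_div hσ.ne').comp_sub_right x).const_mul σ⁻¹
    refine this.congr (Eventually.of_forall fun y => ?_)
    simp only
    congr 3; field_simp; ring
  refine (hasDerivAt_integral_of_dominated_loc_of_deriv_le (s := Ioo (σ / 2) (2 * σ))
    (bound := fun y => (σ / 2)⁻¹ * ((σ / 2)⁻¹ * (B * (C * Real.exp (-(1 / σ) * |y - x|)))))
    (F' := fun s y => s⁻¹ * (s⁻¹ * (G y * gam2 ((y - x) / s))))
    (Ioo_mem_nhds (by linarith) (by linarith)) ?_ hi ?_ ?_ ?_ ?_).2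
  · refine Eventually.of_forall fun x' => Continuous.aestronglyMeasurable ?_
    exact continuous_const.mul (hG.mul (gam_continuous.comp (by fun_prop)))
  · refine Continuous.aestronglyMeasurable ?_
    exact continuous_const.mul (continuous_const.mul (hG.mul (wt_gam2.cont.comp (by fun_prop))))
  · refine Eventually.of_forall fun y s hs => ?_
    have hs0 : 0 < s := by linarith [hs.1]
    rw [Real.norm_eq_abs, abs_mul, abs_mul, abs_mul, abs_of_pos (inv_pos.2 hs0)]
    have h1 := hCb ((y - x) / s)
    have h2 : Real.exp (-2 * |(y - x) / s|) ≤ Real.exp (-(1 / σ) * |y - x|) := by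
      refine Real.exp_le_exp.2 ?_
      rw [abs_div, abs_of_pos hs0]
      have h3 : |y - x| * (1 / (2 * σ)) ≤ |y - x| * (1 / s) :=
        mul_le_mul_of_nonneg_left (one_div_le_one_div_of_le hs0 hs.2.le) (abs_nonneg _)
      have e1 : -(1 / σ) * |y - x| = -2 * (|y - x| * (1 / (2 * σ))) := by field_simp
      have e2 : |y - x| / s = |y - x| * (1 / s) := by ring
      rw [e1, e2]; linarith
    have h3 : s⁻¹ ≤ (σ / 2)⁻¹ := inv_anti₀ (by positivity) hs.1.le
    have h4 := mul_le_mul (hB y) (h1.trans (mul_le_mul_of_nonneg_left h2 hC.le)) (abs_nonneg _) hB0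
    exact mul_le_mul h3 (mul_le_mul h3 h4 (by positivity) (by positivity)) (by positivity) (by positivity)
  · exact (((((integrable_exp_abs (a := 1 / σ) (by positivity)).comp_sub_right x).const_mul _).const_mul
      _).const_mul _).const_mul _
  · refine Eventually.of_forall fun y s hs => ?_
    have hs0 : s ≠ 0 := by have := hs.1; intro h; linarith
    have h1 : HasDerivAt (fun s => (y - x) / s) (-(y - x) / s ^ 2) s := by
      have := (hasDerivAt_inv hs0).const_mul (y - x)
      simp only [← div_eq_mul_inv] at this
      exact this.congr_deriv (by field_simp)
    have h2 := ((gam_deriv ((y - x) / s)).comp s h1).const_mul (G y)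
    have := (hasDerivAt_inv hs0).mul h2
    exact this.congr_deriv (by simp only [gam2, gam1, Function.comp]; field_simp; ring)

end

section
theorem duhamel_time {P k : ℝ → ℝ → ℝ} {β : ℝ} (hβ : -1 < β) (hβ0 : β ≤ 0)
    (hP : Continuous (fun q : ℝ × ℝ => P q.1 q.2))
    (hk : ∀ r > 0, ∀ s, HasDerivAt (fun r => P r s) (k r s) r)
    (hkb : ∀ T, ∃ C, ∀ r > 0, ∀ s ≤ T, |k r s| ≤ C * r ^ β)
    (hR : Continuous (fun t => ∫ s in (0:ℝ)..t, k (t - s) s)) {t : ℝ} (ht : 0 < t) :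
    HasDerivAt (fun t => ∫ s in (0:ℝ)..t, P (t - s) s)
      (P 0 t + ∫ s in (0:ℝ)..t, k (t - s) s) t := by
  have hD : Continuous (fun t => ∫ s in (0:ℝ)..t, P (t - s) s) := by
    refine intervalIntegral.continuous_parametric_intervalIntegral_of_continuous
      (f := fun t s => P (t - s) s) ?_ continuous_id
    exact hP.comp (f := fun q : ℝ × ℝ => (q.1 - q.2, q.2)) (by fun_prop)
  have hPs : ∀ t, Continuous (fun s => P (t - s) s) := fun t =>
    hP.comp (f := fun s : ℝ => (t - s, s)) (by fun_prop)
  -- right derivative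
  have hright : ∀ t > 0, HasDerivWithinAt (fun t => ∫ s in (0:ℝ)..t, P (t - s) s)
      (P 0 t + ∫ s in (0:ℝ)..t, k (t - s) s) (Ici t) t := by
    intro t ht
    rw [← hasDerivWithinAt_Ioi_iff_Ici, hasDerivWithinAt_iff_tendsto_slope' (by simp)]
    have h1 : Tendsto (fun t' => ∫ θ in (0:ℝ)..1, P ((t' - t) * (1 - θ)) (t + (t' - t) * θ))
        (𝓝[>] t) (𝓝 (P 0 t)) := by
      have hc : Continuous (fun t' => ∫ θ in (0:ℝ)..1, P ((t' - t) * (1 - θ)) (t + (t' - t) * θ)) := by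
        refine intervalIntegral.continuous_parametric_intervalIntegral_of_continuous
          (f := fun t' θ => P ((t' - t) * (1 - θ)) (t + (t' - t) * θ)) ?_ continuous_const
        exact hP.comp (f := fun q : ℝ × ℝ => ((q.1 - t) * (1 - q.2), t + (q.1 - t) * q.2)) (by fun_prop)
      have := hc.tendsto t
      simp only [sub_self, zero_mul, add_zero, intervalIntegral.integral_const, sub_zero, one_smul] at this
      exact this.mono_left nhdsWithin_le_nhds
    have h2 : Tendsto (fun t' => ∫ s in (0:ℝ)..t, (t' - t)⁻¹ * (P (t' - s) s - P (t - s) s))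
        (𝓝[>] t) (𝓝 (∫ s in (0:ℝ)..t, k (t - s) s)) := by
      obtain ⟨C, hC⟩ := hkb t
      have hne : ∀ᵐ s : ℝ, s ≠ t := by
        simp [MeasureTheory.ae_iff]
      refine intervalIntegral.tendsto_integral_filter_of_dominated_convergence
        (fun s => C * (t - s) ^ β) ?_ ?_ ?_ ?_
      · refine Eventually.of_forall fun t' => Continuous.aestronglyMeasurable ?_
        exact continuous_const.mul ((hPs t').sub (hPs t))
      · filter_upwards [self_mem_nhdsWithin] with t' ht'
        filter_upwards [hne] with s hst hs
        rw [uIoc_of_le ht.le] at hs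
        have ht'' : t < t' := ht'
        have hst' : s < t := lt_of_le_of_ne hs.2 hst
        have := Convex.norm_image_sub_le_of_norm_hasDerivWithin_le (f := fun r => P r s)
          (f' := fun r => k r s) (s := Icc (t - s) (t' - s)) (x := t - s) (y := t' - s)
          (C := C * (t - s) ^ β) (fun r hr => (hk r (by linarith [hr.1]) s).hasDerivWithinAt)
          (fun r hr => by
            have hr0 : 0 < r := by linarith [hr.1]
            refine (hC r hr0 s hs.2).trans ?_
            have hC0 : 0 ≤ C := by
              have := (abs_nonneg _).trans (hC r hr0 s hs.2)
              exact nonneg_of_mul_nonneg_left this (Real.rpow_pos_of_pos hr0 β)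
            exact mul_le_mul_of_nonneg_left
              (Real.rpow_le_rpow_of_nonpos (by linarith) hr.1 hβ0) hC0)
          (convex_Icc _ _) ⟨le_rfl, by linarith⟩ ⟨by linarith, le_rfl⟩
        rw [Real.norm_eq_abs, Real.norm_eq_abs,
          show t' - s - (t - s) = t' - t by ring, abs_of_pos (by linarith : 0 < t' - t)] at this
        rw [Real.norm_eq_abs, abs_mul, abs_of_pos (by simpa using ht'' : 0 < (t' - t)⁻¹),
          inv_mul_le_iff₀ (by linarith)]
        linarith
      · have := (intervalIntegral.intervalIntegrable_rpow' (a := t) (b := 0) hβ).comp_sub_left t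
        simp only [sub_self, sub_zero] at this
        exact this.const_mul C
      · filter_upwards [hne] with s hst hs
        rw [uIoc_of_le ht.le] at hs
        have hst' : s < t := lt_of_le_of_ne hs.2 hst
        have h3 : HasDerivAt (fun t' => P (t' - s) s) (k (t - s) s) t := by
          have := (hk (t - s) (by linarith) s).comp t ((hasDerivAt_id t).sub_const s)
          exact this.congr_deriv (by ring)
        have h4 := (hasDerivAt_iff_tendsto_slope.1 h3).mono_left
          (nhdsWithin_mono t (fun y (hy : t < y) => hy.ne'))
        refine h4.congr fun t' => ?_
        rw [slope_def_field]; ring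
    have h3 := h1.add h2
    refine h3.congr' ?_
    filter_upwards [self_mem_nhdsWithin] with t' ht'
    have ht'' : t < t' := ht'
    rw [slope_def_field]
    have e1 : ∫ θ in (0:ℝ)..1, P ((t' - t) * (1 - θ)) (t + (t' - t) * θ) =
        (t' - t)⁻¹ * ∫ s in t..t', P (t' - s) s := by
      have := intervalIntegral.integral_comp_add_mul (a := 0) (b := 1) (fun s => P (t' - s) s)
        (c := t' - t) (by linarith : t' - t ≠ 0) t
      simp only [mul_zero, add_zero, mul_one, add_sub_cancel, smul_eq_mul] at this
      rw [← this]
      congr 1; ext θ; congr 1; ring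
    have i1 : ∀ a b t, IntervalIntegrable (fun s => P (t - s) s) MeasureTheory.volume a b :=
      fun a b t => (hPs t).intervalIntegrable a b
    rw [e1, intervalIntegral.integral_const_mul, intervalIntegral.integral_sub (i1 _ _ _) (i1 _ _ _)]
    have := intervalIntegral.integral_add_adjacent_intervals (i1 0 t t') (i1 t t' t')
    rw [← this]
    ring
  have hRc : Continuous (fun t => P 0 t + ∫ s in (0:ℝ)..t, k (t - s) s) :=
    (hP.comp (f := fun t : ℝ => ((0:ℝ), t)) (by fun_prop)).add hR
  have hI : ∀ τ, HasDerivAt (fun τ => ∫ t in (0:ℝ)..τ, (P 0 t + ∫ s in (0:ℝ)..t, k (t - s) s))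
      (P 0 τ + ∫ s in (0:ℝ)..τ, k (τ - s) s) τ := fun τ =>
    intervalIntegral.integral_hasDerivAt_right (hRc.intervalIntegrable _ _)
      (hRc.stronglyMeasurableAtFilter _ _) hRc.continuousAt
  have hconst := constant_of_has_deriv_right_zero (a := t / 2) (b := t + 1)
    (f := fun τ => (∫ s in (0:ℝ)..τ, P (τ - s) s) -
      ∫ t in (0:ℝ)..τ, (P 0 t + ∫ s in (0:ℝ)..t, k (t - s) s))
    (hD.sub (continuous_iff_continuousAt.2 fun τ => (hI τ).continuousAt)).continuousOn
    (fun τ hτ => by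
      have := (hright τ (by linarith [hτ.1])).sub (hI τ).hasDerivWithinAt
      exact this.congr_deriv (by ring))
  refine ((hI t).add_const ((∫ s in (0:ℝ)..(t/2), P (t/2 - s) s) -
      ∫ t in (0:ℝ)..(t/2), (P 0 t + ∫ s in (0:ℝ)..t, k (t - s) s))).congr_of_eventuallyEq ?_
  filter_upwards [Icc_mem_nhds (show t / 2 < t by linarith) (show t < t + 1 by linarith)] with τ hτ
  have := hconst τ hτ
  linarith

end

section
/-- Gaussian-type averages of a source. -/
def JJ (W : ℝ → ℝ) (F : ℝ → ℝ → ℝ) (σ s x : ℝ) : ℝ := ∫ z, F s (x + σ * z) * W z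

/-- bounded continuous sources, locally uniformly Hölder in space -/
structure HSrc (B α : ℝ) (F : ℝ → ℝ → ℝ) : Prop where
  cont : Continuous (fun q : ℝ × ℝ => F q.1 q.2)
  bd : ∀ s x, |F s x| ≤ B
  hold : ∀ T, ∃ C > 0, ∀ s ≤ T, ∀ x y, |F s x - F s y| ≤ C * |x - y| ^ α

theorem JJ_continuous {W : ℝ → ℝ} (hW : Wt W) {F : ℝ → ℝ → ℝ} {B : ℝ}
    (hF : Continuous (fun q : ℝ × ℝ => F q.1 q.2)) (hB : ∀ s x, |F s x| ≤ B) :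
    Continuous (fun q : ℝ × ℝ × ℝ => JJ W F q.1 q.2.1 q.2.2) := by
  unfold JJ
  refine MeasureTheory.continuous_of_dominated (bound := fun z => B * |W z|) ?_ ?_ ?_ ?_
  · intro q
    refine Continuous.aestronglyMeasurable ?_
    exact (hF.comp (f := fun z : ℝ => (q.2.1, q.2.2 + q.1 * z)) (by fun_prop)).mul hW.cont
  · intro q
    refine Eventually.of_forall fun z => ?_
    rw [Real.norm_eq_abs, abs_mul]
    exact mul_le_mul_of_nonneg_right (hB _ _) (abs_nonneg _)
  · exact hW.integrable.abs.const_mul B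
  · refine Eventually.of_forall fun z => ?_
    exact (hF.comp (f := fun q : ℝ × ℝ × ℝ => (q.2.1, q.2.2 + q.1 * z)) (by fun_prop)).mul
      continuous_const

theorem JJ_bound {W : ℝ → ℝ} (hW : Wt W) {F : ℝ → ℝ → ℝ} {B : ℝ} {s : ℝ}
    (hB : ∀ x, |F s x| ≤ B) (σ x : ℝ) : |JJ W F σ s x| ≤ B * ∫ z, |W z| := by
  unfold JJ
  rw [← MeasureTheory.integral_const_mul, ← Real.norm_eq_abs]
  refine MeasureTheory.norm_integral_le_of_norm_le (hW.integrable.abs.const_mul B)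
    (Eventually.of_forall fun z => ?_)
  rw [Real.norm_eq_abs, abs_mul]
  exact mul_le_mul_of_nonneg_right (hB _) (abs_nonneg _)

theorem JJ_zero {F : ℝ → ℝ → ℝ} (s x : ℝ) : JJ gam F 0 s x = F s x := by
  unfold JJ
  simp [MeasureTheory.integral_const_mul, gam_integral]

theorem JJ_gam_bound {F : ℝ → ℝ → ℝ} {B : ℝ} {s : ℝ}
    (hB : ∀ x, |F s x| ≤ B) (σ x : ℝ) : |JJ gam F σ s x| ≤ B := by
  have := JJ_bound wt_gam hB σ x
  have e : ∫ z, |gam z| = 1 := by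
    rw [← gam_integral]; congr 1; ext z; exact abs_of_pos (gam_pos z)
  rwa [e, mul_one] at this

theorem JJ_sub {W : ℝ → ℝ} (hW : Wt W) {F G : ℝ → ℝ → ℝ} {B B' : ℝ} {s : ℝ}
    (hF : Continuous (F s)) (hB : ∀ x, |F s x| ≤ B) (hG : Continuous (G s)) (hB' : ∀ x, |G s x| ≤ B')
    (σ x : ℝ) : JJ W F σ s x - JJ W G σ s x = JJ W (fun s x => F s x - G s x) σ s x := by
  unfold JJ
  rw [← MeasureTheory.integral_sub
    (hW.integrable_bdd (G := fun z => F s (x + σ * z)) (by fun_prop) (fun z => hB _))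
    (hW.integrable_bdd (G := fun z => G s (x + σ * z)) (by fun_prop) (fun z => hB' _))]
  congr 1; ext z; ring

theorem JJ_holder {F : ℝ → ℝ → ℝ} {B C α : ℝ} (hα : 0 < α) (hα1 : α ≤ 1) {s : ℝ}
    (hF : Continuous (F s)) (hB : ∀ x, |F s x| ≤ B) (hC : 0 < C)
    (hh : ∀ x y, |F s x - F s y| ≤ C * |x - y| ^ α) {σ : ℝ} (hσ : 0 ≤ σ) (x : ℝ) :
    |JJ gam2 F σ s x| ≤ C * σ ^ α * ∫ z, Real.exp |z| * |gam2 z| := by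
  have e : JJ gam2 F σ s x = ∫ z, (F s (x + σ * z) - F s x) * gam2 z := by
    have h1 : ∫ z, F s x * gam2 z = 0 := by
      rw [MeasureTheory.integral_const_mul, gam2_integral, mul_zero]
    rw [← sub_zero (JJ gam2 F σ s x), ← h1]
    unfold JJ
    rw [← MeasureTheory.integral_sub
      (wt_gam2.integrable_bdd (G := fun z => F s (x + σ * z)) (by fun_prop) (fun z => hB _))
      (wt_gam2.integrable.const_mul _)]
    congr 1; ext z; ring
  rw [e, ← MeasureTheory.integral_const_mul, ← Real.norm_eq_abs]
  have hi : MeasureTheory.Integrable (fun z => Real.exp |z| * |gam2 z|) := by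
    have := (wt_gam2.integrable_mul (G := fun z => Real.exp |z|) (by fun_prop) (A := 0) (B := 1)
      (fun z => by simp [abs_of_pos (Real.exp_pos _)])).abs
    refine this.congr (Eventually.of_forall fun z => ?_)
    simp only
    rw [abs_mul, abs_of_pos (Real.exp_pos _)]
  refine MeasureTheory.norm_integral_le_of_norm_le (hi.const_mul _)
    (Eventually.of_forall fun z => ?_)
  rw [Real.norm_eq_abs, abs_mul]
  have h1 := hh (x + σ * z) x
  rw [add_sub_cancel_left, abs_mul, abs_of_nonneg hσ, Real.mul_rpow hσ (abs_nonneg z)] at h1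
  have h2 : |z| ^ α ≤ Real.exp |z| := by
    have h3 : |z| ^ α ≤ (1 + |z|) ^ α :=
      Real.rpow_le_rpow (abs_nonneg z) (by linarith) hα.le
    have h4 : (1 + |z|) ^ α ≤ (1 + |z|) ^ (1:ℝ) :=
      Real.rpow_le_rpow_of_exponent_le (by linarith [abs_nonneg z]) hα1
    rw [Real.rpow_one] at h4
    linarith [Real.add_one_le_exp |z|]
  calc |F s (x + σ * z) - F s x| * |gam2 z| ≤ (C * (σ ^ α * Real.exp |z|)) * |gam2 z| := by
        refine mul_le_mul_of_nonneg_right (h1.trans ?_) (abs_nonneg _)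
        have := Real.rpow_nonneg hσ α
        gcongr
    _ = _ := by ring

/-- second space derivative of the heat semigroup -/
def K2 (d : ℝ) (F : ℝ → ℝ → ℝ) (x r s : ℝ) : ℝ := (2 * d * r)⁻¹ * JJ gam2 F √(2 * d * r) s x
/-- first space derivative of the heat semigroup -/
def K1 (d : ℝ) (F : ℝ → ℝ → ℝ) (x r s : ℝ) : ℝ := (√(2 * d * r))⁻¹ * JJ gam1 F √(2 * d * r) s x

theorem K2_nonpos {d : ℝ} (hd : 0 < d) (F : ℝ → ℝ → ℝ) (x : ℝ) {r : ℝ} (hr : r ≤ 0) (s : ℝ) :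
    K2 d F x r s = 0 := by
  unfold K2 JJ
  rw [Real.sqrt_eq_zero_of_nonpos (by nlinarith)]
  simp [MeasureTheory.integral_const_mul, gam2_integral]

theorem sqrt_cancel {d r : ℝ} (hd : 0 < d) (hr : 0 < r) :
    (√(2 * d * r))⁻¹ * (√(2 * d * r))⁻¹ = (2 * d * r)⁻¹ := by
  rw [← mul_inv, Real.mul_self_sqrt (by positivity)]

theorem heat_dx {d B : ℝ} (hd : 0 < d) {F : ℝ → ℝ → ℝ} {s : ℝ}
    (hF : Continuous (F s)) (hB : ∀ x, |F s x| ≤ B) {r : ℝ} (hr : 0 < r) (x : ℝ) :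
    HasDerivAt (fun x => JJ gam F √(2 * d * r) s x) (K1 d F x r s) x :=
  deriv_space wt_gam wt_gam1 gam_deriv hF hB (Real.sqrt_pos.2 (by positivity)) x

theorem heat_dxx {d B : ℝ} (hd : 0 < d) {F : ℝ → ℝ → ℝ} {s : ℝ}
    (hF : Continuous (F s)) (hB : ∀ x, |F s x| ≤ B) {r : ℝ} (hr : 0 < r) (x : ℝ) :
    HasDerivAt (fun x => K1 d F x r s) (K2 d F x r s) x := by
  have := (deriv_space wt_gam1 wt_gam2 gam1_deriv hF hB
    (Real.sqrt_pos.2 (by positivity : 0 < 2 * d * r)) x).const_mul (√(2 * d * r))⁻¹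
  refine this.congr_deriv ?_
  rw [← mul_assoc, sqrt_cancel hd hr]; rfl

theorem heat_dr {d B : ℝ} (hd : 0 < d) {F : ℝ → ℝ → ℝ} {s : ℝ}
    (hF : Continuous (F s)) (hB : ∀ x, |F s x| ≤ B) {r : ℝ} (hr : 0 < r) (x : ℝ) :
    HasDerivAt (fun r => JJ gam F √(2 * d * r) s x) (d * K2 d F x r s) r := by
  have h0 : 0 < 2 * d * r := by positivity
  have h1 := deriv_sigma hF hB (Real.sqrt_pos.2 h0) x
  have h2 : HasDerivAt (fun r => √(2 * d * r)) (d * (√(2 * d * r))⁻¹) r := by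
    have := ((hasDerivAt_id r).const_mul (2 * d)).sqrt (by simpa using h0.ne')
    simp only [id, mul_one] at this
    exact this.congr_deriv (by field_simp)
  have := h1.comp r h2
  refine this.congr_deriv ?_
  unfold K2 JJ
  rw [← sqrt_cancel hd hr]; ring

theorem K1_bound {d B : ℝ} (hd : 0 < d) {F : ℝ → ℝ → ℝ} {s : ℝ} (hB : ∀ x, |F s x| ≤ B)
    {r : ℝ} (hr : 0 < r) (x : ℝ) :
    |K1 d F x r s| ≤ ((2 * d) ^ (-(1/2) : ℝ) * (B * ∫ z, |gam1 z|)) * r ^ (-(1/2) : ℝ) := by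
  unfold K1
  have h0 : 0 < √(2 * d * r) := Real.sqrt_pos.2 (by positivity)
  rw [abs_mul, abs_of_pos (inv_pos.2 h0)]
  have e : (√(2 * d * r))⁻¹ = (2 * d) ^ (-(1/2) : ℝ) * r ^ (-(1/2) : ℝ) := by
    rw [Real.sqrt_eq_rpow, ← Real.rpow_neg (by positivity), Real.mul_rpow (by positivity) hr.le]
  have := mul_le_mul_of_nonneg_left (JJ_bound wt_gam1 hB √(2 * d * r) x) (inv_pos.2 h0).le
  refine this.trans_eq ?_
  rw [e]; ring

theorem K2_bound {d B α : ℝ} (hd : 0 < d) (hα : 0 < α) (hα1 : α ≤ 1) {F : ℝ → ℝ → ℝ} (hF : HSrc B α F)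
    (T : ℝ) : ∃ C, 0 ≤ C ∧ ∀ x, ∀ r > 0, ∀ s ≤ T, |K2 d F x r s| ≤ C * r ^ (α / 2 - 1) := by
  obtain ⟨C, hC, hh⟩ := hF.hold T
  have hI : 0 ≤ ∫ z, Real.exp |z| * |gam2 z| :=
    MeasureTheory.integral_nonneg fun z => by positivity
  refine ⟨(2 * d) ^ (α / 2 - 1) * (C * ∫ z, Real.exp |z| * |gam2 z|), by positivity, fun x r hr s hs => ?_⟩
  have h0 : 0 < 2 * d * r := by positivity
  have h1 := JJ_holder hα hα1 (hF.cont.comp (f := fun y : ℝ => (s, y)) (by fun_prop)) (hF.bd s) hC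
    (hh s hs) (Real.sqrt_nonneg (2 * d * r)) x
  unfold K2
  rw [abs_mul, abs_of_pos (inv_pos.2 h0)]
  have e : (2 * d * r)⁻¹ * (√(2 * d * r)) ^ α = (2 * d) ^ (α / 2 - 1) * r ^ (α / 2 - 1) := by
    rw [← Real.mul_rpow (by positivity) hr.le, Real.sqrt_eq_rpow, ← Real.rpow_mul h0.le,
      ← Real.rpow_neg_one, ← Real.rpow_add h0]
    congr 1; ring
  calc (2 * d * r)⁻¹ * |JJ gam2 F √(2 * d * r) s x|
      ≤ (2 * d * r)⁻¹ * (C * √(2 * d * r) ^ α * ∫ z, Real.exp |z| * |gam2 z|) :=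
        mul_le_mul_of_nonneg_left h1 (inv_pos.2 h0).le
    _ = ((2 * d * r)⁻¹ * √(2 * d * r) ^ α) * (C * ∫ z, Real.exp |z| * |gam2 z|) := by ring
    _ = _ := by rw [e]; ring

section duh
variable {d B α : ℝ} {F : ℝ → ℝ → ℝ}

theorem P_cont (hF : Continuous (fun q : ℝ × ℝ => F q.1 q.2)) (hB : ∀ s x, |F s x| ≤ B) :
    Continuous (fun q : ℝ × ℝ × ℝ => JJ gam F √(2 * d * q.1) q.2.1 q.2.2) :=
  (JJ_continuous wt_gam hF hB).comp (f := fun q : ℝ × ℝ × ℝ => (√(2 * d * q.1), q.2.1, q.2.2))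
    (by fun_prop)

theorem K2_meas (hF : Continuous (fun q : ℝ × ℝ => F q.1 q.2)) (hB : ∀ s x, |F s x| ≤ B) (t x : ℝ) :
    Measurable (fun r => K2 d F x r (t - r)) := by
  unfold K2
  refine Measurable.mul (by fun_prop) (Continuous.measurable ?_)
  exact (JJ_continuous wt_gam2 hF hB).comp (f := fun r : ℝ => (√(2 * d * r), t - r, x)) (by fun_prop)

theorem K1_meas (hF : Continuous (fun q : ℝ × ℝ => F q.1 q.2)) (hB : ∀ s x, |F s x| ≤ B) (t x : ℝ) :
    Measurable (fun r => K1 d F x r (t - r)) := by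
  unfold K1
  refine Measurable.mul (by fun_prop) (Continuous.measurable ?_)
  exact (JJ_continuous wt_gam1 hF hB).comp (f := fun r : ℝ => (√(2 * d * r), t - r, x)) (by fun_prop)

theorem duh_dx (hd : 0 < d) (hF : Continuous (fun q : ℝ × ℝ => F q.1 q.2)) (hB : ∀ s x, |F s x| ≤ B)
    {t : ℝ} (ht : 0 ≤ t) (x : ℝ) :
    IntervalIntegrable (fun r => K1 d F x r (t - r)) MeasureTheory.volume 0 t ∧
    HasDerivAt (fun x => ∫ r in (0:ℝ)..t, JJ gam F √(2 * d * r) (t - r) x)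
      (∫ r in (0:ℝ)..t, K1 d F x r (t - r)) x := by
  have hFs : ∀ s, Continuous (F s) := fun s => hF.comp (f := fun y : ℝ => (s, y)) (by fun_prop)
  refine intervalIntegral.hasDerivAt_integral_of_dominated_loc_of_deriv_le
    (s := univ) (bound := fun r => ((2 * d) ^ (-(1/2) : ℝ) * (B * ∫ z, |gam1 z|)) * r ^ (-(1/2) : ℝ))
    (F' := fun x r => K1 d F x r (t - r))
    univ_mem ?_ ?_ ?_ ?_ ?_ ?_
  · refine Eventually.of_forall fun x => Continuous.aestronglyMeasurable ?_
    exact (P_cont hF hB).comp (f := fun r : ℝ => (r, t - r, x)) (by fun_prop)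
  · refine Continuous.intervalIntegrable ?_ _ _
    exact (P_cont hF hB).comp (f := fun r : ℝ => (r, t - r, x)) (by fun_prop)
  · exact (K1_meas hF hB t x).aestronglyMeasurable
  · refine Eventually.of_forall fun r hr y _ => ?_
    rw [uIoc_of_le ht] at hr
    exact K1_bound hd (hB _) hr.1 y
  · exact (intervalIntegral.intervalIntegrable_rpow' (by norm_num)).const_mul _
  · refine Eventually.of_forall fun r hr y _ => ?_
    rw [uIoc_of_le ht] at hr
    exact heat_dx hd (hFs _) (hB _) hr.1 y

theorem duh_dxx (hd : 0 < d) (hα : 0 < α) (hα1 : α ≤ 1) (hF : HSrc B α F) {t : ℝ} (ht : 0 ≤ t) (x : ℝ) :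
    HasDerivAt (fun x => ∫ r in (0:ℝ)..t, K1 d F x r (t - r))
      (∫ r in (0:ℝ)..t, K2 d F x r (t - r)) x := by
  have hFs : ∀ s, Continuous (F s) := fun s => hF.cont.comp (f := fun y : ℝ => (s, y)) (by fun_prop)
  obtain ⟨C, hC0, hC⟩ := K2_bound hd hα hα1 hF t
  refine (intervalIntegral.hasDerivAt_integral_of_dominated_loc_of_deriv_le
    (s := univ) (bound := fun r => C * r ^ (α / 2 - 1))
    (F' := fun x r => K2 d F x r (t - r))
    univ_mem ?_ ?_ ?_ ?_ ?_ ?_).2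
  · exact Eventually.of_forall fun x => (K1_meas hF.cont hF.bd t x).aestronglyMeasurable
  · exact (duh_dx hd hF.cont hF.bd ht x).1
  · exact (K2_meas hF.cont hF.bd t x).aestronglyMeasurable
  · refine Eventually.of_forall fun r hr y _ => ?_
    rw [uIoc_of_le ht] at hr
    exact hC y r hr.1 _ (by linarith [hr.1])
  · exact (intervalIntegral.intervalIntegrable_rpow' (by linarith)).const_mul _
  · refine Eventually.of_forall fun r hr y _ => ?_
    rw [uIoc_of_le ht] at hr
    exact heat_dxx hd (hFs _) (hF.bd _) hr.1 y

theorem duh_dxx_cont (hd : 0 < d) (hα : 0 < α) (hα1 : α ≤ 1) (hF : HSrc B α F) (x : ℝ) :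
    Continuous (fun t => ∫ r in (0:ℝ)..t, K2 d F x r (t - r)) := by
  refine continuous_iff_continuousAt.2 fun t => ?_
  obtain ⟨C, hC0, hC⟩ := K2_bound hd hα hα1 hF (|t| + 2 + (|t| + 2))
  have key := intervalIntegral.continuousAt_parametric_primitive_of_dominated
    (μ := MeasureTheory.volume) (F := fun t r => K2 d F x r (t - r)) (x₀ := t) (a₀ := 0) (b₀ := t)
    (fun r => |C * r ^ (α / 2 - 1)|) (-(|t| + 1)) (|t| + 1)
    (fun t => (K2_meas hF.cont hF.bd t x).aestronglyMeasurable) ?_ ?_ ?_ ?_ ?_ ?_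
  · exact ContinuousAt.comp (f := fun t : ℝ => (t, t))
      (g := fun q : ℝ × ℝ => ∫ r in (0:ℝ)..q.2, K2 d F x r (q.1 - r)) key (by fun_prop)
  · filter_upwards [Metric.ball_mem_nhds t one_pos] with t' ht'
    rw [MeasureTheory.ae_restrict_iff' measurableSet_uIoc]
    refine Eventually.of_forall fun r hr => ?_
    rw [uIoc_of_le (by linarith [abs_nonneg t])] at hr
    rcases le_or_gt r 0 with h | h
    · rw [K2_nonpos hd F x h, norm_zero]; exact abs_nonneg _
    · refine le_trans (hC x r h _ ?_) (le_abs_self _)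
      rw [Metric.mem_ball, Real.dist_eq] at ht'
      linarith [(abs_lt.1 ht').2, le_abs_self t, abs_nonneg t]
  · exact ((intervalIntegral.intervalIntegrable_rpow' (by linarith)).const_mul _).abs
  · refine Eventually.of_forall fun r => Continuous.continuousAt ?_
    unfold K2
    refine continuous_const.mul ?_
    exact (JJ_continuous wt_gam2 hF.cont hF.bd).comp (f := fun t : ℝ => (√(2 * d * r), t - r, x))
      (by fun_prop)
  · exact ⟨by linarith [abs_nonneg t], by linarith [abs_nonneg t]⟩
  · exact ⟨by linarith [neg_abs_le t], by linarith [le_abs_self t]⟩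
  · simp

theorem duh_pd (hd : 0 < d) (hα : 0 < α) (hα1 : α ≤ 1) (hF : HSrc B α F) {t : ℝ} (ht : 0 < t) (x : ℝ) :
    PD (fun t x => ∫ r in (0:ℝ)..t, JJ gam F √(2 * d * r) (t - r) x) t x
      (∫ r in (0:ℝ)..t, K2 d F x r (t - r)) (d * (∫ r in (0:ℝ)..t, K2 d F x r (t - r)) + F t x) := by
  have hFs : ∀ s, Continuous (F s) := fun s => hF.cont.comp (f := fun y : ℝ => (s, y)) (by fun_prop)
  refine ⟨⟨_, Eventually.of_forall fun y => (duh_dx hd hF.cont hF.bd ht.le y).2,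
    duh_dxx hd hα hα1 hF ht.le x⟩, ?_⟩
  have e1 : ∀ t, ∫ s in (0:ℝ)..t, d * K2 d F x (t - s) s = d * ∫ r in (0:ℝ)..t, K2 d F x r (t - r) := by
    intro t
    have := intervalIntegral.integral_comp_sub_left (a := 0) (b := t) (fun r => K2 d F x r (t - r)) t
    simp only [sub_sub_cancel, sub_self, sub_zero] at this
    rw [intervalIntegral.integral_const_mul, this]
  have e2 : ∀ t, ∫ s in (0:ℝ)..t, JJ gam F √(2 * d * (t - s)) s x =
      ∫ r in (0:ℝ)..t, JJ gam F √(2 * d * r) (t - r) x := by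
    intro t
    have := intervalIntegral.integral_comp_sub_left (a := 0) (b := t)
      (fun r => JJ gam F √(2 * d * r) (t - r) x) t
    simp only [sub_sub_cancel, sub_self, sub_zero] at this
    exact this
  have key := duhamel_time (P := fun r s => JJ gam F √(2 * d * r) s x) (k := fun r s => d * K2 d F x r s)
    (β := α / 2 - 1) (by linarith) (by linarith)
    ((P_cont hF.cont hF.bd).comp (f := fun q : ℝ × ℝ => (q.1, q.2, x)) (by fun_prop))
    (fun r hr s => heat_dr hd (hFs s) (hF.bd s) hr x)
    (fun T => by
      obtain ⟨C, hC0, hC⟩ := K2_bound hd hα hα1 hF T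
      refine ⟨d * C, fun r hr s hs => ?_⟩
      rw [abs_mul, abs_of_pos hd, mul_assoc]
      exact mul_le_mul_of_nonneg_left (hC x r hr s hs) hd.le)
    (by simp only [e1]; exact continuous_const.mul (duh_dxx_cont hd hα hα1 hF x)) ht
  simp only [e1, e2] at key
  refine key.congr_deriv ?_
  simp [JJ_zero, add_comm]

end duh

end

section
/-- truncated nonlinearity -/
structure GN (K B : ℝ) (G : ℝ → ℝ → ℝ → ℝ) : Prop where
  cont : Continuous (fun q : ℝ × ℝ × ℝ => G q.1 q.2.1 q.2.2)
  bd : ∀ t x u, |G t x u| ≤ B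
  lip : ∀ t x u v, |G t x u - G t x v| ≤ K * |u - v|

/-- Duhamel operator -/
def duh (d : ℝ) (F : ℝ → ℝ → ℝ) (t x : ℝ) : ℝ := ∫ r in (0:ℝ)..t, JJ gam F √(2 * d * r) (t - r) x

theorem duh_continuous {d B : ℝ} {F : ℝ → ℝ → ℝ}
    (hF : Continuous (fun q : ℝ × ℝ => F q.1 q.2)) (hB : ∀ s x, |F s x| ≤ B) :
    Continuous (fun q : ℝ × ℝ => duh d F q.1 q.2) := by
  unfold duh
  refine intervalIntegral.continuous_parametric_intervalIntegral_of_continuous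
    (f := fun (q : ℝ × ℝ) r => JJ gam F √(2 * d * r) (q.1 - r) q.2) ?_ continuous_fst
  exact (P_cont hF hB).comp (f := fun q : (ℝ × ℝ) × ℝ => (q.2, q.1.1 - q.2, q.1.2)) (by fun_prop)

theorem duh_bound {d B : ℝ} {F : ℝ → ℝ → ℝ} (hB : ∀ s x, |F s x| ≤ B) {t : ℝ} (ht : 0 ≤ t) (x : ℝ) :
    |duh d F t x| ≤ B * t := by
  have := intervalIntegral.norm_integral_le_of_norm_le_const (a := 0) (b := t) (C := B)
    (f := fun r => JJ gam F √(2 * d * r) (t - r) x) (fun r _ => JJ_gam_bound (hB _) _ x)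
  rwa [Real.norm_eq_abs, sub_zero, abs_of_nonneg ht] at this

theorem exp_conv {lam : ℝ} (hl : 0 < lam) (t : ℝ) :
    ∫ r in (0:ℝ)..t, Real.exp (lam * (t - r)) = (Real.exp (lam * t) - 1) / lam := by
  have := intervalIntegral.integral_eq_sub_of_hasDerivAt (a := 0) (b := t)
    (f := fun r => -(Real.exp (lam * (t - r)) / lam)) (f' := fun r => Real.exp (lam * (t - r))) ?_ ?_
  · rw [this]; simp; ring
  · intro r _
    have h1 : HasDerivAt (fun r => lam * (t - r)) (-lam) r :=
      (((hasDerivAt_id r).const_sub t).const_mul lam).congr_deriv (by ring)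
    exact ((h1.exp.div_const lam).neg).congr_deriv (by field_simp)
  · exact Continuous.intervalIntegrable (by fun_prop) _ _

theorem duh_diff {d B lam K D : ℝ} (hl : 0 < lam) (hK : 0 ≤ K) (hD : 0 ≤ D) {F H : ℝ → ℝ → ℝ}
    (hF : Continuous (fun q : ℝ × ℝ => F q.1 q.2)) (hB : ∀ s x, |F s x| ≤ B)
    (hH : Continuous (fun q : ℝ × ℝ => H q.1 q.2)) (hB' : ∀ s x, |H s x| ≤ B)
    (h : ∀ s ≥ 0, ∀ x, |F s x - H s x| ≤ K * (Real.exp (lam * s) * D)) {t : ℝ} (ht : 0 ≤ t) (x : ℝ) :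
    |duh d F t x - duh d H t x| ≤ K * D * (Real.exp (lam * t) / lam) := by
  have hFs : ∀ s, Continuous (F s) := fun s => hF.comp (f := fun y : ℝ => (s, y)) (by fun_prop)
  have hHs : ∀ s, Continuous (H s) := fun s => hH.comp (f := fun y : ℝ => (s, y)) (by fun_prop)
  have i1 : IntervalIntegrable (fun r => JJ gam F √(2 * d * r) (t - r) x) MeasureTheory.volume 0 t :=
    Continuous.intervalIntegrable
      ((P_cont hF hB).comp (f := fun r : ℝ => (r, t - r, x)) (by fun_prop)) _ _
  have i2 : IntervalIntegrable (fun r => JJ gam H √(2 * d * r) (t - r) x) MeasureTheory.volume 0 t :=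
    Continuous.intervalIntegrable
      ((P_cont hH hB').comp (f := fun r : ℝ => (r, t - r, x)) (by fun_prop)) _ _
  unfold duh
  rw [← intervalIntegral.integral_sub i1 i2, ← Real.norm_eq_abs]
  have h1 : ‖∫ r in (0:ℝ)..t, (JJ gam F √(2 * d * r) (t - r) x - JJ gam H √(2 * d * r) (t - r) x)‖
      ≤ ∫ r in (0:ℝ)..t, K * D * Real.exp (lam * (t - r)) := by
    refine intervalIntegral.norm_integral_le_of_norm_le ht (Eventually.of_forall fun r hr => ?_)
      (Continuous.intervalIntegrable (by fun_prop) _ _)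
    rw [JJ_sub wt_gam (hFs _) (hB _) (hHs _) (hB' _)]
    exact JJ_gam_bound (fun y => (h (t - r) (by linarith [hr.2]) y).trans_eq (by ring)) _ _
  refine h1.trans ?_
  rw [intervalIntegral.integral_const_mul, exp_conv hl]
  refine mul_le_mul_of_nonneg_left ?_ (by positivity)
  gcongr; linarith

theorem mild_exists {d K B A : ℝ} {G : ℝ → ℝ → ℝ → ℝ} (hG : GN K B G) (hK : 0 < K)
    {φ : ℝ → ℝ} (hφ : Continuous φ) (hA : ∀ x, |φ x| ≤ A) :
    ∃ v : ℝ → ℝ → ℝ, Continuous (fun q : ℝ × ℝ => v q.1 q.2) ∧ (∀ t x, v t x = v (max t 0) x) ∧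
      (∀ t ≥ 0, ∀ x, v t x = JJ gam (fun _ => φ) √(2 * d * t) 0 x + duh d (fun s y => G s y (v s y)) t x) := by
  have hB0 : 0 ≤ B := (abs_nonneg _).trans (hG.bd 0 0 0)
  have hA0 : 0 ≤ A := (abs_nonneg _).trans (hA 0)
  set lam := 2 * K with hlam
  have hl : 0 < lam := by positivity
  let src : BoundedContinuousFunction (ℝ × ℝ) ℝ → ℝ → ℝ → ℝ :=
    fun V s x => G s x (Real.exp (lam * max s 0) * V (s, x))
  have srcc : ∀ V, Continuous (fun q : ℝ × ℝ => src V q.1 q.2) := fun V =>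
    hG.cont.comp (f := fun q : ℝ × ℝ => (q.1, q.2, Real.exp (lam * max q.1 0) * V (q.1, q.2)))
      (by fun_prop)
  have srcb : ∀ V s x, |src V s x| ≤ B := fun V s x => hG.bd _ _ _
  let psi : BoundedContinuousFunction (ℝ × ℝ) ℝ → ℝ × ℝ → ℝ := fun V q =>
    Real.exp (-(lam * max q.1 0)) *
      (JJ gam (fun _ => φ) √(2 * d * max q.1 0) 0 q.2 + duh d (src V) (max q.1 0) q.2)
  have hφ' : Continuous (fun q : ℝ × ℝ => (fun _ : ℝ => φ) q.1 q.2) := hφ.comp continuous_snd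
  have psic : ∀ V, Continuous (psi V) := by
    intro V
    refine Continuous.mul (by fun_prop) (Continuous.add ?_ ?_)
    · exact (P_cont hφ' (fun _ => hA)).comp (f := fun q : ℝ × ℝ => (max q.1 0, 0, q.2)) (by fun_prop)
    · exact (duh_continuous (srcc V) (srcb V)).comp (f := fun q : ℝ × ℝ => (max q.1 0, q.2)) (by fun_prop)
  have psib : ∀ V q, ‖psi V q‖ ≤ A + B / lam := by
    intro V q
    have ht : 0 ≤ max q.1 0 := le_max_right _ _
    obtain ⟨t, e⟩ : ∃ t, t = max q.1 0 := ⟨_, rfl⟩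
    have h1 := JJ_gam_bound (F := fun _ => φ) (s := 0) hA √(2 * d * t) q.2
    simp only [psi]
    rw [← e] at ht ⊢
    have h2 := duh_bound (d := d) (srcb V) ht q.2
    rw [Real.norm_eq_abs, abs_mul, Real.abs_exp, Real.exp_neg, inv_mul_le_iff₀ (Real.exp_pos _)]
    refine (abs_add_le _ _).trans ?_
    have h3 := Real.add_one_le_exp (lam * t)
    have h4 : (1:ℝ) ≤ Real.exp (lam * t) := by nlinarith
    have h5 : B * t ≤ Real.exp (lam * t) * (B / lam) := by
      rw [mul_div_assoc', le_div_iff₀ hl]; nlinarith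
    nlinarith
  let Psi : BoundedContinuousFunction (ℝ × ℝ) ℝ → BoundedContinuousFunction (ℝ × ℝ) ℝ := fun V =>
    BoundedContinuousFunction.ofNormedAddCommGroup (psi V) (psic V) _ (psib V)
  have hc : ContractingWith (1/2) Psi := by
    refine ⟨by rw [← NNReal.coe_lt_coe]; norm_num, LipschitzWith.of_dist_le_mul fun V W => ?_⟩
    refine (BoundedContinuousFunction.dist_le (by positivity)).2 fun q => ?_
    have ht : 0 ≤ max q.1 0 := le_max_right _ _
    obtain ⟨t, e⟩ : ∃ t, t = max q.1 0 := ⟨_, rfl⟩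
    change dist (psi V q) (psi W q) ≤ _
    simp only [psi]
    rw [← e] at ht ⊢
    have h2 := duh_diff (d := d) (t := t) (D := dist V W) hl hK.le dist_nonneg (srcc V) (srcb V) (srcc W) (srcb W) (fun s hs x => by
      refine (hG.lip _ _ _ _).trans (mul_le_mul_of_nonneg_left ?_ hK.le)
      rw [max_eq_left hs, ← mul_sub, abs_mul, Real.abs_exp]
      have := BoundedContinuousFunction.dist_coe_le_dist (f := V) (g := W) (s, x)
      rw [Real.dist_eq] at this
      exact mul_le_mul_of_nonneg_left this (Real.exp_pos _).le) ht q.2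
    rw [Real.dist_eq, ← mul_sub, abs_mul, Real.abs_exp, add_sub_add_left_eq_sub, Real.exp_neg,
      inv_mul_le_iff₀ (Real.exp_pos _)]
    refine h2.trans_eq ?_
    rw [hlam]; push_cast
    field_simp
  obtain ⟨V, hV⟩ : ∃ V, Psi V = V := ⟨_, hc.fixedPoint_isFixedPt⟩
  have h1 : ∀ q, V q = psi V q := fun q =>
    (congrArg (fun W : BoundedContinuousFunction (ℝ × ℝ) ℝ => W q) hV).symm
  refine ⟨fun t x => Real.exp (lam * max t 0) * V (t, x), by fun_prop, fun t x => ?_, fun t ht x => ?_⟩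
  · have e : V (max t 0, x) = V (t, x) := by
      rw [h1, h1]; simp only [psi]; rw [max_eq_left (le_max_right t 0)]
    change Real.exp (lam * max t 0) * V (t, x) = Real.exp (lam * max (max t 0) 0) * V (max t 0, x)
    rw [e, max_eq_left (le_max_right t 0)]
  change Real.exp (lam * max t 0) * V (t, x) = _ + duh d (src V) t x
  rw [h1]
  simp only [psi]
  rw [max_eq_left ht, ← mul_assoc, ← Real.exp_add, add_neg_cancel, Real.exp_zero, one_mul]

end

section
theorem heat_lip {φ : ℝ → ℝ} {A Λ : ℝ} (hφ : Continuous φ) (hA : ∀ x, |φ x| ≤ A)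
    (hΛ : ∀ x y, |φ x - φ y| ≤ Λ * |x - y|) (σ x y : ℝ) :
    |JJ gam (fun _ => φ) σ 0 x - JJ gam (fun _ => φ) σ 0 y| ≤ Λ * |x - y| := by
  have e : ∀ x, JJ gam (fun _ => φ) σ 0 x = JJ gam (fun _ z => φ (x + z)) σ 0 0 := by
    intro x; unfold JJ; simp
  rw [e x, e y, JJ_sub wt_gam (B := A) (B' := A) (by fun_prop) (fun z => hA _) (by fun_prop) (fun z => hA _)]
  refine JJ_gam_bound (fun z => (hΛ _ _).trans_eq ?_) _ _
  congr 2; ring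

theorem duh_lip {d B : ℝ} (hd : 0 < d) {F : ℝ → ℝ → ℝ}
    (hF : Continuous (fun q : ℝ × ℝ => F q.1 q.2)) (hB : ∀ s x, |F s x| ≤ B) (T : ℝ) :
    ∃ C ≥ 0, ∀ t ∈ Icc 0 T, ∀ x y, |duh d F t x - duh d F t y| ≤ C * |x - y| := by
  have hB0 : 0 ≤ B := (abs_nonneg _).trans (hB 0 0)
  have hI : 0 ≤ ∫ z, |gam1 z| := MeasureTheory.integral_nonneg fun z => abs_nonneg _
  obtain ⟨c, hc⟩ : ∃ c, c = (2 * d) ^ (-(1/2) : ℝ) * (B * ∫ z, |gam1 z|) := ⟨_, rfl⟩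
  have hc0 : 0 ≤ c := by rw [hc]; positivity
  refine ⟨c * (2 * |T| ^ (1/2 : ℝ)), by positivity, fun t ht x y => ?_⟩
  have hb : ∀ x, ‖∫ r in (0:ℝ)..t, K1 d F x r (t - r)‖ ≤ c * (2 * |T| ^ (1/2 : ℝ)) := by
    intro x
    have h1 : ‖∫ r in (0:ℝ)..t, K1 d F x r (t - r)‖ ≤ ∫ r in (0:ℝ)..t, c * r ^ (-(1/2) : ℝ) := by
      refine intervalIntegral.norm_integral_le_of_norm_le ht.1 (Eventually.of_forall fun r hr => ?_)
        ((intervalIntegral.intervalIntegrable_rpow' (by norm_num)).const_mul _)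
      rw [hc]
      exact K1_bound hd (hB _) hr.1 x
    refine h1.trans ?_
    rw [intervalIntegral.integral_const_mul, integral_rpow (Or.inl (by norm_num))]
    refine mul_le_mul_of_nonneg_left ?_ hc0
    have e : (-(1/2) + 1 : ℝ) = 1/2 := by norm_num
    rw [e, Real.zero_rpow (by norm_num), sub_zero]
    have : t ^ (1/2 : ℝ) ≤ |T| ^ (1/2 : ℝ) :=
      Real.rpow_le_rpow ht.1 (ht.2.trans (le_abs_self _)) (by norm_num)
    linarith
  have := convex_univ.norm_image_sub_le_of_norm_hasDerivWithin_le (f := fun x => duh d F t x)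
    (fun x _ => (duh_dx hd hF hB ht.1 x).2.hasDerivWithinAt) (fun x _ => hb x) (mem_univ y) (mem_univ x)
  simpa only [Real.norm_eq_abs] using this

theorem classical_exists {d K B A Λ α C₀ : ℝ} (hd : 0 < d) {G : ℝ → ℝ → ℝ → ℝ} (hG : GN K B G) (hK : 0 < K)
    (hα : 0 < α) (hα1 : α ≤ 1) (hC₀ : 0 < C₀) (hGh : ∀ s x y u, |G s x u - G s y u| ≤ C₀ * |x - y| ^ α)
    {φ : ℝ → ℝ} (hφ : Continuous φ) (hA : ∀ x, |φ x| ≤ A) (hΛ0 : 0 ≤ Λ)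
    (hΛ : ∀ x y, |φ x - φ y| ≤ Λ * |x - y|) :
    ∃ v : ℝ → ℝ → ℝ, Continuous (fun q : ℝ × ℝ => v q.1 q.2) ∧ (∀ x, v 0 x = φ x) ∧
      (∀ T, ∃ C, ∀ t ∈ Icc 0 T, ∀ x, |v t x| ≤ C) ∧
      ∀ t > 0, ∀ x, ∃ b, PD v t x b (d * b + G t x (v t x)) := by
  obtain ⟨v, vc, vneg, hv⟩ := mild_exists (d := d) hG hK hφ hA
  have hB0 : 0 ≤ B := (abs_nonneg _).trans (hG.bd 0 0 0)
  have hFc : Continuous (fun q : ℝ × ℝ => (fun s y => G s y (v s y)) q.1 q.2) :=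
    hG.cont.comp (f := fun q : ℝ × ℝ => (q.1, q.2, v q.1 q.2)) (by fun_prop)
  have hFb : ∀ s x, |(fun s y => G s y (v s y)) s x| ≤ B := fun s x => hG.bd _ _ _
  have vlip : ∀ T, ∃ C ≥ 0, ∀ t ≤ T, ∀ x y, |v t x - v t y| ≤ C * |x - y| := by
    intro T
    obtain ⟨C, hC0, hC⟩ := duh_lip hd hFc hFb (max T 0)
    refine ⟨Λ + C, by positivity, fun t ht x y => ?_⟩
    have ht0 : 0 ≤ max t 0 := le_max_right _ _
    rw [vneg t x, vneg t y, hv _ ht0, hv _ ht0]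
    have h1 := heat_lip hφ hA hΛ √(2 * d * max t 0) x y
    have h2 := hC (max t 0) ⟨ht0, max_le_max ht le_rfl⟩ x y
    rw [add_sub_add_comm]
    refine (abs_add_le _ _).trans ?_
    linarith
  have hS : HSrc B α (fun s y => G s y (v s y)) := by
    refine ⟨hFc, hFb, fun T => ?_⟩
    obtain ⟨C, hC0, hC⟩ := vlip T
    refine ⟨C₀ + K * C + 2 * B, by positivity, fun s hs x y => ?_⟩
    have hp : 0 ≤ |x - y| ^ α := by positivity
    rcases le_or_gt |x - y| 1 with h | h
    · have h1 : |x - y| ≤ |x - y| ^ α := by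
        have := Real.rpow_le_rpow_of_exponent_ge' (abs_nonneg (x - y)) h hα.le hα1
        rwa [Real.rpow_one] at this
      have h2 := hGh s x y (v s x)
      have h3 := hG.lip s y (v s x) (v s y)
      have h4 := mul_le_mul_of_nonneg_left (hC s hs x y) hK.le
      have h5 : K * (C * |x - y|) ≤ K * C * |x - y| ^ α := by
        rw [← mul_assoc]; exact mul_le_mul_of_nonneg_left h1 (by positivity)
      have h6 := abs_sub_le (G s x (v s x)) (G s y (v s x)) (G s y (v s y))
      have h7 : 0 ≤ 2 * B * |x - y| ^ α := by positivity
      change |G s x (v s x) - G s y (v s y)| ≤ _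
      linarith
    · have h1 : 1 ≤ |x - y| ^ α := Real.one_le_rpow h.le hα.le
      have h2 := abs_sub (G s x (v s x)) (G s y (v s y))
      have h3 := hG.bd s x (v s x)
      have h4 := hG.bd s y (v s y)
      change |G s x (v s x) - G s y (v s y)| ≤ _
      have h5 : 2 * B ≤ 2 * B * |x - y| ^ α := le_mul_of_one_le_right (by positivity) h1
      have h7 : 0 ≤ (C₀ + K * C) * |x - y| ^ α := by positivity
      linarith
  refine ⟨v, vc, fun x => ?_, fun T => ⟨A + B * |T|, fun t ht x => ?_⟩, fun t ht x => ?_⟩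
  · rw [hv 0 le_rfl, mul_zero, Real.sqrt_zero, JJ_zero]; simp [duh]
  · rw [hv t ht.1]
    refine (abs_add_le _ _).trans (add_le_add (JJ_gam_bound (fun x => hA x) _ _) ((duh_bound hFb ht.1 x).trans ?_))
    exact mul_le_mul_of_nonneg_left (ht.2.trans (le_abs_self _)) hB0
  · have h1 := duh_pd hd hα hα1 hS ht x
    have h2 : PD (fun t x => JJ gam (fun _ => φ) √(2 * d * t) 0 x) t x (K2 d (fun _ => φ) x t 0)
        (d * K2 d (fun _ => φ) x t 0) :=
      ⟨⟨_, Eventually.of_forall fun y => heat_dx hd hφ hA ht y, heat_dxx hd hφ hA ht x⟩,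
        heat_dr hd hφ hA ht x⟩
    have h3 := (h2.add h1).congr (w := v) ?_
    · exact ⟨_, by convert h3 using 1; ring⟩
    · have : ∀ᶠ q : ℝ × ℝ in 𝓝 (t, x), 0 < q.1 :=
        continuous_fst.continuousAt.eventually (lt_mem_nhds ht)
      filter_upwards [this] with q hq
      exact hv _ hq.le _

end

section
theorem PD.solves {d : ℝ} {f : ℝ → ℝ → ℝ → ℝ} {v : ℝ → ℝ → ℝ}
    (h : ∀ t > 0, ∀ x, ∃ b, PD v t x b (d * b + f t x (v t x))) :
    SolvesPDE d f v {q : ℝ × ℝ | 0 < q.1} := by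
  intro q hq
  obtain ⟨b, ⟨φ', h1, h2⟩, h3⟩ := h q.1 hq q.2
  have e : deriv (v q.1) =ᶠ[𝓝 q.2] φ' := h1.mono fun y hy => hy.deriv
  have h4 := h2.congr_of_eventuallyEq e
  refine ⟨h1.self_of_nhds.differentiableAt, h4.differentiableAt, ?_⟩
  rw [h4.deriv]
  exact h3

theorem tent_lip {m : ℝ} (hm : 0 < m) (x y : ℝ) : |tent m x - tent m y| ≤ m / 4 * |x - y| := by
  unfold tent
  rw [← mul_sub, abs_mul, abs_of_pos (by positivity)]
  refine mul_le_mul_of_nonneg_left ?_ (by positivity)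
  have h1 := abs_max_sub_max_le_abs (1 - |x|) (1 - |y|) 0
  rw [max_comm 0, max_comm 0]
  refine h1.trans ?_
  rw [sub_sub_sub_cancel_left, abs_sub_comm x y]
  exact abs_abs_sub_abs_le _ _

theorem clamp_lip (M u v : ℝ) : |max 0 (min u M) - max 0 (min v M)| ≤ |u - v| := by
  rw [max_comm 0, max_comm 0]
  refine (abs_max_sub_max_le_abs _ _ _).trans ?_
  have := abs_min_sub_min_le_max u M v M
  simpa using this

theorem cauchy_exists {d ω L : ℝ} (hd : 0 < d) (hω : 0 < ω) (hL : 0 < L) {f : ℝ → ℝ → ℝ → ℝ}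
    (hf : BasicAssumptions ω L f) : ∀ m > 0, ∃ v, IsCauchySolution d f (tent m) v ∧ Cau d f (tent m) v := by
  intro m hm
  obtain ⟨M, hM, hneg⟩ := hf.neg_large
  obtain ⟨M1, hM1⟩ : ∃ M1, M1 = max M (m / 4) := ⟨_, rfl⟩
  have hM1M : M ≤ M1 := hM1 ▸ le_max_left _ _
  have hM1m : m / 4 ≤ M1 := hM1 ▸ le_max_right _ _
  have hM10 : 0 < M1 := hM.trans_le hM1M
  obtain ⟨K, hK, hlip, habs⟩ := (hf.flip hω hL).abs_le hM10
  obtain ⟨B, hB⟩ := hf.fbdd hω hL M1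
  obtain ⟨α, hα, hh⟩ := hf.holder
  obtain ⟨C₀, hC₀, hC⟩ := hh M1 hM10
  have c0 : ∀ u : ℝ, 0 ≤ max 0 (min u M1) := fun u => le_max_left _ _
  have c1 : ∀ u : ℝ, max 0 (min u M1) ≤ M1 := fun u => max_le hM10.le (min_le_right _ _)
  have hG : GN K B (fun t x u => f t x (max 0 (min u M1))) := by
    refine ⟨?_, fun t x u => hB _ _ _ (c0 u) (c1 u), fun t x u v => ?_⟩
    · exact hf.cont.comp_continuous (f := fun q : ℝ × ℝ × ℝ => (q.1, q.2.1, max 0 (min q.2.2 M1)))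
        (by fun_prop) (fun q => c0 _)
    · exact (hlip _ _ _ _ (c0 u) (c1 u) (c0 v) (c1 v)).trans
        (mul_le_mul_of_nonneg_left (clamp_lip _ _ _) hK.le)
  obtain ⟨v, vc, v0, vb, vpde⟩ := classical_exists hd hG hK hα.1 hα.2.le hC₀
    (fun s x y u => by
      have := hC s s x y _ (c0 u) (c1 u)
      rwa [sub_self, abs_zero, Real.zero_rpow (by have := hα.1; positivity), zero_add] at this)
    (tent_continuous m) (A := m / 4) (fun x => by rw [abs_of_nonneg (tent_nonneg hm x)]; exact tent_le hm x)
    (by positivity) (tent_lip hm)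
  have constPD : ∀ a t x : ℝ, PD (fun _ _ => a) t x 0 0 := fun a t x =>
    ⟨D2.const a x, hasDerivAt_const _ _⟩
  have vnn : ∀ t ≥ 0, ∀ x, 0 ≤ v t x := by
    intro t ht x
    obtain ⟨C, hCb⟩ := vb t
    have := max_principle_strip (d := d) (K := 0) (T := t) (C := C) (z := fun t x => 0 - v t x) hd.le
      (by fun_prop) (fun s hs y => by linarith [neg_abs_le (v s y), hCb s hs y])
      (fun y => by rw [v0]; linarith [tent_nonneg hm y])
      (fun s hs y hz => by
        obtain ⟨b, hb⟩ := vpde s hs.1 y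
        refine ⟨_, _, (constPD 0 s y).sub hb, ?_⟩
        rw [max_eq_left ((min_le_left _ _).trans (by linarith)), hf.zero]
        linarith) t ⟨ht, le_rfl⟩ x
    linarith
  have vle : ∀ t ≥ 0, ∀ x, v t x ≤ M1 := by
    intro t ht x
    obtain ⟨C, hCb⟩ := vb t
    have := max_principle_strip (d := d) (K := 0) (T := t) (C := C) (z := fun t x => v t x - M1) hd.le
      (by fun_prop) (fun s hs y => by linarith [le_abs_self (v s y), hCb s hs y])
      (fun y => by rw [v0]; linarith [tent_le hm y])
      (fun s hs y hz => by
        obtain ⟨b, hb⟩ := vpde s hs.1 y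
        refine ⟨_, _, hb.sub (constPD M1 s y), ?_⟩
        rw [min_eq_right (by linarith), max_eq_right hM10.le]
        linarith [hneg s y M1 hM1M]) t ⟨ht, le_rfl⟩ x
    linarith
  have vpde' : ∀ t > 0, ∀ x, ∃ b, PD v t x b (d * b + f t x (v t x)) := by
    intro t ht x
    obtain ⟨b, hb⟩ := vpde t ht x
    rw [min_eq_left (vle t ht.le x), max_eq_right (vnn t ht.le x)] at hb
    exact ⟨b, hb⟩
  have vexp : ∀ ς : ℝ, (ς = 1 ∨ ς = -1) → ∀ t ≥ 0, ∀ x,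
      v t x ≤ m / 4 * Real.exp (1 + ς * x + (d + K) * t) := by
    intro ς hς t ht x
    have hς2 : ς * ς = 1 := by rcases hς with rfl | rfl <;> norm_num
    have := max_principle_strip (d := d) (K := K) (T := t) (C := M1)
      (z := fun t x => v t x - m / 4 * Real.exp (1 + ς * x + (d + K) * t)) hd.le
      (by fun_prop)
      (fun s hs y => by
        have : 0 ≤ m / 4 * Real.exp (1 + ς * y + (d + K) * s) := by positivity
        linarith [vle s hs.1 y])
      (fun y => by
        rw [v0, mul_zero, add_zero]
        rcases le_total 1 |y| with h | h
        · rw [tent_zero h]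
          have : 0 ≤ m / 4 * Real.exp (1 + ς * y) := by positivity
          linarith
        · have h1 : 0 ≤ 1 + ς * y := by
            rcases hς with rfl | rfl
            · linarith [neg_abs_le y]
            · linarith [le_abs_self y]
          have h2 := Real.one_le_exp h1
          have h3 := tent_le hm y
          nlinarith)
      (fun s hs y hz => by
        obtain ⟨b, hb⟩ := vpde' s hs.1 y
        have hw : PD (fun t x => m / 4 * Real.exp (1 + ς * x + (d + K) * t)) s y
            (m / 4 * Real.exp (1 + ς * y + (d + K) * s))
            ((d + K) * (m / 4 * Real.exp (1 + ς * y + (d + K) * s))) := by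
          have l : ∀ y, HasDerivAt (fun x => 1 + ς * x + (d + K) * s) ς y := fun y =>
            ((((hasDerivAt_id y).const_mul ς).const_add 1).add_const _).congr_deriv (by ring)
          refine ⟨D2.of_hasDerivAt
            (φ' := fun x => ς * (m / 4 * Real.exp (1 + ς * x + (d + K) * s))) (fun y => ?_) ?_, ?_⟩
          · exact ((l y).exp.const_mul (m / 4)).congr_deriv (by ring)
          · refine (((l y).exp.const_mul (m / 4)).const_mul ς).congr_deriv ?_
            linear_combination (m / 4 * Real.exp (1 + ς * y + (d + K) * s)) * hς2
          · have l2 : HasDerivAt (fun t => 1 + ς * y + (d + K) * t) (d + K) s :=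
              (((hasDerivAt_id s).const_mul (d + K)).const_add _).congr_deriv (by ring)
            exact (l2.exp.const_mul (m / 4)).congr_deriv (by ring)
        refine ⟨_, _, hb.sub hw, ?_⟩
        have := (le_abs_self _).trans (habs s y _ (vnn s hs.1.le y) (vle s hs.1.le y))
        linarith) t ⟨ht, le_rfl⟩ x
    linarith
  refine ⟨v, ⟨v0, vc.continuousOn, PD.solves vpde', M1, fun t ht x => ?_⟩,
    ⟨vc.continuousOn, v0, vnn, ⟨M1, hM10, vle⟩, vpde', fun T ε hε => ?_⟩⟩
  · rw [abs_of_nonneg (vnn t ht x)]; exact vle t ht x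
  · obtain ⟨D, hD⟩ : ∃ D, D = m / 4 * Real.exp (1 + (d + K) * T) := ⟨_, rfl⟩
    have hD0 : 0 < D := by rw [hD]; positivity
    refine ⟨D / ε, by positivity, fun t ht x hx => ?_⟩
    have h1 : v t x ≤ m / 4 * Real.exp (1 - |x| + (d + K) * t) := by
      rcases le_total 0 x with h | h
      · have := vexp (-1) (Or.inr rfl) t ht.1 x
        rw [abs_of_nonneg h]
        convert this using 3; ring
      · have := vexp 1 (Or.inl rfl) t ht.1 x
        rw [abs_of_nonpos h]
        convert this using 3; ring
    have h2 : m / 4 * Real.exp (1 - |x| + (d + K) * t) ≤ D / Real.exp |x| := by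
      rw [hD, mul_div_assoc, ← Real.exp_sub]
      refine mul_le_mul_of_nonneg_left (Real.exp_le_exp.2 ?_) (by positivity)
      have := mul_le_mul_of_nonneg_left ht.2 (by positivity : 0 ≤ d + K)
      linarith
    refine (h1.trans h2).trans ?_
    rw [div_le_iff₀ hε] at hx
    rw [div_le_iff₀ (Real.exp_pos _)]
    have := Real.add_one_le_exp |x|
    nlinarith

end

/-- Theorem 1.2: the spreading speeds `c*₊,μ`, `c*₋,μ` of the free boundary problem are
nondecreasing in `μ` and converge, as `μ → ∞`, to the spreading speeds `c̄*₊`, `c̄*₋`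
of the Cauchy problem. -/
theorem spreading_speed_limit_mu
    (d ω L : ℝ) (hd : 0 < d) (hω : 0 < ω) (hL : 0 < L)
    (f : ℝ → ℝ → ℝ → ℝ) (hf : BasicAssumptions ω L f)
    (p : ℝ → ℝ → ℝ) (hp : HypH d ω L f p)
    (cbarplus cbarminus : ℝ) (hcbp : 0 < cbarplus) (hcbm : 0 < cbarminus)
    -- `c̄*₊` and `c̄*₋` are the spreading speeds of the Cauchy problem:
    (hcauchy : ∀ v₀ : ℝ → ℝ, Continuous v₀ → HasCompactSupport v₀ →
      (∀ x, 0 ≤ v₀ x) → (∀ x, v₀ x ≤ p 0 x) → (∃ x, v₀ x ≠ 0) →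
      ∀ v : ℝ → ℝ → ℝ, IsCauchySolution d f v₀ v →
        (∀ c₁ c₂ : ℝ, -cbarminus < -c₂ → -c₂ < c₁ → c₁ < cbarplus →
          ∀ ε > 0, ∃ T, ∀ t ≥ T, ∀ x ∈ Set.Icc (-c₂ * t) (c₁ * t), |v t x - p t x| ≤ ε) ∧
        (∀ c₁' c₂' : ℝ, cbarminus < c₂' → cbarplus < c₁' →
          ∀ ε > 0, ∃ T, ∀ t ≥ T, ∀ x : ℝ, (x ≤ -c₂' * t ∨ c₁' * t ≤ x) → |v t x| ≤ ε))
    (cplus cminus : ℝ → ℝ)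
    (hpos : ∀ μ > (0:ℝ), 0 < cplus μ ∧ 0 < cminus μ)
    -- for each `μ > 0`, `c*₋,μ = cminus μ` and `c*₊,μ = cplus μ` satisfy the conclusion
    -- of Theorem 1.1 for the free boundary problem with parameter `μ`:
    (hconcl : ∀ μ > (0:ℝ), Theorem11Conclusion d μ f p (cminus μ) (cplus μ))
    -- for each `μ > 0` there exists at least one solution satisfying the spreading
    -- hypotheses of Theorem 1.1:
    (hexists : ∀ μ > (0:ℝ), ∃ (g₀ h₀ : ℝ) (u₀ : ℝ → ℝ) (u : ℝ → ℝ → ℝ) (g h : ℝ → ℝ),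
      g₀ < h₀ ∧ memH g₀ h₀ u₀ ∧ (∀ x ∈ Set.Icc g₀ h₀, u₀ x ≤ p 0 x) ∧
      IsFBPSolution d μ f g₀ h₀ u₀ u g h ∧
      Tendsto h atTop atTop ∧ Tendsto g atTop atBot ∧
      (∀ A > (0:ℝ), ∀ ε > 0, ∃ T, ∀ t ≥ T, ∀ x ∈ Set.Icc (-A) A, |u t x - p t x| ≤ ε)) :
    MonotoneOn cplus (Set.Ioi 0) ∧ MonotoneOn cminus (Set.Ioi 0) ∧
    Tendsto cplus atTop (𝓝 cbarplus) ∧ Tendsto cminus atTop (𝓝 cbarminus) := by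
  exact final_of_exist d ω L hd hω hL f hf p hp (cauchy_exists hd hω hL hf) cbarplus cbarminus hcbp hcbm
    hcauchy cplus cminus hpos hconcl hexists
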